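/- Let n ≥ 5, a ≥ 0 and p > 1, with either p ≤ (n+4+2a)/(n-4), or p > (n+4+2a)/(n-4) together with p·ℓ₁ > n(n-4)/2 and p·ℓ₂ > n²(n-4)²/16. Let u be a smooth solution of Δ²u = |x|^a |u|^{p-1} u on ℝ^n that is stable outside some compact set of ℝ^n, and set β = (4+a)/(p-1). Then there exist constants C and R* > 0 such that |u(x)| ≤ C |x|^{−β} for all |x| ≥ R*, and moreover Σ_{k=0}^{3} |x|^{β+k} |∇^k u(x)| ≤ C for all |x| ≥ 3R*, where ∇^k u denotes the k-th total derivative of u. -/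

import Mathlib

open MeasureTheory Metric Set Filter
open scoped RealInnerProductSpace Topology

noncomputable section

/-- The Laplacian of `u : ℝⁿ → ℝ` at `x`, as the sum of the pure second
partial derivatives in the coordinate directions. -/
def lap (n : ℕ) (u : EuclideanSpace ℝ (Fin n) → ℝ) (x : EuclideanSpace ℝ (Fin n)) : ℝ :=
  ∑ i : Fin n, iteratedFDeriv ℝ 2 u x ![EuclideanSpace.single i 1, EuclideanSpace.single i 1]

/-- `u` solves `Δ²u = |x|^a |u|^(p-1) u` pointwise on `Ω`. -/
def IsSolutionOn (n : ℕ) (a p : ℝ) (u : EuclideanSpace ℝ (Fin n) → ℝ)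
    (Ω : Set (EuclideanSpace ℝ (Fin n))) : Prop :=
  ∀ x ∈ Ω, lap n (lap n u) x = ‖x‖ ^ a * |u x| ^ (p - 1) * u x

/-- `u` is a stable solution on `Ω`:
`p ∫ |x|^a |u|^(p-1) ψ² ≤ ∫ (Δψ)²` for every test function `ψ ∈ C_c^∞(Ω)`. -/
def StableOn (n : ℕ) (a p : ℝ) (u : EuclideanSpace ℝ (Fin n) → ℝ)
    (Ω : Set (EuclideanSpace ℝ (Fin n))) : Prop :=
  ∀ ψ : EuclideanSpace ℝ (Fin n) → ℝ, ContDiff ℝ (⊤ : ℕ∞) ψ → HasCompactSupport ψ →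
    tsupport ψ ⊆ Ω →
    p * ∫ x, ‖x‖ ^ a * |u x| ^ (p - 1) * ψ x ^ 2 ≤ ∫ x, lap n ψ x ^ 2

/-- Surface integral of `f` over the sphere `∂B_r(x)`, with respect to the
`(n-1)`-dimensional Hausdorff measure. -/
def sphInt (n : ℕ) (x : EuclideanSpace ℝ (Fin n)) (r : ℝ)
    (f : EuclideanSpace ℝ (Fin n) → ℝ) : ℝ :=
  ∫ y in sphere x r, f y ∂(Measure.hausdorffMeasure ((n : ℝ) - 1))

/-- Radial derivative of `u` at `y`, relative to the center `x`. -/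
def radDeriv (n : ℕ) (x : EuclideanSpace ℝ (Fin n))
    (u : EuclideanSpace ℝ (Fin n) → ℝ) (y : EuclideanSpace ℝ (Fin n)) : ℝ :=
  ⟪gradient u y, ‖y - x‖⁻¹ • (y - x)⟫

/-- `ℓ₁ = (β+2)(n-4-β) + β(n-2-β)` with `β = (4+a)/(p-1)`. -/
def ell1 (n : ℕ) (a p : ℝ) : ℝ :=
  let β : ℝ := (4 + a) / (p - 1)
  (β + 2) * ((n : ℝ) - 4 - β) + β * ((n : ℝ) - 2 - β)

/-- `ℓ₂ = β(β+2)(n-4-β)(n-2-β)` with `β = (4+a)/(p-1)`. -/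
def ell2 (n : ℕ) (a p : ℝ) : ℝ :=
  let β : ℝ := (4 + a) / (p - 1)
  β * (β + 2) * ((n : ℝ) - 4 - β) * ((n : ℝ) - 2 - β)

/-- The constant `c(n,p,a) = 2(ρ - γ - 1)`, `ρ = n-1-2β`, `γ = β(β-n+2)`. -/
def cConst (n : ℕ) (a p : ℝ) : ℝ :=
  let β : ℝ := (4 + a) / (p - 1)
  2 * (((n : ℝ) - 1 - 2 * β) - β * (β - (n : ℝ) + 2) - 1)

/-- The rescaled energy `E(r; x, u)` from the monotonicity formula. -/
def energyE (n : ℕ) (a p : ℝ) (u : EuclideanSpace ℝ (Fin n) → ℝ)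
    (x : EuclideanSpace ℝ (Fin n)) (r : ℝ) : ℝ :=
  let β : ℝ := (4 + a) / (p - 1)
  r ^ (2 * β + 4 - (n : ℝ)) *
      (∫ y in ball x r,
        (1 / 2) * lap n u y ^ 2 - (1 / (p + 1)) * ‖y‖ ^ a * |u y| ^ (p + 1))
    + β / 2 * ((n : ℝ) - 2 - β) *
        deriv (fun ρ : ℝ => ρ ^ (2 * β + 1 - (n : ℝ)) * sphInt n x ρ fun y => u y ^ 2) r
    + β / 2 * ((n : ℝ) - 2 - β) *
        deriv (fun ρ : ℝ => ρ ^ (2 * β + 2 - (n : ℝ)) * sphInt n x ρ fun y => u y ^ 2) r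
    + r ^ 3 / 2 *
        deriv (fun ρ : ℝ => ρ ^ (2 * β + 1 - (n : ℝ)) *
          sphInt n x ρ fun y => (β * ρ⁻¹ * u y + radDeriv n x u y) ^ 2) r
    + 1 / 2 *
        deriv (fun ρ : ℝ => ρ ^ (2 * β + 4 - (n : ℝ)) *
          sphInt n x ρ fun y => ‖gradient u y‖ ^ 2 - radDeriv n x u y ^ 2) r
    + 1 / 2 * r ^ (2 * β + 3 - (n : ℝ)) *
        (sphInt n x r fun y => ‖gradient u y‖ ^ 2 - radDeriv n x u y ^ 2)

end

noncomputable section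

/-- Euclidean space of dimension `n`. -/
abbrev Eu (n : ℕ) := EuclideanSpace ℝ (Fin n)

/-- The algebra of smooth functions on `ℝⁿ`. -/
def Sm (n : ℕ) : Subalgebra ℝ (Eu n → ℝ) where
  carrier := {f | ContDiff ℝ (⊤ : ℕ∞) f}
  mul_mem' {f g} hf hg := by
    rw [Set.mem_ofPred_eq] at hf hg ⊢
    exact ContDiff.mul hf hg
  add_mem' {f g} hf hg := by
    rw [Set.mem_ofPred_eq] at hf hg ⊢
    exact ContDiff.add hf hg
  algebraMap_mem' c := by
    rw [Set.mem_ofPred_eq]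
    exact contDiff_const

variable {n : ℕ}

instance : CoeFun (Sm n) fun _ => Eu n → ℝ := ⟨fun f => f.1⟩

lemma Sm.smooth (f : Sm n) : ContDiff ℝ (⊤ : ℕ∞) (f.1) := by
  have := f.2
  exact this
@[fun_prop] lemma Sm.cont (f : Sm n) : Continuous f.1 := (Sm.smooth f).continuous
lemma Sm.diff (f : Sm n) : Differentiable ℝ f.1 := (Sm.smooth f).differentiable (by simp)
@[ext] lemma Sm.ext {f g : Sm n} (h : ∀ x, f x = g x) : f = g := Subtype.ext (funext h)
@[simp] lemma Sm.add_apply (f g : Sm n) (x : Eu n) : (f + g) x = f x + g x := rfl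
@[simp] lemma Sm.mul_apply (f g : Sm n) (x : Eu n) : (f * g) x = f x * g x := rfl
@[simp] lemma Sm.sub_apply (f g : Sm n) (x : Eu n) : (f - g) x = f x - g x := rfl
@[simp] lemma Sm.neg_apply (f : Sm n) (x : Eu n) : (-f) x = -f x := rfl
@[simp] lemma Sm.smul_apply (c : ℝ) (f : Sm n) (x : Eu n) : (c • f) x = c * f x := rfl
@[simp] lemma Sm.pow_apply (f : Sm n) (k : ℕ) (x : Eu n) : (f ^ k) x = f x ^ k := rfl
@[simp] lemma Sm.zero_apply (x : Eu n) : (0 : Sm n) x = 0 := rfl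
@[simp] lemma Sm.one_apply (x : Eu n) : (1 : Sm n) x = 1 := rfl
@[simp] lemma Sm.sum_apply {ι : Type*} (s : Finset ι) (f : ι → Sm n) (x : Eu n) :
    (∑ i ∈ s, f i) x = ∑ i ∈ s, f i x := by
  have : ((∑ i ∈ s, f i : Sm n) : Eu n → ℝ) = ∑ i ∈ s, (f i : Eu n → ℝ) := by
    exact_mod_cast AddSubmonoidClass.coe_finsetSum f s
  rw [this, Finset.sum_apply]

lemma Sm.fderiv_smooth (f : Sm n) : ContDiff ℝ (⊤ : ℕ∞) (fderiv ℝ f.1) :=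
  (Sm.smooth f).fderiv_right (m := (⊤ : ℕ∞)) (by simp)

/-- The derivation `f ↦ (x ↦ f'(x)(A x + b))` along an affine vector field. -/
def Der (A : Eu n →L[ℝ] Eu n) (b : Eu n) : Derivation ℝ (Sm n) (Sm n) :=
  Derivation.mk'
    { toFun := fun f => ⟨fun x => fderiv ℝ f.1 x (A x + b),
        (Sm.fderiv_smooth f).clm_apply (A.contDiff.add contDiff_const)⟩
      map_add' := fun f g => by
        ext x
        change fderiv ℝ (f.1 + g.1) x _ = _
        rw [fderiv_add (Sm.diff f x) (Sm.diff g x)]; rfl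
      map_smul' := fun c f => by
        ext x
        change fderiv ℝ (c • f.1) x _ = _
        rw [fderiv_const_smul (Sm.diff f x)]; rfl }
    fun f g => by
      ext x
      change fderiv ℝ (f.1 * g.1) x _ = _
      rw [fderiv_mul (Sm.diff f x) (Sm.diff g x)]; rfl

lemma Der_apply (A : Eu n →L[ℝ] Eu n) (b : Eu n) (f : Sm n) (x : Eu n) :
    Der A b f x = fderiv ℝ f.1 x (A x + b) := rfl

lemma Der_mul (A : Eu n →L[ℝ] Eu n) (b : Eu n) (f g : Sm n) :
    Der A b (f * g) = Der A b f * g + f * Der A b g := by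
  rw [Derivation.leibniz, smul_eq_mul, smul_eq_mul]; ring

lemma Der_Der_apply (A B : Eu n →L[ℝ] Eu n) (b d : Eu n) (f : Sm n) (x : Eu n) :
    Der A b (Der B d f) x =
      fderiv ℝ (fderiv ℝ f.1) x (A x + b) (B x + d) + fderiv ℝ f.1 x (B (A x + b)) := by
  rw [Der_apply]
  have h1 : DifferentiableAt ℝ (fderiv ℝ f.1) x :=
    (Sm.fderiv_smooth f).differentiable (by simp) x
  have h2 : HasFDerivAt (fun y : Eu n => B y + d) B x := B.hasFDerivAt.add_const d
  have := h1.hasFDerivAt.clm_apply h2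
  change fderiv ℝ (fun y => fderiv ℝ f.1 y (B y + d)) x _ = _
  rw [this.fderiv]
  simp only [add_apply, ContinuousLinearMap.comp_apply,
    ContinuousLinearMap.flip_apply]
  rw [add_comm]

lemma Sm.fderiv_symm (f : Sm n) (x v w : Eu n) :
    fderiv ℝ (fderiv ℝ f.1) x v w = fderiv ℝ (fderiv ℝ f.1) x w v := by
  have : IsSymmSndFDerivAt ℝ f.1 x :=
    ((Sm.smooth f).contDiffAt).isSymmSndFDerivAt (by
      rw [minSmoothness_of_isRCLikeNormedField]
      exact WithTop.coe_le_coe.2 (le_top : (2 : ℕ∞) ≤ ⊤))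
  exact this _ _

lemma Der_comm {A B : Eu n →L[ℝ] Eu n} {b d : Eu n}
    (h : ∀ x, A (B x + d) = B (A x + b)) (f : Sm n) :
    Der A b (Der B d f) = Der B d (Der A b f) := by
  ext x
  rw [Der_Der_apply, Der_Der_apply, h, Sm.fderiv_symm]

lemma Der_congr_at {A : Eu n →L[ℝ] Eu n} {b : Eu n} {f g : Sm n} {x : Eu n}
    (h : f.1 =ᶠ[𝓝 x] g.1) : Der A b f x = Der A b g x := by
  rw [Der_apply, Der_apply, h.fderiv_eq]

/-- Integration against a compactly supported smooth weight. -/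
def J (η : Sm n) : Sm n →ₗ[ℝ] ℝ :=
  open Classical in
  if h : HasCompactSupport η.1 then
    { toFun := fun f => ∫ x, η x * f x
      map_add' := fun f g => by
        have hi : ∀ f : Sm n, Integrable (fun x => η x * f x) := fun f =>
          ((Sm.cont η).mul (Sm.cont f)).integrable_of_hasCompactSupport (h.mul_right)
        rw [← integral_add (hi f) (hi g)]
        simp [mul_add]
      map_smul' := fun c f => by
        simp only [Sm.smul_apply, RingHom.id_apply, smul_eq_mul, ← integral_const_mul]
        congr 1; ext x; ring }
  else 0

/-- Compact support of a smooth function. -/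
abbrev Cs (η : Sm n) : Prop := HasCompactSupport η.1

lemma Cs.mul {η : Sm n} (h : Cs η) (f : Sm n) : Cs (η * f) := HasCompactSupport.mul_right h
lemma Cs.mul' {η : Sm n} (h : Cs η) (f : Sm n) : Cs (f * η) := HasCompactSupport.mul_left h
lemma Cs.smul {η : Sm n} (h : Cs η) (c : ℝ) : Cs (c • η) :=
  HasCompactSupport.smul_left (f := fun _ => c) h
lemma Cs.add {η θ : Sm n} (h : Cs η) (h' : Cs θ) : Cs (η + θ) := HasCompactSupport.add h h'
lemma Cs.der {η : Sm n} (h : Cs η) (A : Eu n →L[ℝ] Eu n) (b : Eu n) : Cs (Der A b η) := by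
  refine HasCompactSupport.intro h fun x hx => ?_
  rw [Der_apply, image_eq_zero_of_notMem_tsupport (f := fderiv ℝ η.1)]
  · rfl
  · exact fun h => hx (tsupport_fderiv_subset ℝ h)
lemma Cs.sum {ι : Type*} {s : Finset ι} {f : ι → Sm n} (h : ∀ i ∈ s, Cs (f i)) :
    Cs (∑ i ∈ s, f i) := by
  classical
  induction s using Finset.induction_on with
  | empty =>
    rw [Finset.sum_empty]
    exact HasCompactSupport.zero
  | insert a s ha ih =>
    rw [Finset.sum_insert ha]
    exact (h a (by simp)).add (ih fun i hi => h i (by simp [hi]))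

lemma Cs.integrable {η : Sm n} (h : Cs η) : Integrable η.1 :=
  (Sm.cont η).integrable_of_hasCompactSupport h

lemma J_apply {η : Sm n} (h : Cs η) (f : Sm n) : J η f = ∫ x, η x * f x := by
  rw [J, dif_pos h]; rfl

lemma J_one {η : Sm n} (h : Cs η) : J η 1 = ∫ x, η x := by simp [J_apply h]

lemma J_mul {η : Sm n} (h : Cs η) (f g : Sm n) : J η (f * g) = J (η * f) g := by
  rw [J_apply h, J_apply (h.mul f)]
  simp [mul_assoc]

lemma J_eq_one {η : Sm n} (h : Cs η) (f : Sm n) : J η f = J (η * f) 1 := by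
  rw [← J_mul h, mul_one]

lemma J_add {η θ : Sm n} (h : Cs η) (h' : Cs θ) (f : Sm n) : J (η + θ) f = J η f + J θ f := by
  rw [J_eq_one (h.add h'), J_eq_one h, J_eq_one h', J_one ((h.add h').mul f), J_one (h.mul f),
    J_one (h'.mul f), ← integral_add (h.mul f).integrable (h'.mul f).integrable]
  simp [add_mul]

lemma J_smul {η : Sm n} (h : Cs η) (c : ℝ) (f : Sm n) : J (c • η) f = c * J η f := by
  rw [J_eq_one (h.smul c), J_eq_one h, J_one ((h.smul c).mul f), J_one (h.mul f),
    ← integral_const_mul]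
  simp

lemma J_neg {η : Sm n} (h : Cs η) (f : Sm n) : J (-η) f = - J η f := by
  have := J_smul h (-1) f
  simpa using this

lemma J_mono {η θ f g : Sm n} (h : Cs η) (h' : Cs θ) (hle : ∀ x, η x * f x ≤ θ x * g x) :
    J η f ≤ J θ g := by
  rw [J_apply h, J_apply h']
  exact integral_mono (h.mul f).integrable (h'.mul g).integrable hle

lemma J_congr {η θ f g : Sm n} (h : Cs η) (h' : Cs θ) (hle : ∀ x, η x * f x = θ x * g x) :
    J η f = J θ g :=
  le_antisymm (J_mono h h' fun x => (hle x).le) (J_mono h' h fun x => (hle x).ge)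

lemma J_nonneg {η f : Sm n} (h : Cs η) (hle : ∀ x, 0 ≤ η x * f x) : 0 ≤ J η f := by
  rw [J_apply h]
  exact integral_nonneg hle

end

noncomputable section
variable {n : ℕ}

/-- The partial derivative in direction `i`. -/
def pd (i : Fin n) : Derivation ℝ (Sm n) (Sm n) := Der 0 (EuclideanSpace.single i 1)

/-- The Euler derivation `x · ∇`. -/
def DE : Derivation ℝ (Sm n) (Sm n) := Der (ContinuousLinearMap.id ℝ _) 0

/-- The `i`-th coordinate function. -/
def xc (i : Fin n) : Sm n := ⟨fun x => x i, by
  change ContDiff ℝ (⊤ : ℕ∞) fun x : Eu n => x i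
  fun_prop⟩

@[simp] lemma xc_apply (i : Fin n) (x : Eu n) : xc i x = x i := rfl

/-- The squared norm. -/
def qn : Sm n := ∑ i, xc i * xc i

@[simp] lemma qn_apply (x : Eu n) : qn x = ‖x‖ ^ 2 := by
  rw [EuclideanSpace.real_norm_sq_eq]
  simp [qn, sq]

/-- The Laplacian on smooth functions. -/
def LP (f : Sm n) : Sm n := ∑ i, pd i (pd i f)

/-- The inner product of gradients. -/
def Gm (f g : Sm n) : Sm n := ∑ i, pd i f * pd i g

lemma pd_apply (i : Fin n) (f : Sm n) (x : Eu n) :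
    pd i f x = fderiv ℝ f.1 x (EuclideanSpace.single i 1) := by
  simp [pd, Der_apply]

lemma DE_apply (f : Sm n) (x : Eu n) : DE f x = fderiv ℝ f.1 x x := by
  simp [DE, Der_apply]

lemma pd_pd_apply (i j : Fin n) (f : Sm n) (x : Eu n) : pd i (pd j f) x =
    fderiv ℝ (fderiv ℝ f.1) x (EuclideanSpace.single i 1) (EuclideanSpace.single j 1) := by
  rw [pd, pd, Der_Der_apply]; simp

lemma lap_eq (f : Sm n) : lap n f.1 = (LP f).1 := by
  ext x
  simp only [lap, LP, Sm.sum_apply, pd_pd_apply, iteratedFDeriv_two_apply]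
  rfl

lemma pd_xc (i j : Fin n) : pd i (xc j) = if i = j then 1 else 0 := by
  ext x
  rw [pd_apply]
  have : (xc j).1 = fun x : Eu n => EuclideanSpace.proj (𝕜 := ℝ) j x := rfl
  rw [this, ContinuousLinearMap.fderiv]
  split_ifs with h <;> simp [h]

lemma pd_mul (i : Fin n) (f g : Sm n) : pd i (f * g) = pd i f * g + f * pd i g := Der_mul _ _ _ _
lemma DE_mul (f g : Sm n) : DE (f * g) = DE f * g + f * DE g := Der_mul _ _ _ _

lemma DE_add (f g : Sm n) : DE (f + g) = DE f + DE g := map_add _ _ _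
lemma DE_sub (f g : Sm n) : DE (f - g) = DE f - DE g := map_sub _ _ _
lemma DE_smul (c : ℝ) (f : Sm n) : DE (c • f) = c • DE f := Derivation.map_smul _ _ _
lemma pd_smul (i : Fin n) (c : ℝ) (f : Sm n) : pd i (c • f) = c • pd i f :=
  Derivation.map_smul _ _ _

lemma DE_eq (f : Sm n) : DE f = ∑ i, xc i * pd i f := by
  ext x
  rw [DE_apply]
  simp only [Sm.sum_apply, Sm.mul_apply, pd_apply, xc_apply]
  have h := congrArg (fderiv ℝ f.1 x) ((EuclideanSpace.basisFun (Fin n) ℝ).sum_repr x)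
  rw [← h, map_sum]
  simp

lemma pd_DE (i : Fin n) (f : Sm n) : pd i (DE f) = DE (pd i f) + pd i f := by
  ext x
  rw [Sm.add_apply, pd, DE, Der_Der_apply, Der_Der_apply, Der_apply]
  simp [Sm.fderiv_symm f x x]

lemma DE_xc (i : Fin n) : DE (xc i) = xc i := by
  simp [DE_eq, pd_xc]

lemma DE_qn : DE (qn : Sm n) = (2 : ℝ) • qn := by
  simp only [qn, map_sum, DE_mul, DE_xc, Finset.smul_sum]
  exact Finset.sum_congr rfl fun i _ => by rw [two_smul]

lemma LP_DE (f : Sm n) : LP (DE f) = DE (LP f) + (2 : ℝ) • LP f := by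
  simp only [LP, pd_DE, map_add, map_sum, Finset.smul_sum, ← Finset.sum_add_distrib]
  exact Finset.sum_congr rfl fun i _ => by rw [two_smul]; abel

lemma LP_add (f g : Sm n) : LP (f + g) = LP f + LP g := by
  simp [LP, Finset.sum_add_distrib]
lemma LP_smul (c : ℝ) (f : Sm n) : LP (c • f) = c • LP f := by
  simp [LP, Finset.smul_sum]

lemma LP_mul (f g : Sm n) : LP (f * g) = f * LP g + g * LP f + (2 : ℝ) • Gm f g := by
  simp only [LP, Gm, pd_mul, map_add, Finset.mul_sum, Finset.smul_sum, ← Finset.sum_add_distrib]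
  exact Finset.sum_congr rfl fun i _ => by rw [two_smul]; ring

lemma Gm_comm (f g : Sm n) : Gm f g = Gm g f := by
  simp [Gm, mul_comm]
lemma Gm_mul_left (f g h : Sm n) : Gm (f * g) h = f * Gm g h + g * Gm f h := by
  simp only [Gm, pd_mul, Finset.mul_sum, ← Finset.sum_add_distrib]
  exact Finset.sum_congr rfl fun i _ => by ring
lemma Gm_self_apply (f : Sm n) (x : Eu n) : Gm f f x = ∑ i, pd i f x ^ 2 := by
  simp [Gm, sq]
lemma Gm_sq_le (f g : Sm n) (x : Eu n) : Gm f g x ^ 2 ≤ Gm f f x * Gm g g x := by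
  simp only [Gm_self_apply]
  simp only [Gm, Sm.sum_apply, Sm.mul_apply]
  exact Finset.sum_mul_sq_le_sq_mul_sq _ _ _
lemma Cs.pd {η : Sm n} (h : Cs η) (i : Fin n) : Cs (pd i η) := h.der _ _
lemma Cs.DE {η : Sm n} (h : Cs η) : Cs (DE η) := h.der _ _
lemma Cs.LP {η : Sm n} (h : Cs η) : Cs (LP η) := Cs.sum fun i _ => (h.pd i).pd i
lemma Cs.Gm {η : Sm n} (h : Cs η) (f : Sm n) : Cs (Gm η f) :=
  Cs.sum fun i _ => (h.pd i).mul _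

lemma J_pd {η : Sm n} (h : Cs η) (i : Fin n) (f : Sm n) : J η (pd i f) = -J (pd i η) f := by
  rw [J_apply h, J_apply (h.pd i)]
  simp only [pd_apply]
  refine integral_mul_fderiv_eq_neg_fderiv_mul_of_integrable ?_ ?_ ?_ ?_ ?_
  · have := ((h.pd i).mul f).integrable
    refine this.congr (ae_of_all _ fun x => ?_)
    simp [pd_apply]
  · have := (h.mul (_root_.pd i f)).integrable
    refine this.congr (ae_of_all _ fun x => ?_)
    simp [pd_apply]
  · exact (h.mul f).integrable
  · exact fun x _ => Sm.diff η x
  · exact fun x _ => Sm.diff f x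

lemma J_sum_left {ι : Type*} (s : Finset ι) {η : ι → Sm n} (h : ∀ i ∈ s, Cs (η i)) (f : Sm n) :
    J (∑ i ∈ s, η i) f = ∑ i ∈ s, J (η i) f := by
  classical
  induction s using Finset.induction_on with
  | empty =>
    have : Cs (0 : Sm n) := HasCompactSupport.zero
    simp [J_apply this]
  | insert a s ha ih =>
    have h2 : ∀ i ∈ s, Cs (η i) := fun i hi => h i (by simp [hi])
    rw [Finset.sum_insert ha, Finset.sum_insert ha, J_add (h a (by simp)) (Cs.sum h2), ih h2]

lemma J_DE {η : Sm n} (h : Cs η) (f : Sm n) : J η (DE f) = -J (DE η + (n : ℝ) • η) f := by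
  have h1 : DE η + (n : ℝ) • η = ∑ i, pd i (η * xc i) := by
    simp only [pd_mul, pd_xc, if_true, mul_one, Finset.sum_add_distrib, DE_eq]
    congr 1
    · simp [mul_comm]
    · simp [← Nat.cast_smul_eq_nsmul ℝ]
  rw [h1, J_sum_left _ fun i _ => (h.mul (xc i)).pd i, DE_eq, map_sum, ← Finset.sum_neg_distrib]
  refine Finset.sum_congr rfl fun i _ => ?_
  rw [J_mul h, J_pd (h.mul _)]

lemma J_LP {η : Sm n} (h : Cs η) (f : Sm n) : J η (LP f) = J (LP η) f := by
  rw [LP, LP, map_sum, J_sum_left _ fun i _ => (h.pd i).pd i]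
  refine Finset.sum_congr rfl fun i _ => ?_
  rw [J_pd h, J_pd (h.pd i), neg_neg]

lemma J_mul_LP {η : Sm n} (h : Cs η) (f g : Sm n) :
    J η (f * LP g) = -J η (Gm f g) - J (Gm η g) f := by
  have e : f * LP g = ∑ i, (pd i (f * pd i g) - pd i f * pd i g) := by
    simp only [LP, pd_mul, Finset.mul_sum]
    exact Finset.sum_congr rfl fun i _ => by ring
  have e2 : J (Gm η g) f = ∑ i, J (pd i η) (f * pd i g) := by
    rw [Gm, J_sum_left _ fun i _ => (h.pd i).mul _]
    refine Finset.sum_congr rfl fun i _ => ?_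
    rw [mul_comm f, J_mul (h.pd i)]
  rw [e, map_sum, e2, Gm, map_sum, ← Finset.sum_neg_distrib, ← Finset.sum_sub_distrib]
  refine Finset.sum_congr rfl fun i _ => ?_
  rw [map_sub, J_pd h]
  ring

/-- The angular part of `|x|²Δ`. -/
def LA (f : Sm n) : Sm n := qn * LP f - DE (DE f) - ((n : ℝ) - 2) • DE f

/-- The carré du champ of the angular part of `|x|²Δ`. -/
def GA (f g : Sm n) : Sm n := qn * Gm f g - DE f * DE g

lemma LA_add (f g : Sm n) : LA (f + g) = LA f + LA g := by
  simp only [LA, LP_add, DE_add, smul_add]; ring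
lemma LA_smul (c : ℝ) (f : Sm n) : LA (c • f) = c • LA f := by
  ext x
  simp only [LA, LP_smul, DE_smul, Sm.sub_apply, Sm.smul_apply, Sm.mul_apply]; ring
lemma DE_LA (f : Sm n) : DE (LA f) = LA (DE f) := by
  ext x
  simp only [LA, LP_DE, DE_sub, DE_smul, DE_mul, DE_qn, Sm.sub_apply, Sm.smul_apply,
    Sm.mul_apply, Sm.add_apply]; ring
lemma LA_mul (f g : Sm n) : LA (f * g) = f * LA g + g * LA f + (2 : ℝ) • GA f g := by
  ext x
  simp only [LA, GA, LP_mul, DE_add, DE_mul, Sm.sub_apply, Sm.smul_apply,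
    Sm.mul_apply, Sm.add_apply]; ring
lemma GA_comm (f g : Sm n) : GA f g = GA g f := by
  rw [GA, GA, Gm_comm, mul_comm (DE f)]
lemma GA_eq (f g : Sm n) : GA f g = (1 / 2 : ℝ) • (LA (f * g) - f * LA g - g * LA f) := by
  ext x
  rw [LA_mul]
  simp only [Sm.sub_apply, Sm.smul_apply, Sm.mul_apply, Sm.add_apply]; ring
lemma DE_GA (f g : Sm n) : DE (GA f g) = GA (DE f) g + GA f (DE g) := by
  simp only [GA_eq, DE_smul, DE_sub, DE_LA, DE_mul, LA_add]
  ext x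
  simp only [Sm.sub_apply, Sm.smul_apply, Sm.mul_apply, Sm.add_apply]; ring
lemma GA_self_nonneg (f : Sm n) (x : Eu n) : 0 ≤ GA f f x := by
  have h : DE f x = ∑ i, x i * pd i f x := by simp [DE_eq]
  simp only [GA, Sm.sub_apply, Sm.mul_apply, qn_apply, Gm_self_apply, h, sub_nonneg,
    EuclideanSpace.real_norm_sq_eq]
  rw [← sq]
  exact Finset.sum_mul_sq_le_sq_mul_sq Finset.univ (fun i => x i) fun i => pd i f x

end

noncomputable section
variable {n : ℕ} {X Y : ℝ → ℝ}

/-- Smooth profiles vanishing on `(-∞, 1]`. -/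
structure Rd (X : ℝ → ℝ) : Prop where
  smooth : ContDiff ℝ (⊤ : ℕ∞) X
  zero : ∀ t ≤ 1, X t = 0

/-- Smooth profiles vanishing on `(-∞, 1]` and near `+∞`. -/
structure Wn (X : ℝ → ℝ) : Prop extends Rd X where
  zero' : ∃ T, ∀ t, T ≤ t → X t = 0

lemma Rd.diff (h : Rd X) : Differentiable ℝ X := h.smooth.differentiable (by simp)
lemma Rd.cont (h : Rd X) : Continuous X := h.smooth.continuous

lemma smooth_deriv (h : ContDiff ℝ (⊤ : ℕ∞) X) : ContDiff ℝ (⊤ : ℕ∞) (deriv X) :=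
  (contDiff_infty_iff_deriv.1 h).2

lemma Rd.deriv (h : Rd X) : Rd (deriv X) where
  smooth := smooth_deriv h.smooth
  zero := by
    have h1 : ∀ t < 1, _root_.deriv X t = 0 := fun t ht => by
      have : X =ᶠ[𝓝 t] fun _ => 0 := by
        filter_upwards [Iio_mem_nhds ht] with s hs using h.zero s (le_of_lt hs)
      rw [this.deriv_eq]; simp
    intro t ht
    have hc : Continuous (_root_.deriv X) := (smooth_deriv h.smooth).continuous
    have : IsClosed {t | _root_.deriv X t = 0} := isClosed_eq hc continuous_const
    have h2 : closure (Iio (1 : ℝ)) ⊆ {t | _root_.deriv X t = 0} :=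
      this.closure_subset_iff.2 fun t ht => h1 t ht
    rw [closure_Iio] at h2
    exact h2 ht

lemma Rd.mul (h : Rd X) (hY : ContDiff ℝ (⊤ : ℕ∞) Y) : Rd fun t => X t * Y t :=
  ⟨h.smooth.mul hY, fun t ht => by rw [h.zero t ht, zero_mul]⟩
lemma Rd.mul' (h : Rd X) (hY : ContDiff ℝ (⊤ : ℕ∞) Y) : Rd fun t => Y t * X t :=
  ⟨hY.mul h.smooth, fun t ht => by rw [h.zero t ht, mul_zero]⟩
lemma Rd.add (h : Rd X) (hY : Rd Y) : Rd fun t => X t + Y t :=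
  ⟨h.smooth.add hY.smooth, fun t ht => by rw [h.zero t ht, hY.zero t ht, add_zero]⟩
lemma exp_smooth (c : ℝ) : ContDiff ℝ (⊤ : ℕ∞) fun t => Real.exp (c * t) := by fun_prop
lemma Rd.exp (h : Rd X) (c : ℝ) : Rd fun t => Real.exp (c * t) * X t := h.mul' (exp_smooth c)

lemma Wn.deriv (h : Wn X) : Wn (deriv X) where
  toRd := h.toRd.deriv
  zero' := by
    obtain ⟨T, hT⟩ := h.zero'
    refine ⟨T + 1, fun t ht => ?_⟩
    have : X =ᶠ[𝓝 t] fun _ => 0 := by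
      filter_upwards [Ioi_mem_nhds (show T < t by linarith)] with s hs using hT s (le_of_lt hs)
    rw [this.deriv_eq]; simp
lemma Wn.mul (h : Wn X) (hY : ContDiff ℝ (⊤ : ℕ∞) Y) : Wn fun t => X t * Y t :=
  ⟨h.toRd.mul hY, h.zero'.imp fun T hT t ht => by rw [hT t ht, zero_mul]⟩
lemma Wn.mul' (h : Wn X) (hY : ContDiff ℝ (⊤ : ℕ∞) Y) : Wn fun t => Y t * X t :=
  ⟨h.toRd.mul' hY, h.zero'.imp fun T hT t ht => by rw [hT t ht, mul_zero]⟩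
lemma Wn.add (h : Wn X) (hY : Wn Y) : Wn fun t => X t + Y t :=
  ⟨h.toRd.add hY.toRd, by
    obtain ⟨S, hS⟩ := h.zero'
    obtain ⟨T, hT⟩ := hY.zero'
    exact ⟨max S T, fun t ht => by
      rw [hS t ((le_max_left _ _).trans ht), hT t ((le_max_right _ _).trans ht), add_zero]⟩⟩
lemma Wn.const_mul (h : Wn X) (c : ℝ) : Wn fun t => c * X t := h.mul' contDiff_const
lemma Wn.exp (h : Wn X) (c : ℝ) : Wn fun t => Real.exp (c * t) * X t := h.mul' (exp_smooth c)

lemma Rd.comp_smooth (h : Rd X) : ContDiff ℝ (⊤ : ℕ∞) fun x : Eu n => X (Real.log ‖x‖) := by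
  rw [contDiff_iff_contDiffAt]
  intro x
  by_cases hx : x = 0
  · have : (fun x : Eu n => X (Real.log ‖x‖)) =ᶠ[𝓝 x] fun _ => 0 := by
      have : ball (0 : Eu n) 1 ∈ 𝓝 x := by rw [hx]; exact ball_mem_nhds _ one_pos
      filter_upwards [this] with y hy
      refine h.zero _ ?_
      have hy' : ‖y‖ < 1 := by simpa using hy
      linarith [Real.log_nonpos (norm_nonneg y) hy'.le]
    exact contDiffAt_const.congr_of_eventuallyEq this
  · exact h.smooth.contDiffAt.comp x
      ((Real.contDiffAt_log.2 (norm_ne_zero_iff.2 hx)).comp x (contDiffAt_norm ℝ hx))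

/-- The smooth radial function with profile `X` in logarithmic variable. -/
def rad (X : ℝ → ℝ) : Sm n :=
  open Classical in
  if h : Rd X then ⟨fun x => X (Real.log ‖x‖), h.comp_smooth⟩ else 0

lemma rad_apply (h : Rd X) (x : Eu n) : rad X x = X (Real.log ‖x‖) := by
  rw [rad, dif_pos h]

lemma fderiv_rad (h : Rd X) (x v : Eu n) :
    fderiv ℝ (rad X : Sm n).1 x v = ⟪x, v⟫ / ‖x‖ ^ 2 * deriv X (Real.log ‖x‖) := by
  have e : (rad X : Sm n).1 = fun x => X (Real.log ‖x‖) := by rw [rad, dif_pos h]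
  rw [e]
  by_cases hx : x = 0
  · have : (fun x : Eu n => X (Real.log ‖x‖)) =ᶠ[𝓝 x] fun _ => 0 := by
      have : ball (0 : Eu n) 1 ∈ 𝓝 x := by rw [hx]; exact ball_mem_nhds _ one_pos
      filter_upwards [this] with y hy
      refine h.zero _ ?_
      have hy' : ‖y‖ < 1 := by simpa using hy
      linarith [Real.log_nonpos (norm_nonneg y) hy'.le]
    rw [this.fderiv_eq]
    simp [hx]
  · have e2 : (fun x : Eu n => X (Real.log ‖x‖)) = fun x => X (Real.log (‖x‖ ^ 2) / 2) := by
      ext y; rw [Real.log_pow]; congr 1; push_cast; ring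
    have hx2 : ‖x‖ ^ 2 ≠ 0 := pow_ne_zero _ (norm_ne_zero_iff.2 hx)
    have h1 : HasFDerivAt (fun y : Eu n => ‖y‖ ^ 2) (2 • innerSL ℝ x) x :=
      (hasStrictFDerivAt_norm_sq x).hasFDerivAt
    have h2 := (h1.log hx2).mul_const (1 / 2)
    have h3 := (h.diff (Real.log (‖x‖ ^ 2) * (1 / 2))).hasDerivAt.comp_hasFDerivAt x h2
    have e3 : Real.log (‖x‖ ^ 2) * (1 / 2) = Real.log ‖x‖ := by
      rw [Real.log_pow]; push_cast; ring
    have e4 : (fun x : Eu n => X (Real.log ‖x‖)) =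
        X ∘ fun y : Eu n => Real.log (‖y‖ ^ 2) * (1 / 2) := by
      ext y; simp only [Function.comp]; rw [Real.log_pow]; congr 1; push_cast; ring
    rw [e4, h3.fderiv, e3]
    simp
    ring

lemma DE_rad (h : Rd X) : DE (rad X : Sm n) = rad (deriv X) := by
  ext x
  rw [DE_apply, fderiv_rad h, rad_apply h.deriv, real_inner_self_eq_norm_sq]
  by_cases hx : x = 0
  · simp [hx, h.deriv.zero 0 (by norm_num)]
  · rw [div_self (pow_ne_zero _ (norm_ne_zero_iff.2 hx)), one_mul]

lemma exp_neg_two_log {x : Eu n} (hx : x ≠ 0) : Real.exp (-2 * Real.log ‖x‖) = (‖x‖ ^ 2)⁻¹ := by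
  have : 0 < ‖x‖ := norm_pos_iff.2 hx
  rw [show -2 * Real.log ‖x‖ = -Real.log (‖x‖ ^ 2) by rw [Real.log_pow]; push_cast; ring,
    Real.exp_neg, Real.exp_log (by positivity)]

lemma pd_rad (h : Rd X) (i : Fin n) :
    pd i (rad X : Sm n) = xc i * rad fun t => Real.exp (-2 * t) * deriv X t := by
  ext x
  rw [pd_apply, fderiv_rad h, Sm.mul_apply, rad_apply (h.deriv.exp _)]
  by_cases hx : x = 0
  · simp [hx]
  · rw [exp_neg_two_log hx, real_inner_comm, EuclideanSpace.inner_single_left]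
    simp
    ring

lemma qn_rad (h : Rd X) : (qn : Sm n) * rad (fun t => Real.exp (-2 * t) * X t) = rad X := by
  ext x
  rw [Sm.mul_apply, rad_apply h, rad_apply (h.exp _), qn_apply]
  by_cases hx : x = 0
  · simp [hx, h.zero 0 (by norm_num)]
  · rw [exp_neg_two_log hx, ← mul_assoc, mul_inv_cancel₀ (pow_ne_zero _ (norm_ne_zero_iff.2 hx)),
      one_mul]

lemma rad_add (h : Rd X) (hY : Rd Y) : (rad X : Sm n) + rad Y = rad fun t => X t + Y t := by
  ext x
  rw [Sm.add_apply, rad_apply h, rad_apply hY, rad_apply (h.add hY)]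

lemma rad_smul (h : Rd X) (c : ℝ) : c • (rad X : Sm n) = rad fun t => c * X t := by
  ext x
  rw [Sm.smul_apply, rad_apply h, rad_apply (h.mul' contDiff_const)]

lemma Gm_rad (h : Rd X) (f : Sm n) :
    Gm (rad X) f = rad (fun t => Real.exp (-2 * t) * deriv X t) * DE f := by
  simp only [Gm, pd_rad h, DE_eq, Finset.mul_sum]
  exact Finset.sum_congr rfl fun i _ => by ring

lemma GA_rad (h : Rd X) (f : Sm n) : GA (rad X) f = 0 := by
  rw [GA, Gm_rad h, ← mul_assoc, qn_rad h.deriv, DE_rad h, sub_self]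

lemma LP_rad (h : Rd X) : LP (rad X : Sm n) =
    rad fun t => Real.exp (-2 * t) * (deriv (deriv X) t + ((n : ℝ) - 2) * deriv X t) := by
  have h2 : Rd fun t => Real.exp (-2 * t) * deriv X t := h.deriv.exp _
  have e : LP (rad X : Sm n) = (n : ℝ) • rad (fun t => Real.exp (-2 * t) * deriv X t) +
      DE (rad fun t => Real.exp (-2 * t) * deriv X t) := by
    simp only [LP, pd_rad h, pd_mul, pd_xc, if_true, one_mul, Finset.sum_add_distrib, DE_eq]
    congr 1
    simp [← Nat.cast_smul_eq_nsmul ℝ]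
  have e2 : deriv (fun t => Real.exp (-2 * t) * deriv X t) =
      fun t => Real.exp (-2 * t) * deriv (deriv X) t - 2 * (Real.exp (-2 * t) * deriv X t) := by
    ext t
    have h1 : HasDerivAt (fun t : ℝ => Real.exp (-2 * t)) (Real.exp (-2 * t) * (-2 * 1)) t :=
      ((hasDerivAt_id t).const_mul (-2)).exp
    rw [(h1.fun_mul (h.deriv.diff t).hasDerivAt).deriv]
    ring
  rw [e, DE_rad h2]
  ext x
  rw [Sm.add_apply, Sm.smul_apply, rad_apply h2, rad_apply h2.deriv, rad_apply, e2]
  · ring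
  · exact (h.deriv.deriv.add (h.deriv.mul' contDiff_const)).exp _

lemma LA_rad (h : Rd X) : LA (rad X : Sm n) = 0 := by
  have hh : Rd fun t => deriv (deriv X) t + ((n : ℝ) - 2) * deriv X t :=
    h.deriv.deriv.add (h.deriv.mul' contDiff_const)
  rw [LA, LP_rad h, qn_rad hh, DE_rad h, DE_rad h.deriv]
  ext x
  rw [Sm.sub_apply, Sm.sub_apply, Sm.smul_apply, rad_apply h.deriv, rad_apply h.deriv.deriv,
    rad_apply hh, Sm.zero_apply]
  ring

lemma LA_rad_mul (h : Rd X) (f : Sm n) : LA (rad X * f) = rad X * LA f := by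
  rw [LA_mul, LA_rad h, GA_rad h]
  simp

lemma Wn.cs (h : Wn X) : Cs (rad X : Sm n) := by
  obtain ⟨T, hT⟩ := h.zero'
  refine HasCompactSupport.intro (isCompact_closedBall (0 : Eu n) (Real.exp T)) fun x hx => ?_
  rw [rad_apply h.toRd]
  have hx' : Real.exp T < ‖x‖ := by simpa using hx
  exact hT _ ((Real.le_log_iff_exp_le ((Real.exp_pos _).trans hx')).2 hx'.le)

/-- Integration on the cylinder `ℝ × S^{n-1}` against the profile `X`. -/
def K (X : ℝ → ℝ) : Sm n →ₗ[ℝ] ℝ := J (rad fun t => Real.exp (-n * t) * X t)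

lemma J_rad_congr (h : ∀ t, X t = Y t) (f : Sm n) : J (rad X) f = J (rad Y) f := by
  rw [show X = Y from funext h]

lemma K_def (X : ℝ → ℝ) (f : Sm n) : K X f = J (rad fun t => Real.exp (-n * t) * X t) f := rfl

lemma K_DE (h : Wn X) (f : Sm n) : K X (DE f) = -K (deriv X) f := by
  rw [K_def, J_DE (h.exp _).cs, K_def, DE_rad (h.exp _).toRd, rad_smul (h.exp _).toRd,
    rad_add (h.exp _).toRd.deriv ((h.exp _).toRd.mul' contDiff_const)]
  congr 1
  refine J_rad_congr (fun t => ?_) f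
  have h1 : HasDerivAt (fun t : ℝ => Real.exp (-n * t)) (Real.exp (-n * t) * (-n * 1)) t :=
      ((hasDerivAt_id t).const_mul _).exp
  rw [(h1.fun_mul (h.diff t).hasDerivAt).deriv]
  ring

lemma K_congr_left (h : ∀ t, X t = Y t) (f : Sm n) : K X f = K Y f := by
  rw [show X = Y from funext h]

lemma K_add (h : Wn X) (h' : Wn Y) (f : Sm n) : K (fun t => X t + Y t) f = K X f + K Y f := by
  rw [K_def, K_def, K_def, ← J_add (h.exp _).cs (h'.exp _).cs, rad_add (h.exp _).toRd
    (h'.exp _).toRd]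
  refine J_rad_congr (fun t => ?_) f; ring

lemma K_const_mul (h : Wn X) (c : ℝ) (f : Sm n) : K (fun t => c * X t) f = c * K X f := by
  rw [K_def, K_def, ← J_smul (h.exp _).cs, rad_smul (h.exp _).toRd]
  refine J_rad_congr (fun t => ?_) f; ring

lemma K_mul_LA (h : Wn X) (f g : Sm n) : K X (f * LA g) = -K X (GA f g) := by
  set Z : ℝ → ℝ := fun t => Real.exp ((2 - n) * t) * X t with hZdef
  have hZ : Wn Z := h.exp _
  have h0 : (rad fun t => Real.exp (-n * t) * X t) * (qn : Sm n) = rad Z := by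
    have e : (fun t => Real.exp (-n * t) * X t) = fun t => Real.exp (-2 * t) * Z t := by
      ext t
      rw [hZdef, ← mul_assoc, ← Real.exp_add]
      congr 2; ring
    rw [mul_comm, ← qn_rad hZ.toRd, e]
  have d1 : ∀ t, HasDerivAt (fun t : ℝ => Real.exp ((2 - n) * t))
      (Real.exp ((2 - n) * t) * ((2 - n) * 1)) t := fun t =>
    ((hasDerivAt_id t).const_mul _).exp
  have e1 : ∀ t, Real.exp (-2 * t) * deriv Z t =
      Real.exp (-n * t) * (deriv X t + (2 - n) * X t) := fun t => by
    rw [hZdef, ((d1 t).fun_mul (h.diff t).hasDerivAt).deriv,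
      show -(n : ℝ) * t = -2 * t + (2 - n) * t by ring, Real.exp_add]
    ring
  have h1 : ∀ u, K X (qn * u) = J (rad Z) u := fun u => by
    rw [K_def, J_mul (h.exp _).cs, h0]
  have h2 : J (Gm (rad Z) g) f = K (deriv X) (f * DE g) + (2 - n) * K X (f * DE g) := by
    rw [Gm_rad hZ.toRd, ← J_mul (hZ.deriv.exp _).cs, mul_comm (DE g), J_rad_congr e1, ← K_def,
      K_add h.deriv (h.const_mul _), K_const_mul h]
  have h3 : K X (f * DE (DE g)) = -K (deriv X) (f * DE g) - K X (DE f * DE g) := by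
    rw [← K_DE h, DE_mul, map_add]; ring
  have e : f * LA g = qn * (f * LP g) - f * DE (DE g) - ((n : ℝ) - 2) • (f * DE g) := by
    ext x
    simp only [LA, Sm.sub_apply, Sm.smul_apply, Sm.mul_apply]; ring
  rw [e, map_sub, map_sub, map_smul, h1, J_mul_LP hZ.cs, h2, h3, GA, map_sub, h1, smul_eq_mul]
  ring

lemma K_mono {f g : Sm n} (h : Wn X) (hX : ∀ t, 0 ≤ X t)
    (hle : ∀ x, X (Real.log ‖x‖) ≠ 0 → f x ≤ g x) : K X f ≤ K X g := by
  rw [K_def, K_def]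
  refine J_mono (h.exp _).cs (h.exp _).cs fun x => ?_
  rw [rad_apply (h.exp _).toRd]
  by_cases h0 : X (Real.log ‖x‖) = 0
  · simp [h0]
  · exact mul_le_mul_of_nonneg_left (hle x h0) (mul_nonneg (Real.exp_pos _).le (hX _))

lemma K_nonneg {f : Sm n} (h : Wn X) (hX : ∀ t, 0 ≤ X t)
    (hle : ∀ x, X (Real.log ‖x‖) ≠ 0 → 0 ≤ f x) : 0 ≤ K X f := by
  have := K_mono (f := 0) h hX hle
  rwa [map_zero] at this

lemma K_congr {f g : Sm n} (h : Wn X) (hle : ∀ x, X (Real.log ‖x‖) ≠ 0 → f x = g x) :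
    K X f = K X g := by
  rw [K_def, K_def]
  refine J_congr (h.exp _).cs (h.exp _).cs fun x => ?_
  rw [rad_apply (h.exp _).toRd]
  by_cases h0 : X (Real.log ‖x‖) = 0
  · simp [h0]
  · rw [hle x h0]

lemma K_mono_left {f : Sm n} (h : Wn X) (hY : Wn Y) (hle : ∀ t, X t ≤ Y t)
    (hf : ∀ x, 0 ≤ f x) : K X f ≤ K Y f := by
  rw [K_def, K_def]
  refine J_mono (h.exp _).cs (hY.exp _).cs fun x => ?_
  rw [rad_apply (h.exp _).toRd, rad_apply (hY.exp _).toRd]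
  exact mul_le_mul_of_nonneg_right (mul_le_mul_of_nonneg_left (hle _) (Real.exp_pos _).le) (hf x)

end

noncomputable section
variable {n : ℕ}

/-- `v` is a stable solution of `Δ²v = c|v|^{p-1}v` on `Ω`. -/
structure Adm (p : ℝ) (v : Sm n) (c : Eu n → ℝ) (Ω : Set (Eu n)) : Prop where
  sol : ∀ x ∈ Ω, LP (LP v) x = c x * |v x| ^ (p - 1) * v x
  nonneg : ∀ x ∈ Ω, 0 ≤ c x
  stab : ∀ ψ : Sm n, Cs ψ → tsupport ψ.1 ⊆ Ω →
    p * ∫ x, c x * |v x| ^ (p - 1) * ψ x ^ 2 ≤ ∫ x, LP ψ x ^ 2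

/-- The constant in the Caccioppoli inequality. -/
def cacc (p : ℝ) : ℝ := 2 * (18 / (p - 1) + 24) + (30 / (p - 1) + 36) ^ 2

lemma cacc_pos {p : ℝ} (hp : 1 < p) : 0 < cacc p := by
  have : 0 < p - 1 := by linarith
  rw [cacc]; positivity

lemma Adm.source_nonneg {p : ℝ} {v : Sm n} {c : Eu n → ℝ} {Ω : Set (Eu n)} (h : Adm p v c Ω)
    {x : Eu n} (hx : x ∈ Ω) : 0 ≤ v x * LP (LP v) x := by
  rw [h.sol x hx, show v x * (c x * |v x| ^ (p - 1) * v x) = c x * |v x| ^ (p - 1) * v x ^ 2 by ring]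
  have := h.nonneg x hx
  positivity

lemma Adm.stab_mul {p : ℝ} {v : Sm n} {c : Eu n → ℝ} {Ω : Set (Eu n)} (h : Adm p v c Ω)
    {η : Sm n} (hη : Cs η) (hΩ : tsupport η.1 ⊆ Ω) :
    p * J (η * η) (v * LP (LP v)) ≤ J (LP (v * η)) (LP (v * η)) := by
  have h1 := h.stab (v * η) (hη.mul' v) ((closure_mono (by
    intro x hx
    simp only [Function.mem_support] at hx ⊢
    intro h0
    exact hx (by change v x * η x = 0; rw [h0, mul_zero]))).trans hΩ)
  rw [J_apply (hη.mul η), J_apply (hη.mul' v).LP]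
  simp only [← sq]
  refine le_trans (le_of_eq ?_) h1
  congr 1
  refine integral_congr_ae (ae_of_all _ fun x => ?_)
  simp only [Sm.mul_apply, Sm.pow_apply]
  by_cases hx : x ∈ tsupport η.1
  · rw [h.sol x (hΩ hx)]; ring
  · have : η x = 0 := image_eq_zero_of_notMem_tsupport hx
    rw [this]; ring

theorem caccioppoli {p : ℝ} (hp : 1 < p) {v : Sm n} {c : Eu n → ℝ} {Ω : Set (Eu n)}
    (h : Adm p v c Ω) {η ω : Sm n} (hη : Cs η) (hΩ : tsupport η.1 ⊆ Ω) (hω : Cs ω)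
    (h1 : ∀ x, Gm η η x ^ 2 ≤ ω x * η x ^ 2) (h2 : ∀ x, |LP (Gm η η) x| ≤ ω x)
    (h3 : ∀ x, LP η x ^ 2 ≤ ω x) :
    J (η * η) (v * LP (LP v)) + J (η * η) (LP v * LP v) ≤ cacc p * J ω (v * v) := by
  have ω0 : ∀ x, 0 ≤ ω x := fun x => (abs_nonneg _).trans (h2 x)
  set N := J (η * η) (v * LP (LP v)) with hN
  set I2 := J (η * η) (LP v * LP v) with hI2
  set Q := J ω (v * v) with hQ
  set P := -J (Gm η η) (v * LP v) with hP
  set S := J (LP (v * η)) (LP (v * η)) with hS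
  set E : Sm n := (2 : ℝ) • Gm η v + v * LP η with hE
  have cE : Cs E := ((hη.Gm v).smul 2).add (hη.LP.mul' v)
  have cηη := hη.mul η
  have cξ := hη.Gm η
  set T := J E E with hT
  have N0 : 0 ≤ N := J_nonneg cηη fun x => by
    by_cases hx : x ∈ tsupport η.1
    · have := h.source_nonneg (hΩ hx)
      simp only [Sm.mul_apply]
      exact mul_nonneg (mul_self_nonneg _) this
    · have : η x = 0 := image_eq_zero_of_notMem_tsupport hx
      simp [this]
  have I20 : 0 ≤ I2 := J_nonneg cηη fun x => by
    simp only [Sm.mul_apply]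
    exact mul_nonneg (mul_self_nonneg _) (mul_self_nonneg _)
  have hpN : p * N ≤ S := h.stab_mul hη hΩ
  have hLE : LP (v * η) = η * LP v + E := by
    rw [LP_mul, hE, Gm_comm v η]; ring
  have hSN : S = N + T + 2 * P := by
    have e1 : N = J (LP (v * (η * η))) (LP v) := by
      rw [← J_LP (cηη.mul' v), hN, J_mul cηη, mul_comm v]
    have e2 : LP (v * (η * η)) = η * η * LP v + (2 : ℝ) • (η * E) + (2 : ℝ) • (v * Gm η η) := by
      rw [LP_mul, LP_mul, Gm_comm v (η * η), Gm_mul_left, hE]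
      simp only [two_smul]
      ring
    have c1 : Cs (η * η * LP v) := cηη.mul _
    have c2 : Cs ((2 : ℝ) • (η * E)) := (hη.mul _).smul 2
    have c3 : Cs ((2 : ℝ) • (v * Gm η η)) := (cξ.mul' v).smul 2
    have e3 : J ((2 : ℝ) • (v * Gm η η)) (LP v) = -2 * P := by
      rw [J_smul (cξ.mul' v), hP, J_mul cξ, mul_comm v]; ring
    have e4 : S = J (η * η * LP v + (2 : ℝ) • (η * E)) (LP v) + T := by
      rw [hS, J_eq_one (hη.mul' v).LP, hT, J_eq_one cE, J_eq_one (c1.add c2),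
        ← J_add ((c1.add c2).mul _) (cE.mul _), hLE]
      congr 2
      simp only [two_smul]
      ring
    rw [e4, e1, e2, J_add (c1.add c2) c3, e3]
    ring
  have hG : J (Gm η η) (Gm v v) ≤ Q / 2 + P := by
    have e : Gm v v = (1 / 2 : ℝ) • LP (v * v) - v * LP v := by
      rw [LP_mul]; ext x
      simp only [Sm.sub_apply, Sm.smul_apply, Sm.mul_apply, Sm.add_apply]; ring
    rw [e, map_sub, map_smul, J_LP cξ, smul_eq_mul]
    have : J (LP (Gm η η)) (v * v) ≤ Q := J_mono cξ.LP hω fun x =>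
      mul_le_mul_of_nonneg_right ((le_abs_self _).trans (h2 x)) (mul_self_nonneg _)
    linarith
  have hTle : T ≤ 6 * Q + 8 * P := by
    have : T ≤ 8 * J (Gm η η) (Gm v v) + 2 * Q := by
      rw [hQ, ← J_smul cξ, ← J_smul hω, hT, J_eq_one cE, J_eq_one (cξ.smul 8),
        J_eq_one (hω.smul 2), ← J_add ((cξ.smul 8).mul _) ((hω.smul 2).mul _)]
      refine J_mono (cE.mul _) (((cξ.smul 8).mul _).add ((hω.smul 2).mul _)) fun x => ?_
      simp only [hE, Sm.smul_apply, Sm.mul_apply, Sm.add_apply, Sm.one_apply, mul_one]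
      nlinarith [Gm_sq_le η v x, h3 x, sq_nonneg (2 * Gm η v x - v x * LP η x),
        mul_le_mul_of_nonneg_left (h3 x) (sq_nonneg (v x))]
    linarith
  have hI2le : I2 ≤ 2 * S + 2 * T := by
    rw [hI2, hS, hT, ← J_smul (hη.mul' v).LP, ← J_smul cE, J_eq_one cηη,
      J_eq_one ((hη.mul' v).LP.smul 2), J_eq_one (cE.smul 2),
      ← J_add (((hη.mul' v).LP.smul 2).mul _) ((cE.smul 2).mul _)]
    refine J_mono (cηη.mul _) ((((hη.mul' v).LP.smul 2).mul _).add ((cE.smul 2).mul _)) fun x => ?_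
    simp only [hLE, Sm.smul_apply, Sm.mul_apply, Sm.add_apply, Sm.one_apply, mul_one]
    nlinarith [sq_nonneg (η x * LP v x + 2 * E x)]
  have hp1 : 0 < p - 1 := by linarith
  set b := 30 / (p - 1) + 36 with hb
  have hb0 : 0 < b := by positivity
  have hPle : b * P ≤ I2 / 2 + b ^ 2 / 2 * Q := by
    have e : b * P = J (Gm η η) ((-b) • (v * LP v)) := by
      rw [map_smul, hP, smul_eq_mul]; ring
    have e2 : I2 / 2 + b ^ 2 / 2 * Q = J ((1 / 2 : ℝ) • (η * η * (LP v * LP v)) +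
        (b ^ 2 / 2) • (ω * (v * v))) 1 := by
      rw [J_add ((cηη.mul _).smul _) ((hω.mul _).smul _), J_smul (cηη.mul _), J_smul (hω.mul _),
        ← J_eq_one cηη, ← J_eq_one hω]
      ring
    rw [e, e2]
    refine J_mono cξ (((cηη.mul _).smul _).add ((hω.mul _).smul _)) fun x => ?_
    simp only [Sm.smul_apply, Sm.mul_apply, Sm.add_apply, Sm.one_apply, mul_one]
    refine abs_le_of_sq_le_sq' ?_ ?_ |>.2
    · have k1 := mul_le_mul_of_nonneg_right (h1 x) (sq_nonneg (b * v x * LP v x))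
      nlinarith [sq_nonneg (1 / 2 * (η x * η x * (LP v x * LP v x)) -
        b ^ 2 / 2 * (ω x * (v x * v x)))]
    · have := mul_nonneg (ω0 x) (mul_self_nonneg (v x))
      have := mul_nonneg (mul_self_nonneg (η x)) (mul_self_nonneg (LP v x))
      positivity
  have hNle : N ≤ (6 * Q + 10 * P) / (p - 1) := by
    rw [le_div_iff₀ hp1]; linarith
  have h3N : 3 * ((6 * Q + 10 * P) / (p - 1)) + 24 * Q + 36 * P =
      (18 / (p - 1) + 24) * Q + b * P := by
    rw [hb]; field_simp; ring
  rw [cacc, ← hb]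
  nlinarith

end

noncomputable section
variable {n : ℕ}

/-- Precomposition with `z ↦ y + r z`. -/
def aff (y : Eu n) (r : ℝ) (f : Sm n) : Sm n := ⟨fun z => f (y + r • z), by
  change ContDiff ℝ (⊤ : ℕ∞) fun z => f.1 (y + r • z)
  have := Sm.smooth f
  fun_prop⟩

@[simp] lemma aff_apply (y : Eu n) (r : ℝ) (f : Sm n) (z : Eu n) : aff y r f z = f (y + r • z) := rfl

lemma pd_aff (y : Eu n) (r : ℝ) (f : Sm n) (i : Fin n) : pd i (aff y r f) = r • aff y r (pd i f) := by
  ext z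
  rw [pd_apply, Sm.smul_apply, aff_apply, pd_apply]
  have h1 : HasFDerivAt (fun z : Eu n => y + r • z) (r • ContinuousLinearMap.id ℝ (Eu n)) z :=
    ((hasFDerivAt_id z).const_smul r).const_add y
  have h2 := (Sm.diff f (y + r • z)).hasFDerivAt.comp z h1
  have : (aff y r f).1 = f.1 ∘ fun z => y + r • z := rfl
  rw [this, h2.fderiv]
  simp

lemma LP_aff (y : Eu n) (r : ℝ) (f : Sm n) : LP (aff y r f) = r ^ 2 • aff y r (LP f) := by
  ext z
  simp only [LP, pd_aff, pd_smul, Sm.sum_apply, Sm.smul_apply, aff_apply, Finset.mul_sum]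
  exact Finset.sum_congr rfl fun i _ => by ring

lemma aff_aff_inv (y : Eu n) {r : ℝ} (hr : r ≠ 0) (f : Sm n) :
    aff y r (aff (-(r⁻¹ • y)) r⁻¹ f) = f := by
  ext z
  simp only [aff_apply]
  rw [smul_add, smul_smul, inv_mul_cancel₀ hr, one_smul]
  simp

lemma integral_comp_aff (y : Eu n) {r : ℝ} (hr : 0 < r) (g : Eu n → ℝ) :
    ∫ z, g (y + r • z) = (r ^ n)⁻¹ * ∫ x, g x := by
  have := Measure.integral_comp_smul (volume : Measure (Eu n)) (fun z => g (y + z)) r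
  rw [this, integral_add_left_eq_self g y]
  simp [abs_of_pos (pow_pos hr n)]

lemma Cs.aff {f : Sm n} (h : Cs f) (y : Eu n) {r : ℝ} (hr : r ≠ 0) : Cs (aff y r f) := by
  have := h.comp_homeomorph ((Homeomorph.smulOfNeZero r hr).trans (Homeomorph.addLeft y))
  exact this

lemma tsupport_aff (f : Sm n) (y : Eu n) {r : ℝ} (hr : r ≠ 0) :
    tsupport (aff y r f).1 = (fun z => y + r • z) ⁻¹' tsupport f.1 := by
  have := tsupport_comp_eq_preimage f.1
    ((Homeomorph.smulOfNeZero r hr).trans (Homeomorph.addLeft y) : Eu n ≃ₜ Eu n)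
  exact this

lemma Adm.scale {p : ℝ} {v : Sm n} {c : Eu n → ℝ} {Ω Ω' : Set (Eu n)} (h : Adm p v c Ω)
    (y : Eu n) {r l : ℝ} (hr : 0 < r) (hl : 0 < l) (hΩ : ∀ z ∈ Ω', y + r • z ∈ Ω) :
    Adm p (l • aff y r v) (fun z => l ^ (1 - p) * r ^ 4 * c (y + r • z)) Ω' where
  sol z hz := by
    rw [LP_smul, LP_aff, LP_smul, LP_smul, LP_aff]
    simp only [Sm.smul_apply, aff_apply]
    rw [h.sol _ (hΩ z hz), abs_mul, Real.mul_rpow (abs_nonneg _) (abs_nonneg _), abs_of_pos hl]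
    have : l ^ (1 - p) * l ^ (p - 1) = 1 := by
      rw [← Real.rpow_add hl]; simp
    linear_combination (-(l * r ^ 4 * c (y + r • z) * |v (y + r • z)| ^ (p - 1) * v (y + r • z))) * this
  nonneg z hz := by
    have := h.nonneg _ (hΩ z hz)
    positivity
  stab ψ hψ hs := by
    set φ := aff (-(r⁻¹ • y)) r⁻¹ ψ with hφ
    have hψφ : ψ = aff y r φ := (aff_aff_inv y hr.ne' ψ).symm
    have hr' : r⁻¹ ≠ 0 := inv_ne_zero hr.ne'
    have hst := h.stab φ (hψ.aff _ hr') (by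
      intro x hx
      have e : y + r • (-(r⁻¹ • y) + r⁻¹ • x) = x := by
        rw [smul_add, smul_neg, smul_smul, smul_smul, mul_inv_cancel₀ hr.ne', one_smul, one_smul]
        simp
      rw [hφ, tsupport_aff _ _ hr'] at hx
      rw [← e]
      exact hΩ _ (hs hx))
    have e1 : (∫ x, LP ψ x ^ 2) = r ^ 4 * ((r ^ n)⁻¹ * ∫ x, LP φ x ^ 2) := by
      rw [← integral_comp_aff y hr, ← integral_const_mul, hψφ, LP_aff]
      congr 1; ext x
      simp only [Sm.smul_apply, aff_apply]; ring
    have hll : l ^ (1 - p) * l ^ (p - 1) = 1 := by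
      rw [← Real.rpow_add hl]; simp
    have e2 : (∫ z, l ^ (1 - p) * r ^ 4 * c (y + r • z) * |(l • aff y r v) z| ^ (p - 1) * ψ z ^ 2) =
        r ^ 4 * ((r ^ n)⁻¹ * ∫ x, c x * |v x| ^ (p - 1) * φ x ^ 2) := by
      rw [← integral_comp_aff y hr, ← integral_const_mul, hψφ]
      congr 1; ext x
      simp only [Sm.smul_apply, aff_apply]
      rw [abs_mul, Real.mul_rpow (abs_nonneg _) (abs_nonneg _), abs_of_pos hl]
      linear_combination (r ^ 4 * c (y + r • x) * |v (y + r • x)| ^ (p - 1) *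
        φ (y + r • x) ^ 2) * hll
    rw [e1, e2]
    calc _ = r ^ 4 * (r ^ n)⁻¹ * (p * ∫ x, c x * |v x| ^ (p - 1) * φ x ^ 2) := by ring
      _ ≤ r ^ 4 * (r ^ n)⁻¹ * ∫ x, LP φ x ^ 2 := by gcongr
      _ = _ := by ring

end

noncomputable section
variable {n : ℕ}

/-- A smooth step: `0` for `t ≤ 2` and `1` for `t ≥ 3`. -/
def stp (t : ℝ) : ℝ := Real.smoothTransition (t - 2)

lemma stp_smooth : ContDiff ℝ (⊤ : ℕ∞) stp :=
  Real.smoothTransition.contDiff.comp (contDiff_id.sub contDiff_const)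
lemma stp_nonneg (t : ℝ) : 0 ≤ stp t := Real.smoothTransition.nonneg _
lemma stp_le_one (t : ℝ) : stp t ≤ 1 := Real.smoothTransition.le_one _
lemma stp_zero {t : ℝ} (h : t ≤ 2) : stp t = 0 := Real.smoothTransition.zero_of_nonpos (by linarith)
lemma stp_one {t : ℝ} (h : 3 ≤ t) : stp t = 1 := Real.smoothTransition.one_of_one_le (by linarith)
lemma stp_rd : Rd stp := ⟨stp_smooth, fun t ht => stp_zero (by linarith)⟩

lemma deriv_stp_zero {t : ℝ} (h : t ≤ 2) : deriv stp t = 0 := by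
  have hc : Continuous (deriv stp) := (smooth_deriv stp_smooth).continuous
  have : ∀ s ∈ Iio (2 : ℝ), deriv stp s = 0 := fun s hs => by
    have : stp =ᶠ[𝓝 s] fun _ => 0 := by
      filter_upwards [Iio_mem_nhds hs] with r hr using stp_zero (le_of_lt hr)
    rw [this.deriv_eq]; simp
  have h2 : closure (Iio (2 : ℝ)) ⊆ {s | deriv stp s = 0} :=
    closure_minimal this (isClosed_eq hc continuous_const)
  rw [closure_Iio] at h2
  exact h2 h

lemma deriv_stp_zero' {t : ℝ} (h : 3 ≤ t) : deriv stp t = 0 := by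
  have hc : Continuous (deriv stp) := (smooth_deriv stp_smooth).continuous
  have : ∀ s ∈ Ioi (3 : ℝ), deriv stp s = 0 := fun s hs => by
    have : stp =ᶠ[𝓝 s] fun _ => 1 := by
      filter_upwards [Ioi_mem_nhds hs] with r hr using stp_one (le_of_lt hr)
    rw [this.deriv_eq]; simp
  have h2 : closure (Ioi (3 : ℝ)) ⊆ {s | deriv stp s = 0} :=
    closure_minimal this (isClosed_eq hc continuous_const)
  rw [closure_Ioi] at h2
  exact h2 h

lemma stp_mono : Monotone stp := fun s t h => Real.smoothTransition.monotone (by linarith)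

lemma deriv_stp_nonneg (t : ℝ) : 0 ≤ deriv stp t := stp_mono.deriv_nonneg

lemma stp_deriv_wn : Wn (deriv stp) :=
  ⟨stp_rd.deriv, 3, fun _ ht => deriv_stp_zero' ht⟩

/-- The fourth order operator with `Δ²(r^{4-n} g(log r)) = r^{-n} (Q g)(log r)`. -/
def Qop (n : ℕ) (g : ℝ → ℝ) (t : ℝ) : ℝ :=
  deriv (deriv (deriv (deriv g))) t + (8 - 2 * n) * deriv (deriv (deriv g)) t +
    ((6 - n) * (2 - n) + 2 * (4 - n)) * deriv (deriv g) t + 2 * (4 - n) * (2 - n) * deriv g t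

lemma LP_rad_exp {g : ℝ → ℝ} (hg : Rd g) (c : ℝ) : LP (rad fun t => Real.exp (c * t) * g t : Sm n) =
    rad fun t => Real.exp ((c - 2) * t) *
      (deriv (deriv g) t + (2 * c + n - 2) * deriv g t + c * (c + n - 2) * g t) := by
  rw [LP_rad (hg.exp c)]
  have hd : ∀ {g : ℝ → ℝ}, Rd g → deriv (fun t => Real.exp (c * t) * g t) =
      fun t => Real.exp (c * t) * (deriv g t + c * g t) := by
    intro g hg
    ext t
    have h1 : HasDerivAt (fun t => Real.exp (c * t)) (Real.exp (c * t) * (c * 1)) t :=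
      ((hasDerivAt_id t).const_mul c).exp
    exact (h1.mul (hg.diff t).hasDerivAt).deriv.trans (by ring)
  have hd2 : deriv (fun t => deriv g t + c * g t) = fun t => deriv (deriv g) t + c * deriv g t := by
    ext t
    exact ((hg.deriv.diff t).hasDerivAt.add ((hg.diff t).hasDerivAt.const_mul c)).deriv
  rw [hd hg, hd (hg.deriv.add (hg.mul' contDiff_const)), hd2]
  congr 1; ext t
  rw [show (c - 2) * t = -2 * t + c * t by ring, Real.exp_add]; ring

lemma LP_LP_rad {g : ℝ → ℝ} (hg : Rd g) :
    LP (LP (rad fun t => Real.exp ((4 - n) * t) * g t : Sm n)) =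
      rad fun t => Real.exp (-n * t) * Qop n g t := by
  have h2 : Rd fun t => deriv (deriv g) t + (6 - n : ℝ) * deriv g t + 2 * (4 - n : ℝ) * g t :=
    (hg.deriv.deriv.add (hg.deriv.mul' contDiff_const)).add (hg.mul' contDiff_const)
  rw [LP_rad_exp hg, show (fun t => Real.exp ((4 - (n : ℝ) - 2) * t) *
      (deriv (deriv g) t + (2 * (4 - (n : ℝ)) + n - 2) * deriv g t +
        (4 - (n : ℝ)) * (4 - n + n - 2) * g t)) = fun t => Real.exp ((2 - n) * t) *
      (deriv (deriv g) t + (6 - n) * deriv g t + 2 * (4 - n) * g t) by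
    ext t; ring_nf, LP_rad_exp h2]
  have e1 : ∀ {g : ℝ → ℝ}, Rd g →
      deriv (fun t => deriv (deriv g) t + (6 - n : ℝ) * deriv g t + 2 * (4 - n : ℝ) * g t) =
      fun t => deriv (deriv (deriv g)) t + (6 - n : ℝ) * deriv (deriv g) t +
        2 * (4 - n : ℝ) * deriv g t := by
    intro g hg
    ext t
    exact (((hg.deriv.deriv.diff t).hasDerivAt.add ((hg.deriv.diff t).hasDerivAt.const_mul _)).add
      ((hg.diff t).hasDerivAt.const_mul _)).deriv
  rw [e1 hg, e1 hg.deriv]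
  congr 1; ext t
  rw [Qop]; ring_nf

lemma Qop_wn {g : ℝ → ℝ} (hg : Wn (deriv g)) : Wn (Qop n g) :=
  ((hg.deriv.deriv.deriv.add (hg.deriv.deriv.const_mul _)).add (hg.deriv.const_mul _)).add
    (hg.const_mul _)

/-- Mass of the averaging kernel `K (Qop n stp)`. -/
def mss (n : ℕ) : ℝ := K (Qop n stp) (1 : Sm n)

lemma K_deriv_one {X : ℝ → ℝ} (h : Wn X) : K (deriv X) (1 : Sm n) = 0 := by
  have := K_DE h (1 : Sm n)
  rw [Derivation.map_one_eq_zero, map_zero] at this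
  linarith

lemma mss_pos (hn : 5 ≤ n) : 0 < mss n := by
  have h := stp_deriv_wn
  have e : mss n = 2 * (4 - n) * (2 - n) * K (deriv stp) (1 : Sm n) := by
    have := K_add (n := n) ((h.deriv.deriv.deriv.add (h.deriv.deriv.const_mul (8 - 2 * (n : ℝ)))).add
      (h.deriv.const_mul ((6 - (n : ℝ)) * (2 - n) + 2 * (4 - n))))
      (h.const_mul (2 * (4 - (n : ℝ)) * (2 - n))) 1
    rw [K_add (h.deriv.deriv.deriv.add (h.deriv.deriv.const_mul _)) (h.deriv.const_mul _),
      K_add h.deriv.deriv.deriv (h.deriv.deriv.const_mul _), K_const_mul h.deriv.deriv,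
      K_const_mul h.deriv, K_const_mul h, K_deriv_one h, K_deriv_one h.deriv,
      K_deriv_one h.deriv.deriv] at this
    rw [mss]
    refine Eq.trans ?_ (this.trans (by ring))
    rfl
  have hn' : (5 : ℝ) ≤ n := by exact_mod_cast hn
  rw [e]
  have h0 : 0 < K (deriv stp) (1 : Sm n) := by
    rw [K_def, J_one (h.exp _).cs]
    obtain ⟨t, -, ht⟩ := exists_deriv_eq_slope stp (show (2:ℝ) < 3 by norm_num)
      stp_rd.cont.continuousOn stp_rd.diff.differentiableOn
    refine Continuous.integral_pos_of_hasCompactSupport_nonneg_nonzero (Sm.cont _) (h.exp _).cs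
      (fun x => ?_) (x := EuclideanSpace.single ⟨0, by omega⟩ (Real.exp t)) ?_
    · change 0 ≤ (rad fun t => Real.exp (-n * t) * deriv stp t : Sm n) x
      rw [rad_apply (h.exp _).toRd]
      exact mul_nonneg (Real.exp_pos _).le (deriv_stp_nonneg _)
    · rw [rad_apply (h.exp _).toRd]
      simp only [PiLp.norm_single, Real.norm_eq_abs, Real.abs_exp, Real.log_exp]
      rw [ht, stp_one le_rfl, stp_zero le_rfl]
      have := Real.exp_pos (-(n : ℝ) * t)
      norm_num
  have : 0 < 2 * (4 - (n : ℝ)) * (2 - n) := by nlinarith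
  positivity

lemma K_aff {X : ℝ → ℝ} (h : Wn X) (h2 : ∀ t ≤ 2, X t = 0) (f : Sm n) :
    K X (aff 0 (Real.exp (-1)) f) = K (fun t => X (t + 1)) f := by
  have hX1 : Wn fun t => X (t + 1) := by
    obtain ⟨T, hT⟩ := h.zero'
    exact ⟨⟨h.smooth.comp (contDiff_id.add contDiff_const), fun t ht => h2 _ (by linarith)⟩,
      T, fun t ht => hT _ (by linarith)⟩
  rw [K_def, K_def, J_apply (h.exp _).cs, J_apply (hX1.exp _).cs]
  have := integral_comp_aff (0 : Eu n) (Real.exp_pos (-1))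
    (fun x => (rad fun t => Real.exp (-n * t) * X (t + 1)) x * f x)
  have e : (∫ x, (rad fun t => Real.exp (-n * t) * X (t + 1)) x * f x) =
      Real.exp (-1) ^ n * ∫ z, (fun x => (rad fun t => Real.exp (-n * t) * X (t + 1)) x * f x)
        (0 + Real.exp (-1) • z) := by
    rw [this, mul_inv_cancel_left₀ (pow_pos (Real.exp_pos _) n).ne']
  rw [e, ← integral_const_mul]
  congr 1; ext x
  simp only []
  rw [rad_apply (h.exp _).toRd, rad_apply (hX1.exp _).toRd, aff_apply]
  by_cases hx : x = 0
  · simp [hx, h.zero]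
  · have hx' : 0 < ‖x‖ := norm_pos_iff.2 hx
    have : Real.log ‖(0 : Eu n) + Real.exp (-1) • x‖ = Real.log ‖x‖ - 1 := by
      rw [zero_add, norm_smul, Real.norm_eq_abs, Real.abs_exp, Real.log_mul (Real.exp_pos _).ne' hx'.ne',
        Real.log_exp]; ring
    simp only [this, sub_add_cancel]
    rw [← mul_assoc, ← mul_assoc, ← Real.exp_nat_mul, ← Real.exp_add]
    congr 3; ring

/-- The window `θ(t+1) - θ(t)`. -/
def dstp (t : ℝ) : ℝ := stp (t + 1) - stp t

lemma dstp_wn : Wn dstp where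
  smooth := (stp_smooth.comp (contDiff_id.add contDiff_const)).sub stp_smooth
  zero t ht := by rw [dstp, stp_zero (by linarith), stp_zero (by linarith)]; ring
  zero' := ⟨3, fun t ht => by rw [dstp, stp_one (by linarith), stp_one (by linarith)]; ring⟩

lemma Qop_dstp (t : ℝ) : Qop n stp (t + 1) = Qop n stp t + Qop n dstp t := by
  have e : ∀ {g : ℝ → ℝ}, Rd g → deriv (fun t => g (t + 1) - g t) =
      fun t => deriv g (t + 1) - deriv g t := by
    intro g hg
    ext t
    have h1 : HasDerivAt (fun t => g (t + 1)) (deriv g (t + 1)) t :=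
      HasDerivAt.comp_add_const t 1 (hg.diff (t + 1)).hasDerivAt
    exact (h1.sub (hg.diff t).hasDerivAt).deriv
  have h := stp_rd
  have e0 : dstp = fun t => stp (t + 1) - stp t := rfl
  rw [Qop, Qop, Qop, e0, e h, e h.deriv, e h.deriv.deriv, e h.deriv.deriv.deriv]
  ring

lemma Qop_stp_zero {t : ℝ} (ht : t ≤ 2) : Qop n stp t = 0 := by
  have key : ∀ {g : ℝ → ℝ}, Continuous (deriv g) → (∀ t ≤ 2, g t = 0) → ∀ t ≤ 2, deriv g t = 0 := by
    intro g hc hg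
    have : ∀ s ∈ Iio (2 : ℝ), deriv g s = 0 := fun s hs => by
      have : g =ᶠ[𝓝 s] fun _ => 0 := by
        filter_upwards [Iio_mem_nhds hs] with r hr using hg r (le_of_lt hr)
      rw [this.deriv_eq]; simp
    have h2 : closure (Iio (2 : ℝ)) ⊆ {s | deriv g s = 0} :=
      closure_minimal this (isClosed_eq hc continuous_const)
    rw [closure_Iio] at h2
    exact fun t ht => h2 ht
  have h := stp_rd
  have h1 := key h.deriv.cont (fun t ht => stp_zero ht)
  have h2 := key h.deriv.deriv.cont h1
  have h3 := key h.deriv.deriv.deriv.cont h2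
  have h4 := key h.deriv.deriv.deriv.deriv.cont h3
  rw [Qop, h1 t ht, h2 t ht, h3 t ht, h4 t ht]; ring

/-- The kernel in the representation formula. -/
def chi (n : ℕ) : Sm n := rad fun t => Real.exp ((4 - n) * t) * dstp t

lemma chi_cs : Cs (chi n) := (dstp_wn.exp _).cs

lemma telescope (f : Sm n) : K (Qop n stp) (aff 0 (Real.exp (-1)) f) =
    K (Qop n stp) f + J (chi n) (LP (LP f)) := by
  have h1 := Qop_wn (n := n) stp_deriv_wn
  have h2 := Qop_wn (n := n) dstp_wn.deriv
  rw [K_aff h1 (fun t => Qop_stp_zero), K_congr_left Qop_dstp, K_add h1 h2, J_LP chi_cs,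
    J_LP chi_cs.LP, chi, LP_LP_rad dstp_wn.toRd]
  rfl

end

noncomputable section
variable {n : ℕ}

/-- Directional derivative. -/
def Dh (h : Eu n) : Derivation ℝ (Sm n) (Sm n) := Der 0 h

lemma Dh_apply (h : Eu n) (f : Sm n) (x : Eu n) : Dh h f x = fderiv ℝ f.1 x h := by
  simp [Dh, Der_apply]

lemma Dh_comm (h k : Eu n) (f : Sm n) : Dh h (Dh k f) = Dh k (Dh h f) := Der_comm (by simp) f

lemma Dh_smul (h : Eu n) (c : ℝ) (f : Sm n) : Dh h (c • f) = c • Dh h f :=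
  Derivation.map_smul _ _ _

lemma Cs.Dh {η : Sm n} (h : Cs η) (k : Eu n) : Cs (Dh k η) := h.der _ _

lemma LP_Dh (h : Eu n) (f : Sm n) : LP (Dh h f) = Dh h (LP f) := by
  simp only [LP, map_sum]
  refine Finset.sum_congr rfl fun i _ => ?_
  rw [show pd i = Dh (EuclideanSpace.single i 1) from rfl, Dh_comm _ h, Dh_comm _ h]

lemma Dh_aff (h y : Eu n) (r : ℝ) (f : Sm n) : Dh h (aff y r f) = r • aff y r (Dh h f) := by
  ext z
  rw [Dh_apply, Sm.smul_apply, aff_apply, Dh_apply]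
  have h1 : HasFDerivAt (fun z : Eu n => y + r • z) (r • ContinuousLinearMap.id ℝ (Eu n)) z :=
    ((hasFDerivAt_id z).const_smul r).const_add y
  have h2 := (Sm.diff f (y + r • z)).hasFDerivAt.comp z h1
  have : (aff y r f).1 = f.1 ∘ fun z => y + r • z := rfl
  rw [this, h2.fderiv]
  simp

lemma J_Dh {η : Sm n} (h : Cs η) (k : Eu n) (f : Sm n) : J η (Dh k f) = -J (Dh k η) f := by
  rw [J_apply h, J_apply (h.Dh k)]
  simp only [Dh_apply]
  have := integral_mul_fderiv_eq_neg_fderiv_mul_of_integrable (μ := volume) (f := η.1) (g := f.1) (v := k)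
    (((h.Dh k).mul f).integrable.congr (ae_of_all _ fun x => by simp [Dh_apply]))
    ((h.mul (Dh k f)).integrable.congr (ae_of_all _ fun x => by simp [Dh_apply]))
    ((h.mul f).integrable) (fun x _ => Sm.diff η x) (fun x _ => Sm.diff f x)
  rw [this]

/-- Iterated directional derivatives. -/
def Dm : (k : ℕ) → (Fin k → Eu n) → Sm n → Sm n
  | 0, _, f => f
  | k + 1, m, f => Dh (m 0) (Dm k (Fin.tail m) f)

lemma Dm_Dh (k : ℕ) (m : Fin k → Eu n) (h : Eu n) (f : Sm n) :
    Dm k m (Dh h f) = Dh h (Dm k m f) := by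
  induction k with
  | zero => rfl
  | succ k ih => simp only [Dm]; rw [ih, Dh_comm]

lemma Cs.Dm {η : Sm n} (h : Cs η) (k : ℕ) (m : Fin k → Eu n) : Cs (Dm k m η) := by
  induction k with
  | zero => exact h
  | succ k ih => exact (ih _).Dh _

lemma LP_Dm (k : ℕ) (m : Fin k → Eu n) (f : Sm n) : LP (Dm k m f) = Dm k m (LP f) := by
  induction k with
  | zero => rfl
  | succ k ih => simp only [Dm]; rw [LP_Dh, ih]

lemma Dm_aff (k : ℕ) (m : Fin k → Eu n) (y : Eu n) (r : ℝ) (f : Sm n) :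
    Dm k m (aff y r f) = r ^ k • aff y r (Dm k m f) := by
  induction k with
  | zero => simp [Dm]
  | succ k ih => simp only [Dm]; rw [ih, Dh_smul, Dh_aff, smul_smul]; ring_nf

lemma J_Dm {η : Sm n} (h : Cs η) (k : ℕ) (m : Fin k → Eu n) (f : Sm n) :
    J η (Dm k m f) = (-1) ^ k * J (Dm k m η) f := by
  induction k generalizing η with
  | zero => simp [Dm]
  | succ k ih => simp only [Dm]; rw [J_Dh h, ih (h.Dh _), Dm_Dh]; ring

lemma Dm_apply (k : ℕ) (m : Fin k → Eu n) (f : Sm n) (x : Eu n) :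
    Dm k m f x = iteratedFDeriv ℝ k f.1 x m := by
  induction k generalizing x with
  | zero => simp [Dm]
  | succ k ih =>
    rw [iteratedFDeriv_succ_apply_left, Dm, Dh_apply]
    have : (Dm k (Fin.tail m) f).1 = fun x => iteratedFDeriv ℝ k f.1 x (Fin.tail m) :=
      funext fun x => ih _ x
    rw [this]
    have hd : DifferentiableAt ℝ (iteratedFDeriv ℝ k f.1) x :=
      ((Sm.smooth f).differentiable_iteratedFDeriv (m := k)
        (by exact_mod_cast (ENat.natCast_lt_top k))) x
    rw [fderiv_continuousMultilinear_apply_const_apply hd]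

lemma iteratedFDeriv_norm_le {k : ℕ} {f : Sm n} {x : Eu n} {C : ℝ} (hC : 0 ≤ C)
    (h : ∀ m, |Dm k m f x| ≤ C * ∏ i, ‖m i‖) : ‖iteratedFDeriv ℝ k f.1 x‖ ≤ C :=
  ContinuousMultilinearMap.opNorm_le_bound hC fun m => by
    rw [← Dm_apply, Real.norm_eq_abs]; exact h m

lemma J_Dm_bound {η : Sm n} {R : ℝ} (hη : ∀ x, R < ‖x‖ → η x = 0) (k : ℕ) :
    ∃ C, 0 ≤ C ∧ ∀ (m : Fin k → Eu n) (f : Sm n) (A : ℝ), (∀ z ∈ closedBall (0 : Eu n) R, |f z| ≤ A) →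
      |J (Dm k m η) f| ≤ C * (∏ i, ‖m i‖) * A := by
  have hts : tsupport η.1 ⊆ closedBall 0 R := closure_minimal (fun x hx => by
    by_contra h
    exact hx (hη x (by simpa using h))) isClosed_closedBall
  have hc : Cs η := HasCompactSupport.of_support_subset_isCompact (isCompact_closedBall 0 R)
    (subset_tsupport _ |>.trans hts)
  have hcont : Continuous (iteratedFDeriv ℝ k η.1) :=
    (Sm.smooth η).continuous_iteratedFDeriv (m := k) (by exact_mod_cast le_top)
  have hi : Integrable fun x => ‖iteratedFDeriv ℝ k η.1 x‖ :=
    (hcont.norm.integrable_of_hasCompactSupport (hc.iteratedFDeriv (𝕜 := ℝ) k).norm)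
  refine ⟨∫ x, ‖iteratedFDeriv ℝ k η.1 x‖, by positivity, fun m f A hA => ?_⟩
  rw [J_apply (hc.Dm k m)]
  calc _ ≤ ∫ x, |Dm k m η x * f x| := abs_integral_le_integral_abs
    _ ≤ ∫ x, ‖iteratedFDeriv ℝ k η.1 x‖ * ((∏ i, ‖m i‖) * A) := by
        refine integral_mono (((hc.Dm k m).mul f).integrable.abs) (hi.mul_const _) fun x => ?_
        simp only [abs_mul]
        rw [Dm_apply, ← Real.norm_eq_abs]
        by_cases hx : x ∈ closedBall (0 : Eu n) R
        · calc _ ≤ (‖iteratedFDeriv ℝ k η.1 x‖ * ∏ i, ‖m i‖) * A := by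
                gcongr
                · exact ContinuousMultilinearMap.le_opNorm _ _
                · exact hA x hx
            _ = _ := by ring
        · have : iteratedFDeriv ℝ k η.1 x = 0 := by
            by_contra h
            exact hx (hts (support_iteratedFDeriv_subset k h))
          simp [this]
    _ = _ := by rw [integral_mul_const]; ring

end

noncomputable section
variable {n : ℕ}

lemma aff_aff (x y : Eu n) (r s : ℝ) (f : Sm n) :
    aff y s (aff x r f) = aff (x + r • y) (r * s) f := by
  ext z
  simp only [aff_apply]
  rw [smul_add, smul_smul, ← add_assoc]

lemma telescope_sum (f : Sm n) (x : Eu n) (r : ℝ) (N : ℕ) :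
    K (Qop n stp) (aff x (r * Real.exp (-1) ^ N) f) = K (Qop n stp) (aff x r f) +
      ∑ k ∈ Finset.range N, (r * Real.exp (-1) ^ k) ^ 4 *
        J (chi n) (aff x (r * Real.exp (-1) ^ k) (LP (LP f))) := by
  induction N with
  | zero => simp
  | succ N ih =>
    have h := telescope (aff x (r * Real.exp (-1) ^ N) f)
    rw [aff_aff, smul_zero, add_zero] at h
    rw [pow_succ, ← mul_assoc, h, ih, Finset.sum_range_succ, LP_aff, LP_smul, LP_aff, smul_smul,
      map_smul, smul_eq_mul]
    ring

lemma rep (f : Sm n) (x : Eu n) (r : ℝ) :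
    Tendsto (fun N => K (Qop n stp) (aff x r f) +
      ∑ k ∈ Finset.range N, (r * Real.exp (-1) ^ k) ^ 4 *
        J (chi n) (aff x (r * Real.exp (-1) ^ k) (LP (LP f)))) atTop (𝓝 (mss n * f x)) := by
  simp only [← telescope_sum]
  have hw := (Qop_wn (n := n) stp_deriv_wn).exp (-n)
  set η : Sm n := rad fun t => Real.exp (-n * t) * Qop n stp t with hη
  have hc : Cs η := hw.cs
  have hcont : Continuous fun s : ℝ => ∫ z in tsupport η.1, η z * f (x + s • z) := by
    refine continuous_parametric_integral_of_continuous ?_ hc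
    have h1 := Sm.cont η
    have h2 := Sm.cont f
    change Continuous fun q : ℝ × Eu n => η q.2 * f (x + q.1 • q.2)
    fun_prop
  have e : ∀ s, K (Qop n stp) (aff x s f) = ∫ z in tsupport η.1, η z * f (x + s • z) := fun s => by
    rw [K_def, J_apply hc, setIntegral_eq_integral_of_forall_compl_eq_zero]
    · rfl
    · intro z hz; rw [image_eq_zero_of_notMem_tsupport hz, zero_mul]
  have e0 : mss n * f x = ∫ z in tsupport η.1, η z * f (x + (0 : ℝ) • z) := by
    rw [mss, K_def, J_one hc, setIntegral_eq_integral_of_forall_compl_eq_zero]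
    · simp only [zero_smul, add_zero]
      rw [integral_mul_const]
    · intro z hz; rw [image_eq_zero_of_notMem_tsupport hz, zero_mul]
  simp only [e]
  rw [e0]
  refine (hcont.tendsto 0).comp ?_
  have : Tendsto (fun N : ℕ => r * Real.exp (-1) ^ N) atTop (𝓝 (r * 0)) :=
    (tendsto_pow_atTop_nhds_zero_of_lt_one (Real.exp_pos _).le
      (by rw [Real.exp_lt_one_iff]; norm_num)).const_mul r
  rwa [mul_zero] at this

/-- A radius containing the supports of the kernels. -/
def R0 : ℝ := Real.exp 3

lemma R0_pos : 0 < R0 := Real.exp_pos _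

lemma rad_zero_of_R0 {X : ℝ → ℝ} (h : Rd X) (h3 : ∀ t, 3 ≤ t → X t = 0) (x : Eu n)
    (hx : R0 < ‖x‖) : (rad X : Sm n) x = 0 := by
  rw [rad_apply h, h3]
  rw [← Real.log_exp 3]
  exact Real.log_le_log (Real.exp_pos _) hx.le

lemma chi_zero (x : Eu n) (hx : R0 < ‖x‖) : chi n x = 0 :=
  rad_zero_of_R0 (dstp_wn.exp _).toRd (fun t ht => by
    rw [dstp, stp_one ht, stp_one (by linarith)]; ring) x hx

lemma Qop_stp_zero' {t : ℝ} (ht : 3 ≤ t) : Qop n stp t = 0 := by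
  have key : ∀ {g : ℝ → ℝ}, Continuous (deriv g) → (∀ t, 3 ≤ t → g t = 0) →
      ∀ t, 3 ≤ t → deriv g t = 0 := by
    intro g hc hg
    have : ∀ s ∈ Ioi (3 : ℝ), deriv g s = 0 := fun s hs => by
      have : g =ᶠ[𝓝 s] fun _ => 0 := by
        filter_upwards [Ioi_mem_nhds hs] with r hr using hg r (le_of_lt hr)
      rw [this.deriv_eq]; simp
    have h2 : closure (Ioi (3 : ℝ)) ⊆ {s | deriv g s = 0} :=
      closure_minimal this (isClosed_eq hc continuous_const)
    rw [closure_Ioi] at h2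
    exact fun t ht => h2 ht
  have h := stp_rd
  have h1 : ∀ t, 3 ≤ t → deriv stp t = 0 := fun t ht => deriv_stp_zero' ht
  have h2 := key h.deriv.deriv.cont h1
  have h3 := key h.deriv.deriv.deriv.cont h2
  have h4 := key h.deriv.deriv.deriv.deriv.cont h3
  rw [Qop, h1 t ht, h2 t ht, h3 t ht, h4 t ht]; ring

lemma Qop_rad_zero (x : Eu n) (hx : R0 < ‖x‖) :
    (rad fun t => Real.exp (-n * t) * Qop n stp t : Sm n) x = 0 :=
  rad_zero_of_R0 ((Qop_wn (n := n) stp_deriv_wn).exp _).toRd (fun t ht => by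
    rw [Qop_stp_zero' ht, mul_zero]) x hx

lemma exp_neg_one_lt : Real.exp (-1) < 1 / 2 := by
  rw [Real.exp_neg, inv_lt_comm₀ (Real.exp_pos _) (by norm_num)]
  have := Real.exp_one_gt_d9
  norm_num; linarith

lemma sum_exp_le (N : ℕ) : ∑ k ∈ Finset.range N, Real.exp (-1) ^ k ≤ 2 := by
  have h0 := (Real.exp_pos (-1)).le
  have h1 := exp_neg_one_lt
  calc _ ≤ ∑' k : ℕ, Real.exp (-1) ^ k :=
        (summable_geometric_of_lt_one h0 (by linarith)).sum_le_tsum _ (fun _ _ => by positivity)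
    _ = (1 - Real.exp (-1))⁻¹ := tsum_geometric_of_lt_one h0 (by linarith)
    _ ≤ 2 := by
        rw [inv_le_comm₀ (by linarith) (by norm_num)]; linarith

/-- Interior estimates for the derivatives of order at most three. -/
theorem deriv_bound (hn : 5 ≤ n) {k : ℕ} (hk : k ≤ 3) : ∃ C, 0 ≤ C ∧ ∀ (v : Sm n) (x : Eu n)
    (r A B : ℝ), 0 < r → 0 ≤ A → 0 ≤ B →
    (∀ z ∈ closedBall x (r * R0), |v z| ≤ B) → (∀ z ∈ closedBall x (r * R0), |LP (LP v) z| ≤ A) →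
    ‖iteratedFDeriv ℝ k v.1 x‖ ≤ C * (r ^ k)⁻¹ * (B + r ^ 4 * A) := by
  obtain ⟨C1, hC1, h1⟩ := J_Dm_bound (n := n) Qop_rad_zero k
  obtain ⟨C2, hC2, h2⟩ := J_Dm_bound (n := n) chi_zero k
  have hm := mss_pos hn
  refine ⟨(mss n)⁻¹ * (C1 + 2 * C2), by positivity, fun v x r A B hr hA hB hv hf => ?_⟩
  have hin : ∀ s, 0 ≤ s → s ≤ r → ∀ z ∈ closedBall (0 : Eu n) R0, x + s • z ∈ closedBall x (r * R0) := by
    intro s hs hsr z hz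
    rw [mem_closedBall, dist_eq_norm, add_sub_cancel_left, norm_smul, Real.norm_of_nonneg hs]
    have : ‖z‖ ≤ R0 := by simpa using hz
    have := norm_nonneg z
    gcongr
  refine iteratedFDeriv_norm_le (by positivity) fun m => ?_
  set M := ∏ i, ‖m i‖ with hM
  have hM0 : 0 ≤ M := Finset.prod_nonneg fun i _ => norm_nonneg _
  set e := Real.exp (-1) with he
  have he0 : 0 < e := Real.exp_pos _
  have he1 : e < 1 := by have := exp_neg_one_lt; linarith
  have key : ∀ s, 0 < s → s ≤ r → ∀ g : Sm n, ∀ A, (∀ z ∈ closedBall x (r * R0), |g z| ≤ A) →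
      ∀ {η : Sm n} {C : ℝ}, Cs η → (∀ (m : Fin k → Eu n) (f : Sm n) (A : ℝ),
        (∀ z ∈ closedBall (0 : Eu n) R0, |f z| ≤ A) → |J (Dm k m η) f| ≤ C * (∏ i, ‖m i‖) * A) →
      |J η (aff x s (Dm k m g))| ≤ (s ^ k)⁻¹ * (C * M * A) := by
    intro s hs hsr g A hg η C hη hC
    have e1 : aff x s (Dm k m g) = (s ^ k)⁻¹ • Dm k m (aff x s g) := by
      rw [Dm_aff, smul_smul, inv_mul_cancel₀ (by positivity), one_smul]
    rw [e1, map_smul, J_Dm hη, smul_eq_mul, abs_mul, abs_of_pos (by positivity : 0 < (s ^ k)⁻¹),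
      abs_mul, abs_pow, abs_neg, abs_one, one_pow, one_mul]
    gcongr
    exact hC m _ A fun z hz => hg _ (hin s hs.le hsr z hz)
  have hb : ∀ N, |K (Qop n stp) (aff x r (Dm k m v)) +
      ∑ j ∈ Finset.range N, (r * e ^ j) ^ 4 * J (chi n) (aff x (r * e ^ j) (LP (LP (Dm k m v))))| ≤
      (C1 + 2 * C2) * (r ^ k)⁻¹ * (B + r ^ 4 * A) * M := by
    intro N
    have b1 := key r hr le_rfl v B hv ((Qop_wn (n := n) stp_deriv_wn).exp (-n)).cs h1
    have b2 : ∀ j, |(r * e ^ j) ^ 4 * J (chi n) (aff x (r * e ^ j) (LP (LP (Dm k m v))))| ≤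
        e ^ j * ((r ^ k)⁻¹ * r ^ 4 * (C2 * M * A)) := by
      intro j
      have hs : 0 < r * e ^ j := by positivity
      have hsr : r * e ^ j ≤ r := mul_le_of_le_one_right hr.le (pow_le_one₀ he0.le he1.le)
      have b := key _ hs hsr (LP (LP v)) A hf chi_cs h2
      rw [LP_Dm, LP_Dm, abs_mul, abs_of_pos (by positivity : 0 < (r * e ^ j) ^ 4)]
      calc _ ≤ (r * e ^ j) ^ 4 * (((r * e ^ j) ^ k)⁻¹ * (C2 * M * A)) := by gcongr
        _ = (r ^ k)⁻¹ * r ^ 4 * (C2 * M * A) * ((e ^ j) ^ 4 * ((e ^ j) ^ k)⁻¹) := by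
            rw [mul_pow, mul_pow, mul_inv]; ring
        _ ≤ (r ^ k)⁻¹ * r ^ 4 * (C2 * M * A) * e ^ j := by
            have h3 : (e ^ j) ^ 4 * ((e ^ j) ^ k)⁻¹ ≤ e ^ j := by
              have hej : 0 < e ^ j := by positivity
              have hej1 : e ^ j ≤ 1 := pow_le_one₀ he0.le he1.le
              rw [mul_inv_le_iff₀ (by positivity), ← pow_succ']
              exact pow_le_pow_of_le_one hej.le hej1 (by omega)
            gcongr
        _ = _ := by ring
    calc _ ≤ |K (Qop n stp) (aff x r (Dm k m v))| + |∑ j ∈ Finset.range N, (r * e ^ j) ^ 4 *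
            J (chi n) (aff x (r * e ^ j) (LP (LP (Dm k m v))))| := abs_add_le _ _
      _ ≤ (r ^ k)⁻¹ * (C1 * M * B) + ∑ j ∈ Finset.range N,
            e ^ j * ((r ^ k)⁻¹ * r ^ 4 * (C2 * M * A)) :=
          add_le_add b1 ((Finset.abs_sum_le_sum_abs _ _).trans (Finset.sum_le_sum fun j _ => b2 j))
      _ ≤ (r ^ k)⁻¹ * (C1 * M * B) + 2 * ((r ^ k)⁻¹ * r ^ 4 * (C2 * M * A)) := by
          rw [← Finset.sum_mul]
          have := sum_exp_le N
          gcongr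
      _ ≤ _ := by
          have p1 : 0 ≤ (r ^ k)⁻¹ * M * (C1 * (r ^ 4 * A)) := by positivity
          have p2 : 0 ≤ (r ^ k)⁻¹ * M * (2 * C2 * B) := by positivity
          nlinarith
  have hlim := le_of_tendsto (rep (Dm k m v) x r).abs (Eventually.of_forall hb)
  rw [abs_mul, abs_of_pos hm] at hlim
  calc _ = (mss n)⁻¹ * (mss n * |Dm k m v x|) := by field_simp
    _ ≤ (mss n)⁻¹ * ((C1 + 2 * C2) * (r ^ k)⁻¹ * (B + r ^ 4 * A) * M) := by gcongr
    _ = _ := by ring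

end

noncomputable section
open scoped ENNReal
variable {n : ℕ}

lemma lintegral_comp_aff (y : Eu n) {r : ℝ} (hr : 0 < r) {g : Eu n → ℝ≥0∞} (hg : Measurable g) :
    ∫⁻ z, g (y + r • z) = ENNReal.ofReal ((r ^ n)⁻¹) * ∫⁻ x, g x := by
  have h1 : ∫⁻ z, g (y + r • z) = ∫⁻ z, g (y + z) ∂(Measure.map (fun z => r • z) volume) := by
    rw [lintegral_map (by fun_prop) (by fun_prop)]
  rw [h1, Measure.map_addHaar_smul _ hr.ne', lintegral_smul_measure, lintegral_add_left_eq_self g y,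
    smul_eq_mul, finrank_euclideanSpace_fin, abs_of_pos (by positivity)]

lemma setLIntegral_comp_aff_le (y : Eu n) {r : ℝ} (hr : 0 < r) {g : Eu n → ℝ≥0∞} (hg : Measurable g)
    {U B : Set (Eu n)} (hU : MeasurableSet U) (hB : MeasurableSet B) (h : ∀ z ∈ U, y + r • z ∈ B) :
    ∫⁻ z in U, g (y + r • z) ≤ ENNReal.ofReal ((r ^ n)⁻¹) * ∫⁻ x in B, g x := by
  rw [← lintegral_indicator hU, ← lintegral_indicator hB,
    ← lintegral_comp_aff y hr (hg.indicator hB)]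
  refine lintegral_mono fun z => ?_
  by_cases hz : z ∈ U
  · simp [hz, h z hz]
  · simp [hz]

lemma J_enorm_le {η : Sm n} {R : ℝ} (hη : ∀ x, R < ‖x‖ → η x = 0) :
    ∃ C : ℝ, 0 ≤ C ∧ ∀ f : Sm n, ‖J η f‖ₑ ≤ ENNReal.ofReal C * ∫⁻ z in closedBall (0 : Eu n) R, ‖f z‖ₑ := by
  have hc : Cs η := HasCompactSupport.of_support_subset_isCompact (isCompact_closedBall 0 R)
    (fun x hx => by by_contra h; exact hx (hη x (by simpa using h)))
  obtain ⟨C, hC⟩ := (Sm.cont η).bounded_above_of_compact_support hc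
  have hC0 : 0 ≤ C := (norm_nonneg _).trans (hC 0)
  refine ⟨C, hC0, fun f => ?_⟩
  rw [J_apply hc]
  refine (enorm_integral_le_lintegral_enorm _).trans ?_
  rw [← lintegral_const_mul _ (Sm.cont f).measurable.enorm, ← lintegral_indicator measurableSet_closedBall]
  refine lintegral_mono fun z => ?_
  by_cases hz : z ∈ closedBall (0 : Eu n) R
  · simp only [hz, indicator_of_mem, enorm_mul]
    gcongr
    rw [← ofReal_norm]
    exact ENNReal.ofReal_le_ofReal (hC z)
  · simp [hη z (by simpa using hz)]

/-- The `L¹` averages entering the representation formula. -/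
def avg (f : Sm n) (x : Eu n) (s : ℝ) : ℝ≥0∞ := ∫⁻ z in closedBall (0 : Eu n) R0, ‖f (x + s • z)‖ₑ

lemma rep_enorm (hn : 5 ≤ n) : ∃ C : ℝ, 0 ≤ C ∧ ∀ (v : Sm n) (x : Eu n) (r : ℝ), 0 < r →
    ‖v x‖ₑ ≤ ENNReal.ofReal C * (avg v x r + ∑' k : ℕ,
      ENNReal.ofReal ((r * Real.exp (-1) ^ k) ^ 4) * avg (LP (LP v)) x (r * Real.exp (-1) ^ k)) := by
  obtain ⟨C1, hC1, h1⟩ := J_enorm_le (n := n) Qop_rad_zero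
  obtain ⟨C2, hC2, h2⟩ := J_enorm_le (n := n) chi_zero
  have hm := mss_pos hn
  refine ⟨(mss n)⁻¹ * (C1 + C2), by positivity, fun v x r hr => ?_⟩
  set S := avg v x r + ∑' k : ℕ,
      ENNReal.ofReal ((r * Real.exp (-1) ^ k) ^ 4) * avg (LP (LP v)) x (r * Real.exp (-1) ^ k) with hS
  have hb : ∀ N, ‖K (Qop n stp) (aff x r v) + ∑ k ∈ Finset.range N, (r * Real.exp (-1) ^ k) ^ 4 *
        J (chi n) (aff x (r * Real.exp (-1) ^ k) (LP (LP v)))‖ₑ ≤ ENNReal.ofReal (C1 + C2) * S := by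
    intro N
    calc _ ≤ ‖K (Qop n stp) (aff x r v)‖ₑ + ‖∑ k ∈ Finset.range N, (r * Real.exp (-1) ^ k) ^ 4 *
            J (chi n) (aff x (r * Real.exp (-1) ^ k) (LP (LP v)))‖ₑ := enorm_add_le _ _
      _ ≤ ENNReal.ofReal C1 * avg v x r + ∑ k ∈ Finset.range N,
            ENNReal.ofReal C2 * (ENNReal.ofReal ((r * Real.exp (-1) ^ k) ^ 4) *
              avg (LP (LP v)) x (r * Real.exp (-1) ^ k)) := by
          refine add_le_add (h1 _) ((enorm_sum_le _ _).trans (Finset.sum_le_sum fun k _ => ?_))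
          rw [enorm_mul, Real.enorm_of_nonneg (by positivity), mul_left_comm]
          gcongr
          exact h2 _
      _ ≤ ENNReal.ofReal C1 * S + ENNReal.ofReal C2 * S := by
          rw [← Finset.mul_sum]
          gcongr
          · exact le_self_add
          · exact (ENNReal.sum_le_tsum _).trans le_add_self
      _ = _ := by rw [← add_mul, ENNReal.ofReal_add hC1 hC2]
  have hlim := le_of_tendsto ((continuous_enorm.tendsto _).comp (rep v x r)) (Eventually.of_forall hb)
  calc ‖v x‖ₑ = ENNReal.ofReal (mss n)⁻¹ * ‖mss n * v x‖ₑ := by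
        rw [enorm_mul, Real.enorm_of_nonneg hm.le, ← mul_assoc, ← ENNReal.ofReal_mul (by positivity),
          inv_mul_cancel₀ hm.ne']
        simp
    _ ≤ ENNReal.ofReal (mss n)⁻¹ * (ENNReal.ofReal (C1 + C2) * S) := by gcongr
    _ = _ := by rw [← mul_assoc, ← ENNReal.ofReal_mul (by positivity)]

lemma tsum_sq_mul_rpow_le {b a : ℕ → ℝ≥0∞} {q : ℝ} (hq : 0 < q) (hb : ∑' k, b k ≤ 2) :
    (∑' k, b k ^ 2 * a k) ^ q ≤ 2 ^ q * ∑' k, b k ^ q * a k ^ q := by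
  set T := ∑' k, b k ^ q * a k ^ q with hT
  have h1 : ∀ k, b k * a k ≤ T ^ (1 / q) := fun k => by
    rw [one_div, ENNReal.le_rpow_inv_iff hq, ENNReal.mul_rpow_of_nonneg _ _ hq.le]
    exact ENNReal.le_tsum k
  have h2 : ∑' k, b k ^ 2 * a k ≤ 2 * T ^ (1 / q) :=
    calc _ ≤ ∑' k, b k * T ^ (1 / q) := ENNReal.tsum_le_tsum fun k => by
          rw [sq, mul_assoc]; gcongr; exact h1 k
      _ = (∑' k, b k) * T ^ (1 / q) := ENNReal.tsum_mul_right
      _ ≤ _ := by gcongr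
  calc _ ≤ (2 * T ^ (1 / q)) ^ q := by gcongr
    _ = 2 ^ q * T := by
      rw [ENNReal.mul_rpow_of_nonneg _ _ hq.le, ← ENNReal.rpow_mul, one_div, inv_mul_cancel₀ hq.ne',
        ENNReal.rpow_one]

lemma lintegral_rpow_le {U : Set (Eu n)} {g : Eu n → ℝ≥0∞} (hg : Measurable g) {q : ℝ} (hq : 1 < q) :
    (∫⁻ x in U, g x) ^ q ≤ volume U ^ (q - 1) * ∫⁻ x in U, g x ^ q := by
  have hpq : q.HolderConjugate (q / (q - 1)) := Real.HolderConjugate.conjExponent hq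
  have h := ENNReal.lintegral_mul_le_Lp_mul_Lq (volume.restrict U) hpq (f := g) (g := fun _ => 1)
    hg.aemeasurable aemeasurable_const
  simp only [Pi.mul_apply, mul_one, ENNReal.one_rpow, lintegral_const, one_mul,
    Measure.restrict_apply MeasurableSet.univ, univ_inter] at h
  calc _ ≤ ((∫⁻ x in U, g x ^ q) ^ (1 / q) * volume U ^ (1 / (q / (q - 1)))) ^ q := by gcongr
    _ = _ := by
      have hq0 : 0 < q := by linarith
      rw [ENNReal.mul_rpow_of_nonneg _ _ hq0.le, ← ENNReal.rpow_mul, ← ENNReal.rpow_mul, mul_comm]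
      congr 2
      · field_simp
      · rw [one_div, inv_mul_cancel₀ hq0.ne', ENNReal.rpow_one]

end

noncomputable section
open scoped ENNReal
variable {n : ℕ}

/-- The fixed scale at which the representation formula is used. -/
def r0 : ℝ := Real.exp (-5)

lemma r0_pos : 0 < r0 := Real.exp_pos _

lemma r0_le_one : r0 ≤ 1 := by rw [r0, Real.exp_le_one_iff]; norm_num

lemma r0_R0 : r0 * R0 < 1 / 4 := by
  have h := exp_neg_one_lt
  have h0 := Real.exp_pos (-1)
  rw [r0, R0, ← Real.exp_add, show (-5 + 3 : ℝ) = -1 + -1 by norm_num, Real.exp_add]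
  nlinarith

lemma add_smul_mem_half {x z : Eu n} (hx : x ∈ ball (0 : Eu n) (1 / 4)) {s : ℝ} (hs : 0 < s) (hs' : s ≤ r0)
    (hz : z ∈ closedBall (0 : Eu n) R0) : x + s • z ∈ ball (0 : Eu n) (1 / 2) := by
  have h1 : ‖x‖ < 1 / 4 := by simpa using hx
  have h2 : ‖z‖ ≤ R0 := by simpa using hz
  have h3 := r0_R0
  have h4 : s * ‖z‖ ≤ r0 * R0 := by have := norm_nonneg z; have := r0_pos; gcongr
  rw [mem_ball_zero_iff]
  calc _ ≤ ‖x‖ + ‖s • z‖ := norm_add_le _ _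
    _ = ‖x‖ + s * ‖z‖ := by rw [norm_smul, Real.norm_of_nonneg hs.le]
    _ < _ := by linarith

lemma avg_le (F : Sm n) {x : Eu n} (hx : x ∈ ball (0 : Eu n) (1 / 4)) {s : ℝ} (hs : 0 < s)
    (hs' : s ≤ r0) :
    avg F x s ≤ ENNReal.ofReal ((s ^ n)⁻¹) * ∫⁻ y in ball (0 : Eu n) (1 / 2), ‖F y‖ₑ :=
  setLIntegral_comp_aff_le x hs (Sm.cont F).measurable.enorm measurableSet_closedBall measurableSet_ball
    fun _ hz => add_smul_mem_half hx hs hs' hz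

lemma measurable_avg (F : Sm n) (s : ℝ) : Measurable fun x => avg F x s := by
  unfold avg
  have : Measurable (Function.uncurry fun (x z : Eu n) => ‖F (x + s • z)‖ₑ) := by
    have := Sm.cont F
    refine Continuous.measurable ?_
    change Continuous fun q : Eu n × Eu n => ‖F.1 (q.1 + s • q.2)‖ₑ
    fun_prop
  exact this.lintegral_prod_right

lemma lintegral_avg_le (F : Sm n) {s : ℝ} (hs : 0 < s) (hs' : s ≤ r0) :
    ∫⁻ x in ball (0 : Eu n) (1 / 4), avg F x s ≤
      volume (closedBall (0 : Eu n) R0) * ∫⁻ y in ball (0 : Eu n) (1 / 2), ‖F y‖ₑ := by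
  unfold avg
  rw [lintegral_lintegral_swap]
  · calc _ ≤ ∫⁻ z in closedBall (0 : Eu n) R0, ∫⁻ y in ball (0 : Eu n) (1 / 2), ‖F y‖ₑ := by
          refine setLIntegral_mono_ae' measurableSet_closedBall (ae_of_all _ fun z hz => ?_)
          have h := setLIntegral_comp_aff_le (s • z) one_pos (Sm.cont F).measurable.enorm
            (measurableSet_ball (x := (0 : Eu n)) (ε := 1 / 4))
            (measurableSet_ball (x := (0 : Eu n)) (ε := 1 / 2)) (fun x hx => by
              rw [one_smul, add_comm]; exact add_smul_mem_half hx hs hs' hz)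
          simpa [add_comm] using h
      _ = _ := by rw [lintegral_const, Measure.restrict_apply_univ, mul_comm]
  · have := Sm.cont F
    refine (Continuous.measurable ?_).aemeasurable
    change Continuous fun q : Eu n × Eu n => ‖F.1 (q.1 + s • q.2)‖ₑ
    fun_prop

theorem lq_estimate (hn : 5 ≤ n) {σ : ℝ} (hσ : 0 < σ) (hnσ : n * σ ≤ 1) :
    ∃ C : ℝ≥0∞, C ≠ ⊤ ∧ ∀ (v : Sm n) (ρ : ℝ), 0 < ρ → ρ ≤ 1 / 4 →
      ∫⁻ x in ball (0 : Eu n) ρ, ‖v x‖ₑ ^ (1 + σ) ≤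
        C * (ENNReal.ofReal (ρ ^ n) * (∫⁻ x in ball (0 : Eu n) (1 / 2), ‖v x‖ₑ ^ (1 + σ)) +
          (∫⁻ x in ball (0 : Eu n) (1 / 2), ‖LP (LP v) x‖ₑ) ^ (1 + σ)) := by
  obtain ⟨C1, hC1, hrep⟩ := rep_enorm hn
  set q := 1 + σ with hq
  have hq0 : 0 < q := by linarith
  have hq1 : 1 < q := by linarith
  set V := volume (closedBall (0 : Eu n) R0) with hV
  have hVt : V ≠ ⊤ := measure_closedBall_lt_top.ne
  set W := volume (ball (0 : Eu n) 1) with hW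
  have hWt : W ≠ ⊤ := measure_ball_lt_top.ne
  set A := ENNReal.ofReal C1 ^ q * 2 ^ (q - 1) with hA
  have hAt : A ≠ ⊤ := ENNReal.mul_ne_top (ENNReal.rpow_ne_top_of_nonneg hq0.le ENNReal.ofReal_ne_top)
    (ENNReal.rpow_ne_top_of_nonneg (by linarith) (by simp))
  set B1 := V ^ (q - 1) * ENNReal.ofReal ((r0 ^ n)⁻¹) with hB1
  have hB1t : B1 ≠ ⊤ := ENNReal.mul_ne_top (ENNReal.rpow_ne_top_of_nonneg (by linarith) hVt)
    ENNReal.ofReal_ne_top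
  set B2 := 2 ^ q * (V * 2) with hB2
  have hB2t : B2 ≠ ⊤ := ENNReal.mul_ne_top (ENNReal.rpow_ne_top_of_nonneg hq0.le (by simp))
    (ENNReal.mul_ne_top hVt (by simp))
  refine ⟨A * (B1 * W + B2), ENNReal.mul_ne_top hAt (ENNReal.add_ne_top.2
    ⟨ENNReal.mul_ne_top hB1t hWt, hB2t⟩), fun v ρ hρ hρ' => ?_⟩
  set F := LP (LP v) with hF
  set I := ∫⁻ x in ball (0 : Eu n) (1 / 2), ‖v x‖ₑ ^ q with hI
  set G := ∫⁻ x in ball (0 : Eu n) (1 / 2), ‖F x‖ₑ with hG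
  let s : ℕ → ℝ := fun k => r0 * Real.exp (-1) ^ k
  have he1 : Real.exp (-1) ≤ 1 := by have := exp_neg_one_lt; linarith
  have hs0 : ∀ k, 0 < s k := fun k => mul_pos r0_pos (pow_pos (Real.exp_pos _) _)
  have hsr : ∀ k, s k ≤ r0 := fun k =>
    mul_le_of_le_one_right r0_pos.le (pow_le_one₀ (Real.exp_pos _).le he1)
  have hs1 : ∀ k, s k ≤ 1 := fun k => (hsr k).trans r0_le_one
  have hse : ∀ k, s k ≤ Real.exp (-1) ^ k := fun k =>
    mul_le_of_le_one_left (pow_pos (Real.exp_pos _) _).le r0_le_one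
  have hsum : ∑' k, ENNReal.ofReal (s k) ≤ 2 := by
    refine ENNReal.tsum_le_of_sum_range_le fun N => ?_
    rw [← ENNReal.ofReal_sum_of_nonneg (fun k _ => (hs0 k).le)]
    calc _ ≤ ENNReal.ofReal 2 := ENNReal.ofReal_le_ofReal
          ((Finset.sum_le_sum fun k _ => hse k).trans (sum_exp_le N))
      _ = 2 := by simp
  let b : ℕ → ℝ≥0∞ := fun k => ENNReal.ofReal (s k ^ 2)
  have hb : ∑' k, b k ≤ 2 := (ENNReal.tsum_le_tsum fun k => ENNReal.ofReal_le_ofReal (by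
    have := hs0 k; have := hs1 k; nlinarith)).trans hsum
  have hsub : ball (0 : Eu n) ρ ⊆ ball (0 : Eu n) (1 / 4) := ball_subset_ball hρ'
  have hpt : ∀ x ∈ ball (0 : Eu n) ρ, ‖v x‖ₑ ^ q ≤
      A * (B1 * I + 2 ^ q * ∑' k, b k ^ q * avg F x (s k) ^ q) := by
    intro x hx
    have h1 := hrep v x r0 r0_pos
    have e1 : ∀ k, ENNReal.ofReal ((r0 * Real.exp (-1) ^ k) ^ 4) = b k ^ 2 := fun k => by
      change _ = ENNReal.ofReal (s k ^ 2) ^ 2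
      rw [← ENNReal.ofReal_pow (by positivity), ← pow_mul]
    simp only [e1] at h1
    have h2 : avg v x r0 ^ q ≤ B1 * I := by
      rw [avg]
      refine (lintegral_rpow_le (Sm.cont (aff x r0 v)).measurable.enorm hq1).trans ?_
      rw [hB1, mul_assoc]
      gcongr
      exact setLIntegral_comp_aff_le x r0_pos ((Sm.cont v).measurable.enorm.pow_const q)
        measurableSet_closedBall measurableSet_ball
        fun _ hz => add_smul_mem_half (hsub hx) r0_pos le_rfl hz
    calc _ ≤ (ENNReal.ofReal C1 * (avg v x r0 + ∑' k, b k ^ 2 * avg F x (s k))) ^ q := by gcongr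
      _ = ENNReal.ofReal C1 ^ q * (avg v x r0 + ∑' k, b k ^ 2 * avg F x (s k)) ^ q :=
          ENNReal.mul_rpow_of_nonneg _ _ hq0.le
      _ ≤ ENNReal.ofReal C1 ^ q * (2 ^ (q - 1) * (avg v x r0 ^ q + (∑' k, b k ^ 2 * avg F x (s k)) ^ q)) := by
          gcongr
          exact ENNReal.rpow_add_le_mul_rpow_add_rpow _ _ hq1.le
      _ ≤ ENNReal.ofReal C1 ^ q * (2 ^ (q - 1) *
            (B1 * I + 2 ^ q * ∑' k, b k ^ q * avg F x (s k) ^ q)) := by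
          gcongr
          exact tsum_sq_mul_rpow_le hq0 hb
      _ = _ := by rw [hA]; ring
  have hk : ∀ k, ∫⁻ x in ball (0 : Eu n) ρ, b k ^ q * avg F x (s k) ^ q ≤
      ENNReal.ofReal (s k) * (V * G ^ q) := by
    intro k
    have h1 : ∀ x ∈ ball (0 : Eu n) ρ, b k ^ q * avg F x (s k) ^ q ≤
        ENNReal.ofReal (s k) * G ^ σ * avg F x (s k) := by
      intro x hx
      have h2 := avg_le F (hsub hx) (hs0 k) (hsr k)
      have h3 : avg F x (s k) ^ q ≤ (ENNReal.ofReal ((s k ^ n)⁻¹) * G) ^ σ * avg F x (s k) := by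
        rw [hq, add_comm, ENNReal.rpow_add_of_nonneg _ _ hσ.le zero_le_one, ENNReal.rpow_one]
        gcongr
      have h4 : b k ^ q * ENNReal.ofReal ((s k ^ n)⁻¹) ^ σ ≤ ENNReal.ofReal (s k) := by
        change ENNReal.ofReal (s k ^ 2) ^ q * _ ≤ _
        have hp := hs0 k
        rw [ENNReal.ofReal_rpow_of_nonneg (by positivity) hq0.le,
          ENNReal.ofReal_rpow_of_nonneg (by positivity) hσ.le, ← ENNReal.ofReal_mul (by positivity)]
        refine ENNReal.ofReal_le_ofReal ?_
        rw [← Real.rpow_natCast (s k) 2, ← Real.rpow_natCast (s k) n, ← Real.rpow_neg hp.le,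
          ← Real.rpow_mul hp.le, ← Real.rpow_mul hp.le, ← Real.rpow_add hp]
        calc _ ≤ s k ^ (1 : ℝ) := by
              refine Real.rpow_le_rpow_of_exponent_ge hp (hs1 k) ?_
              push_cast; nlinarith
          _ = s k := Real.rpow_one _
      calc _ ≤ b k ^ q * ((ENNReal.ofReal ((s k ^ n)⁻¹) * G) ^ σ * avg F x (s k)) := by gcongr
        _ = (b k ^ q * ENNReal.ofReal ((s k ^ n)⁻¹) ^ σ) * G ^ σ * avg F x (s k) := by
            rw [ENNReal.mul_rpow_of_nonneg _ _ hσ.le]; ring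
        _ ≤ _ := by gcongr
    calc _ ≤ ∫⁻ x in ball (0 : Eu n) ρ, ENNReal.ofReal (s k) * G ^ σ * avg F x (s k) :=
          setLIntegral_mono_ae' measurableSet_ball (ae_of_all _ h1)
      _ ≤ ∫⁻ x in ball (0 : Eu n) (1 / 4), ENNReal.ofReal (s k) * G ^ σ * avg F x (s k) :=
          lintegral_mono_set hsub
      _ = ENNReal.ofReal (s k) * G ^ σ * ∫⁻ x in ball (0 : Eu n) (1 / 4), avg F x (s k) :=
          lintegral_const_mul _ (measurable_avg F _)
      _ ≤ ENNReal.ofReal (s k) * G ^ σ * (V * G) := by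
          gcongr
          exact lintegral_avg_le F (hs0 k) (hsr k)
      _ = _ := by
          have : G ^ q = G ^ σ * G := by
            rw [hq, add_comm, ENNReal.rpow_add_of_nonneg _ _ hσ.le zero_le_one, ENNReal.rpow_one]
          rw [this]; ring
  have hm : ∀ k, Measurable fun x => b k ^ q * avg F x (s k) ^ q := fun k =>
    ((measurable_avg F _).pow_const q).const_mul _
  have hvol : volume (ball (0 : Eu n) ρ) = ENNReal.ofReal (ρ ^ n) * W := by
    rw [Measure.addHaar_ball_of_pos _ _ hρ, finrank_euclideanSpace_fin]
  calc _ ≤ ∫⁻ x in ball (0 : Eu n) ρ, A * (B1 * I + 2 ^ q * ∑' k, b k ^ q * avg F x (s k) ^ q) :=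
        setLIntegral_mono_ae' measurableSet_ball (ae_of_all _ hpt)
    _ = A * (B1 * I * volume (ball (0 : Eu n) ρ) +
          2 ^ q * ∑' k, ∫⁻ x in ball (0 : Eu n) ρ, b k ^ q * avg F x (s k) ^ q) := by
        have m1 : Measurable fun x => ∑' k, b k ^ q * avg F x (s k) ^ q := Measurable.tsum hm
        have m2 : Measurable fun x => B1 * I + 2 ^ q * ∑' k, b k ^ q * avg F x (s k) ^ q :=
          measurable_const.add (m1.const_mul _)
        rw [lintegral_const_mul _ m2,
          lintegral_add_left measurable_const, lintegral_const, Measure.restrict_apply_univ,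
          lintegral_const_mul _ m1, lintegral_tsum fun k => (hm k).aemeasurable]
    _ ≤ A * (B1 * I * (ENNReal.ofReal (ρ ^ n) * W) + 2 ^ q * (2 * (V * G ^ q))) := by
        rw [hvol]
        gcongr
        calc _ ≤ ∑' k, ENNReal.ofReal (s k) * (V * G ^ q) := ENNReal.tsum_le_tsum hk
          _ = (∑' k, ENNReal.ofReal (s k)) * (V * G ^ q) := ENNReal.tsum_mul_right
          _ ≤ _ := by gcongr
    _ = A * (B1 * W * (ENNReal.ofReal (ρ ^ n) * I) + B2 * G ^ q) := by rw [hB2]; ring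
    _ ≤ A * ((B1 * W + B2) * (ENNReal.ofReal (ρ ^ n) * I) + (B1 * W + B2) * G ^ q) := by
        gcongr
        · exact le_self_add
        · exact le_add_self
    _ = _ := by ring

end

noncomputable section
open scoped ENNReal
variable {n : ℕ}

lemma Gm_pow_left (ζ g : Sm n) (k : ℕ) : Gm (ζ ^ (k + 1)) g = ((k : ℝ) + 1) • (ζ ^ k * Gm ζ g) := by
  induction k with
  | zero => ext x; simp
  | succ k ih =>
    rw [pow_succ, Gm_mul_left, ih]
    ext x; simp; ring

lemma LP_pow (ζ : Sm n) (k : ℕ) : LP (ζ ^ (k + 2)) =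
    ζ ^ k * (((k : ℝ) + 2) • (ζ * LP ζ) + (((k : ℝ) + 2) * ((k : ℝ) + 1)) • Gm ζ ζ) := by
  induction k with
  | zero => rw [zero_add, pow_two, LP_mul]; ext x; simp; ring
  | succ k ih =>
    rw [show k + 1 + 2 = (k + 2) + 1 by ring, pow_succ, LP_mul, ih, Gm_pow_left]
    ext x; simp; ring

lemma Cs.exists_bound {η : Sm n} (h : Cs η) : ∃ C : ℝ, 0 ≤ C ∧ ∀ x, |η x| ≤ C := by
  obtain ⟨C, hC⟩ := HasCompactSupport.exists_bound_of_continuous h (Sm.cont η)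
  exact ⟨C, (norm_nonneg _).trans (hC 0), hC⟩

lemma exists_cutoff_bound {ζ : Sm n} (h : Cs ζ) (N : ℕ) : ∃ C : ℝ, 0 ≤ C ∧ ∀ x,
    Gm (ζ ^ (N + 2)) (ζ ^ (N + 2)) x ^ 2 ≤ C * ζ x ^ (2 * N) * (ζ ^ (N + 2)) x ^ 2 ∧
    |LP (Gm (ζ ^ (N + 2)) (ζ ^ (N + 2))) x| ≤ C * ζ x ^ (2 * N) ∧
    LP (ζ ^ (N + 2)) x ^ 2 ≤ C * ζ x ^ (2 * N) := by
  set G := Gm ζ ζ with hG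
  have cG : Cs G := h.Gm ζ
  set b : ℝ := ((N : ℝ) + 2) ^ 2 with hb
  have e1 : Gm (ζ ^ (N + 2)) (ζ ^ (N + 2)) = b • (ζ ^ (2 * N + 2) * G) := by
    rw [Gm_pow_left ζ _ (N + 1), Gm_comm, Gm_pow_left ζ _ (N + 1)]
    ext x; simp [hb, hG]; ring
  set H := (((2 * N : ℕ) : ℝ) + 2) • (ζ * LP ζ) +
    ((((2 * N : ℕ) : ℝ) + 2) * (((2 * N : ℕ) : ℝ) + 1)) • G with hH
  set H2 := b • (ζ ^ 2 * LP G + G * H + (2 * (((2 * N + 1 : ℕ) : ℝ) + 1)) • (ζ * Gm ζ G)) with hH2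
  have e2 : LP (Gm (ζ ^ (N + 2)) (ζ ^ (N + 2))) = ζ ^ (2 * N) * H2 := by
    rw [e1, LP_smul, LP_mul, LP_pow, Gm_pow_left ζ _ (2 * N + 1)]
    ext x; simp [hH2, hH]; ring
  set H3 := ((N : ℝ) + 2) • (ζ * LP ζ) + (((N : ℝ) + 2) * ((N : ℝ) + 1)) • G with hH3
  have e3 : LP (ζ ^ (N + 2)) = ζ ^ N * H3 := LP_pow ζ N
  have cH : Cs H := ((h.mul _).smul _).add (cG.smul _)
  have cH2 : Cs H2 := ((cG.LP.mul' _ |>.add (cG.mul _)).add ((h.mul _).smul _)).smul _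
  have cH3 : Cs H3 := ((h.mul _).smul _).add (cG.smul _)
  obtain ⟨C1, h1, h1'⟩ := ((cG.smul b).mul (b • G)).exists_bound
  obtain ⟨C2, h2, h2'⟩ := cH2.exists_bound
  obtain ⟨C3, h3, h3'⟩ := (cH3.mul H3).exists_bound
  have hz : ∀ x, 0 ≤ ζ x ^ (2 * N) := fun x => by rw [pow_mul]; positivity
  refine ⟨C1 + C2 + C3, by positivity, fun x => ⟨?_, ?_, ?_⟩⟩
  · rw [e1]
    have := (le_abs_self _).trans (h1' x)
    simp only [Sm.smul_apply, Sm.mul_apply, Sm.pow_apply] at this ⊢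
    calc _ = ζ x ^ (2 * N) * (ζ x ^ (N + 2)) ^ 2 * (b * G x * (b * G x)) := by ring
      _ ≤ ζ x ^ (2 * N) * (ζ x ^ (N + 2)) ^ 2 * (C1 + C2 + C3) := by
          have := hz x
          gcongr; linarith
      _ = _ := by ring
  · rw [e2, Sm.mul_apply, abs_mul, Sm.pow_apply, abs_of_nonneg (hz x), mul_comm]
    have := hz x
    gcongr
    linarith [h2' x]
  · rw [e3, Sm.mul_apply, mul_pow, Sm.pow_apply, ← pow_mul, mul_comm N 2, mul_comm]
    have := hz x
    have := (le_abs_self _).trans (h3' x)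
    simp only [Sm.mul_apply] at this
    gcongr
    nlinarith

/-- A weighted Young inequality with a degenerate weight. -/
lemma weight_young {p : ℝ} (hp : 1 < p) {N : ℕ} (hN : 4 ≤ N * (p - 1)) {L : ℝ} (hL : 0 < L) {q : ℝ}
    (hq0 : 0 ≤ q) (hq2 : q ≤ 2) {x s : ℝ} (hx0 : 0 ≤ x) (hx1 : x ≤ 1) (hs : 0 ≤ s) :
    x ^ (2 * N) * s ^ 2 ≤ L⁻¹ * (x ^ (2 * N + 4) * (s ^ (p - 1) * s ^ 2)) +
      (1 + L ^ (2 / (p - 1))) * s ^ q := by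
  have hp' : 0 < p - 1 := by linarith
  have hsq : 0 ≤ s ^ q := Real.rpow_nonneg hs _
  have hLL : 0 ≤ L ^ (2 / (p - 1)) := Real.rpow_nonneg hL.le _
  have hxN : x ^ (2 * N) ≤ 1 := pow_le_one₀ hx0 hx1
  have hx0N : 0 ≤ x ^ (2 * N) := by positivity
  have hsp : 0 ≤ s ^ (p - 1) := Real.rpow_nonneg hs _
  rcases le_or_gt L (x ^ 4 * s ^ (p - 1)) with h | h
  · have : 1 ≤ L⁻¹ * (x ^ 4 * s ^ (p - 1)) := by
      rw [inv_mul_eq_div, le_div_iff₀ hL]; linarith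
    calc x ^ (2 * N) * s ^ 2 ≤ x ^ (2 * N) * s ^ 2 * (L⁻¹ * (x ^ 4 * s ^ (p - 1))) :=
          le_mul_of_one_le_right (by positivity) this
      _ = L⁻¹ * (x ^ (2 * N + 4) * (s ^ (p - 1) * s ^ 2)) := by ring
      _ ≤ _ := by
          have : 0 ≤ (1 + L ^ (2 / (p - 1))) * s ^ q := by positivity
          linarith
  · have h0 : 0 ≤ L⁻¹ * (x ^ (2 * N + 4) * (s ^ (p - 1) * s ^ 2)) := by positivity
    suffices x ^ (2 * N) * s ^ 2 ≤ (1 + L ^ (2 / (p - 1))) * s ^ q by linarith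
    rcases le_or_gt s 1 with h1 | h1
    · have : s ^ 2 ≤ s ^ q := by
        rcases hs.eq_or_lt with rfl | hs0
        · simpa using Real.rpow_nonneg le_rfl q
        · rw [← Real.rpow_natCast]
          exact Real.rpow_le_rpow_of_exponent_ge hs0 h1 (by simpa using hq2)
      nlinarith
    · have h3 : (x ^ N * s) ^ (p - 1) ≤ L := by
        rw [Real.mul_rpow (by positivity) hs, ← Real.rpow_natCast, ← Real.rpow_mul hx0]
        refine le_trans ?_ h.le
        gcongr
        rw [← Real.rpow_natCast]
        rcases hx0.eq_or_lt with rfl | hx0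
        · rw [Real.zero_rpow (by linarith), Real.zero_rpow (by norm_num)]
        · exact Real.rpow_le_rpow_of_exponent_ge hx0 hx1 (by simpa using hN)
      have h4 : x ^ N * s ≤ L ^ (1 / (p - 1)) := by
        rw [one_div, Real.le_rpow_inv_iff_of_pos (by positivity) hL.le hp']
        exact h3
      have h5 : x ^ (2 * N) * s ^ 2 ≤ L ^ (2 / (p - 1)) := by
        calc _ = (x ^ N * s) ^ 2 := by ring
          _ ≤ (L ^ (1 / (p - 1))) ^ 2 := by gcongr
          _ = _ := by rw [← Real.rpow_natCast, ← Real.rpow_mul hL.le]; congr 1; push_cast; ring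
      have h6 : 1 ≤ s ^ q := Real.one_le_rpow h1.le hq0
      nlinarith

end

noncomputable section
open scoped ENNReal
variable {n : ℕ}

theorem interior_bound {p : ℝ} (hp : 1 < p) {Ω : Set (Eu n)} {ζ : Sm n} (hζ : Cs ζ)
    (hΩ : tsupport ζ.1 ⊆ Ω) (hζ0 : ∀ x, 0 ≤ ζ x) (hζ1 : ∀ x, ζ x ≤ 1) {c0 : ℝ} (hc0 : 0 < c0)
    {q : ℝ} (hq0 : 0 ≤ q) (hq2 : q ≤ 2) :
    ∃ (N : ℕ) (C : ℝ), 0 ≤ C ∧ ∀ (v : Sm n) (c : Eu n → ℝ), Adm p v c Ω → (∀ x ∈ Ω, c0 ≤ c x) →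
      J (ζ ^ (2 * N + 4)) (v * LP (LP v)) + J (ζ ^ (2 * N + 4)) (LP v * LP v) ≤
        C * ∫ x in tsupport ζ.1, |v x| ^ q := by
  have hp' : 0 < p - 1 := by linarith
  obtain ⟨N, hN⟩ := exists_nat_ge (4 / (p - 1))
  rw [div_le_iff₀ hp'] at hN
  obtain ⟨C1, hC1, hb⟩ := exists_cutoff_bound hζ N
  set K := cacc p * C1 + 1 with hK
  have hK0 : 0 < K := by have := cacc_pos hp; positivity
  set L := 2 * K / c0 with hL
  have hL0 : 0 < L := by positivity
  set M := K * (1 + L ^ (2 / (p - 1))) with hM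
  have hM0 : 0 ≤ M := by have := Real.rpow_nonneg hL0.le (2 / (p - 1)); positivity
  have epow : ζ ^ (N + 2) * ζ ^ (N + 2) = ζ ^ (2 * N + 4) := by ring
  refine ⟨N, 2 * M, by positivity, fun v c h hc => ?_⟩
  have cη : Cs (ζ ^ (N + 2)) := by rw [pow_succ]; exact hζ.mul' _
  have c2 : Cs (ζ ^ (2 * N + 4)) := by rw [pow_succ]; exact hζ.mul' _
  have hN0 : N ≠ 0 := by rintro rfl; norm_num at hN
  have cω : Cs (C1 • ζ ^ (2 * N)) := by
    obtain ⟨k, rfl⟩ := Nat.exists_eq_succ_of_ne_zero hN0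
    rw [show 2 * (k + 1) = 2 * k + 1 + 1 by ring, pow_succ]
    exact (hζ.mul' _).smul _
  have hts : tsupport (ζ ^ (N + 2)).1 ⊆ Ω := by
    refine (closure_mono ?_).trans hΩ
    intro x hx
    simp only [Function.mem_support] at hx ⊢
    intro h0
    exact hx (by change (ζ x) ^ (N + 2) = 0; rw [h0]; simp)
  have h1 := caccioppoli hp h cη hts cω
    (fun x => by simpa using (hb x).1) (fun x => by simpa using (hb x).2.1)
    (fun x => by simpa using (hb x).2.2)
  rw [epow] at h1
  have hint : IntegrableOn (fun x => |v x| ^ q) (tsupport ζ.1) := by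
    refine ContinuousOn.integrableOn_compact hζ ?_
    exact ((Sm.cont v).abs.rpow_const fun x => Or.inr hq0).continuousOn
  have hnn : 0 ≤ J (ζ ^ (2 * N + 4)) (LP v * LP v) := J_nonneg c2 fun x => by
    have := hζ0 x
    simp only [Sm.pow_apply, Sm.mul_apply]
    have := mul_self_nonneg (LP v x)
    positivity
  have h2 : cacc p * J (C1 • ζ ^ (2 * N)) (v * v) ≤
      (1 / 2) * J (ζ ^ (2 * N + 4)) (v * LP (LP v)) + M * ∫ x in tsupport ζ.1, |v x| ^ q := by
    rw [J_apply cω, J_apply c2, ← integral_indicator (isClosed_tsupport _).measurableSet,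
      ← integral_const_mul, ← integral_const_mul, ← integral_const_mul, ← integral_add]
    · refine integral_mono ((cω.mul (v * v)).integrable.const_mul _) ?_ fun x => ?_
      · exact ((c2.mul (v * LP (LP v))).integrable.const_mul _).add
          (((integrable_indicator_iff (isClosed_tsupport _).measurableSet).2 hint).const_mul _)
      · simp only [Sm.smul_apply, Sm.mul_apply, Sm.pow_apply]
        by_cases hx : x ∈ tsupport ζ.1
        · rw [indicator_of_mem hx, h.sol x (hΩ hx)]
          have y := weight_young hp hN hL0 hq0 hq2 (hζ0 x) (hζ1 x) (abs_nonneg (v x))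
          rw [sq_abs] at y
          have hz : 0 ≤ ζ x ^ (2 * N) * v x ^ 2 := by
            have := hζ0 x; positivity
          have hz2 : 0 ≤ ζ x ^ (2 * N + 4) * (|v x| ^ (p - 1) * v x ^ 2) := by
            have := hζ0 x; positivity
          have hKL : K * L⁻¹ = 1 / 2 * c0 := by rw [hL]; field_simp
          calc _ = cacc p * C1 * (ζ x ^ (2 * N) * v x ^ 2) := by ring
            _ ≤ K * (ζ x ^ (2 * N) * v x ^ 2) := by gcongr; linarith
            _ ≤ K * (L⁻¹ * (ζ x ^ (2 * N + 4) * (|v x| ^ (p - 1) * v x ^ 2)) +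
                (1 + L ^ (2 / (p - 1))) * |v x| ^ q) := by gcongr
            _ = K * L⁻¹ * (ζ x ^ (2 * N + 4) * (|v x| ^ (p - 1) * v x ^ 2)) + M * |v x| ^ q := by
                rw [hM]; ring
            _ = 1 / 2 * (c0 * (ζ x ^ (2 * N + 4) * (|v x| ^ (p - 1) * v x ^ 2))) + M * |v x| ^ q := by
                rw [hKL]; ring
            _ ≤ 1 / 2 * (c x * (ζ x ^ (2 * N + 4) * (|v x| ^ (p - 1) * v x ^ 2))) + M * |v x| ^ q := by
                have := hc x (hΩ hx)
                gcongr
            _ = _ := by ring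
        · have : ζ x = 0 := image_eq_zero_of_notMem_tsupport hx
          rw [indicator_of_notMem hx, this]
          simp [hN0]
    · exact (c2.mul (v * LP (LP v))).integrable.const_mul _
    · exact ((integrable_indicator_iff (isClosed_tsupport _).measurableSet).2 hint).const_mul _
  linarith

end

noncomputable section
open scoped ENNReal
variable {n : ℕ}

/-- A smooth cutoff of the ball of radius `1/2` inside the unit ball. -/
def bcut (n : ℕ) : Sm n :=
  ⟨(⟨1 / 2, 3 / 4, by norm_num, by norm_num⟩ : ContDiffBump (0 : Eu n)), ContDiffBump.contDiff _⟩

lemma bcut_nonneg (x : Eu n) : 0 ≤ bcut n x := ContDiffBump.nonneg _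

lemma bcut_le_one (x : Eu n) : bcut n x ≤ 1 := ContDiffBump.le_one _

lemma bcut_one {x : Eu n} (hx : x ∈ ball (0 : Eu n) (1 / 2)) : bcut n x = 1 :=
  ContDiffBump.one_of_mem_closedBall _ (ball_subset_closedBall hx)

lemma bcut_cs : Cs (bcut n) := ContDiffBump.hasCompactSupport _

lemma bcut_tsupport : tsupport (bcut n).1 ⊆ ball (0 : Eu n) 1 := by
  have : tsupport (bcut n).1 = closedBall 0 (3 / 4) := ContDiffBump.tsupport_eq _
  rw [this]
  exact closedBall_subset_ball (by norm_num)

/-- Stable solutions in the unit ball whose coefficient lies in `[c0, c1]`. -/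
def Loc (p c0 c1 : ℝ) (v : Sm n) : Prop :=
  ∃ c : Eu n → ℝ, Adm p v c (ball 0 1) ∧ (∀ x ∈ ball (0 : Eu n) 1, c0 ≤ c x) ∧
    ∀ x ∈ ball (0 : Eu n) 1, c x ≤ c1

/-- The integral of `|v|^q` over the unit ball. -/
def Sq (q : ℝ) (v : Sm n) : ℝ≥0∞ := ∫⁻ x in ball (0 : Eu n) 1, ‖v x‖ₑ ^ q

lemma enorm_rpow_eq (x : ℝ) {q : ℝ} (hq : 0 ≤ q) : ENNReal.ofReal (|x| ^ q) = ‖x‖ₑ ^ q := by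
  rw [← ENNReal.ofReal_rpow_of_nonneg (abs_nonneg x) hq, ← Real.norm_eq_abs, ofReal_norm]

theorem source_estimate {p : ℝ} (hp : 1 < p) {c0 : ℝ} (hc0 : 0 < c0) {c1 : ℝ}
    {q : ℝ} (hq0 : 0 ≤ q) (hq2 : q ≤ 2) (hqp : q ≤ p) :
    ∃ C : ℝ≥0∞, C ≠ ⊤ ∧ ∀ v : Sm n, Loc p c0 c1 v →
      ∫⁻ x in ball (0 : Eu n) (1 / 2), ‖LP (LP v) x‖ₑ ≤ C * Sq q v := by
  obtain ⟨N, C, hC, hI⟩ := interior_bound hp (bcut_cs (n := n)) bcut_tsupport bcut_nonneg bcut_le_one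
    hc0 hq0 hq2
  refine ⟨ENNReal.ofReal c1 + ENNReal.ofReal C, by finiteness, fun v ⟨c, h, hl, hu⟩ => ?_⟩
  have h1 := hI v c h hl
  set η := bcut n ^ (2 * N + 4) with hη
  have cη : Cs η := by rw [hη, pow_succ]; exact bcut_cs.mul' _
  have hη0 : ∀ x, 0 ≤ η x := fun x => by
    have := bcut_nonneg x
    simp only [hη, Sm.pow_apply]; positivity
  have hnn : 0 ≤ J η (LP v * LP v) := J_nonneg cη fun x => by
    have := hη0 x
    have := mul_self_nonneg (LP v x)
    simp only [Sm.mul_apply]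
    positivity
  have hsrc : ∀ x, 0 ≤ η x * (v * LP (LP v)) x := fun x => by
    by_cases hx : x ∈ tsupport (bcut n).1
    · exact mul_nonneg (hη0 x) (h.source_nonneg (bcut_tsupport hx))
    · have : bcut n x = 0 := image_eq_zero_of_notMem_tsupport hx
      simp [hη, this]
  have h2 : ∫⁻ x in ball (0 : Eu n) (1 / 2), ENNReal.ofReal ((v * LP (LP v)) x) ≤
      ENNReal.ofReal (J η (v * LP (LP v))) := by
    have hi : Integrable fun x => η x * (v * LP (LP v)) x := (cη.mul (v * LP (LP v))).integrable
    rw [J_apply cη, ofReal_integral_eq_lintegral_ofReal hi (ae_of_all _ hsrc)]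
    calc _ ≤ ∫⁻ x in ball (0 : Eu n) (1 / 2), ENNReal.ofReal (η x * (v * LP (LP v)) x) := by
          refine setLIntegral_mono_ae' measurableSet_ball (ae_of_all _ fun x hx => ?_)
          rw [hη, Sm.pow_apply, bcut_one hx]; simp
      _ ≤ _ := setLIntegral_le_lintegral _ _
  have h3 : ENNReal.ofReal (∫ x in tsupport (bcut n).1, |v x| ^ q) ≤ Sq q v := by
    rw [ofReal_integral_eq_lintegral_ofReal]
    · simp only [enorm_rpow_eq _ hq0]
      exact lintegral_mono_set bcut_tsupport
    · refine ContinuousOn.integrableOn_compact bcut_cs ?_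
      exact ((Sm.cont v).abs.rpow_const fun x => Or.inr hq0).continuousOn
    · exact ae_of_all _ fun x => Real.rpow_nonneg (abs_nonneg _) _
  have hm : Measurable fun x => ENNReal.ofReal c1 * ‖v x‖ₑ ^ q :=
    ((Sm.cont v).measurable.enorm.pow_const q).const_mul _
  calc _ ≤ ∫⁻ x in ball (0 : Eu n) (1 / 2),
        (ENNReal.ofReal c1 * ‖v x‖ₑ ^ q + ENNReal.ofReal ((v * LP (LP v)) x)) := by
        refine setLIntegral_mono_ae' measurableSet_ball (ae_of_all _ fun x hx => ?_)
        have hx1 : x ∈ ball (0 : Eu n) 1 := ball_subset_ball (by norm_num) hx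
        have hc := h.nonneg x hx1
        have hc1 := hu x hx1
        have hc10 := hc.trans hc1
        rw [← enorm_rpow_eq _ hq0, ← ENNReal.ofReal_mul (hc.trans hc1), ← ENNReal.ofReal_add
          (mul_nonneg (hc.trans hc1) (Real.rpow_nonneg (abs_nonneg _) _)) (show 0 ≤ (v * LP (LP v)) x from h.source_nonneg hx1),
          ← ofReal_norm, Real.norm_eq_abs]
        refine ENNReal.ofReal_le_ofReal ?_
        rw [Sm.mul_apply, h.sol x hx1, abs_mul, abs_mul, abs_of_nonneg hc,
          abs_of_nonneg (Real.rpow_nonneg (abs_nonneg (v x)) _)]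
        set s := |v x| with hs
        have hs0 : 0 ≤ s := abs_nonneg _
        have hss : v x * (c x * s ^ (p - 1) * v x) = c x * s ^ (p - 1) * s ^ 2 := by
          rw [hs, sq_abs]; ring
        rw [hss]
        have hsp : 0 ≤ s ^ (p - 1) := Real.rpow_nonneg hs0 _
        have hsq : 0 ≤ s ^ q := Real.rpow_nonneg hs0 _
        rcases le_or_gt s 1 with h1 | h1
        · have : s ^ (p - 1) * s ≤ s ^ q := by
            rcases hs0.eq_or_lt with h0 | h0
            · rw [← h0]; simpa using Real.rpow_nonneg le_rfl q
            · calc s ^ (p - 1) * s = s ^ p := by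
                    rw [Real.rpow_sub_one h0.ne']; field_simp
                _ ≤ _ := Real.rpow_le_rpow_of_exponent_ge h0 h1 hqp
          have : c x * (s ^ (p - 1) * s) ≤ c1 * s ^ q := by gcongr
          have : 0 ≤ c x * s ^ (p - 1) * s ^ 2 := by positivity
          nlinarith
        · have : c x * s ^ (p - 1) * s ≤ c x * s ^ (p - 1) * s ^ 2 := by gcongr; nlinarith
          have : 0 ≤ c1 * s ^ q := mul_nonneg (hc.trans hc1) hsq
          linarith
    _ = ENNReal.ofReal c1 * (∫⁻ x in ball (0 : Eu n) (1 / 2), ‖v x‖ₑ ^ q) +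
          ∫⁻ x in ball (0 : Eu n) (1 / 2), ENNReal.ofReal ((v * LP (LP v)) x) := by
        rw [lintegral_add_left hm, lintegral_const_mul _ ((Sm.cont v).measurable.enorm.pow_const q)]
    _ ≤ ENNReal.ofReal c1 * Sq q v + ENNReal.ofReal C * Sq q v := by
        gcongr
        · exact lintegral_mono_set (ball_subset_ball (by norm_num))
        · refine h2.trans ?_
          calc _ ≤ ENNReal.ofReal (C * ∫ x in tsupport (bcut n).1, |v x| ^ q) :=
                ENNReal.ofReal_le_ofReal (by linarith)
            _ = ENNReal.ofReal C * ENNReal.ofReal (∫ x in tsupport (bcut n).1, |v x| ^ q) :=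
                ENNReal.ofReal_mul hC
            _ ≤ _ := by gcongr
    _ = _ := by ring

end

noncomputable section
open scoped ENNReal
variable {n : ℕ}

/-- The scaling `v ↦ r^{4/(p-1)} v(y + r ·)`, which preserves the equation. -/
def sc (p : ℝ) (y : Eu n) (r : ℝ) (v : Sm n) : Sm n := r ^ (4 / (p - 1)) • aff y r v

lemma sc_apply (p : ℝ) (y : Eu n) (r : ℝ) (v : Sm n) (z : Eu n) :
    sc p y r v z = r ^ (4 / (p - 1)) * v (y + r • z) := rfl

lemma sc_sc (p : ℝ) (y : Eu n) {r t : ℝ} (hr : 0 ≤ r) (ht : 0 ≤ t) (v : Sm n) :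
    sc p 0 t (sc p y r v) = sc p y (r * t) v := by
  ext z
  simp only [sc_apply, Real.mul_rpow hr ht, zero_add, smul_smul]
  ring

lemma Loc.scale {p c0 c1 : ℝ} (hp : 1 < p) {v : Sm n} (h : Loc p c0 c1 v) {y : Eu n} {r : ℝ} (hr : 0 < r)
    (hyr : ∀ z ∈ ball (0 : Eu n) 1, y + r • z ∈ ball (0 : Eu n) 1) : Loc p c0 c1 (sc p y r v) := by
  obtain ⟨c, h, hl, hu⟩ := h
  have hl0 : 0 < r ^ (4 / (p - 1)) := Real.rpow_pos_of_pos hr _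
  have hp' : p - 1 ≠ 0 := by linarith
  have e : (r ^ (4 / (p - 1))) ^ (1 - p) * r ^ 4 = 1 := by
    rw [← Real.rpow_mul hr.le, ← Real.rpow_natCast, ← Real.rpow_add hr]
    have : 4 / (p - 1) * (1 - p) + ((4 : ℕ) : ℝ) = 0 := by push_cast; field_simp; ring
    rw [this, Real.rpow_zero]
  refine ⟨_, h.scale y hr hl0 hyr, fun x hx => ?_, fun x hx => ?_⟩
  · rw [e, one_mul]; exact hl _ (hyr x hx)
  · rw [e, one_mul]; exact hu _ (hyr x hx)

lemma Sq_sc_le {p : ℝ} {q : ℝ} (hq : 0 ≤ q) (v : Sm n) {y : Eu n} {r : ℝ} (hr : 0 < r) {B : Set (Eu n)}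
    (hB : MeasurableSet B) (h : ∀ z ∈ ball (0 : Eu n) 1, y + r • z ∈ B) :
    Sq q (sc p y r v) ≤ ENNReal.ofReal (r ^ (4 / (p - 1))) ^ q *
      (ENNReal.ofReal ((r ^ n)⁻¹) * ∫⁻ x in B, ‖v x‖ₑ ^ q) := by
  have hm : Measurable fun x => ‖v x‖ₑ ^ q := (Sm.cont v).measurable.enorm.pow_const q
  rw [Sq]
  simp only [sc_apply, enorm_mul, ENNReal.mul_rpow_of_nonneg _ _ hq]
  have hm' : Measurable fun z => ‖v (y + r • z)‖ₑ ^ q :=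
    hm.comp (by fun_prop : Measurable fun z : Eu n => y + r • z)
  rw [lintegral_const_mul _ hm']
  have e : ‖r ^ (4 / (p - 1))‖ₑ = ENNReal.ofReal (r ^ (4 / (p - 1))) := by
    rw [← ofReal_norm, Real.norm_of_nonneg (Real.rpow_nonneg hr.le _)]
  rw [e]
  gcongr
  exact setLIntegral_comp_aff_le y hr hm measurableSet_ball hB h

lemma smul_mem_unit_ball {r : ℝ} (hr : 0 < r) (hr1 : r ≤ 1) {z : Eu n} (hz : z ∈ ball (0 : Eu n) 1) :
    (0 : Eu n) + r • z ∈ ball (0 : Eu n) r ∧ (0 : Eu n) + r • z ∈ ball (0 : Eu n) 1 := by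
  have : ‖z‖ < 1 := by simpa using hz
  have h : ‖(0 : Eu n) + r • z‖ < r := by
    rw [zero_add, norm_smul, Real.norm_of_nonneg hr.le]; nlinarith
  exact ⟨by simpa using h, by simpa using h.trans_le hr1⟩

theorem decay_step (hn : 5 ≤ n) {p : ℝ} (hp : 1 < p) {c0 : ℝ} (hc0 : 0 < c0) (c1 : ℝ) {σ : ℝ} (hσ : 0 < σ)
    (hnσ : n * σ ≤ 1) (hσp : 1 + σ ≤ p) :
    ∃ (ρ : ℝ) (ε0 : ℝ≥0∞), 0 < ρ ∧ ρ ≤ 1 / 4 ∧ 0 < ε0 ∧ ∀ v : Sm n, Loc p c0 c1 v → ∀ ε ≤ ε0,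
      Sq (1 + σ) v ≤ ε → Sq (1 + σ) (sc p 0 ρ v) ≤ ε := by
  set q := 1 + σ with hq
  have hq0 : 0 < q := by linarith
  have hn' : (5 : ℝ) ≤ n := by exact_mod_cast hn
  have hq2 : q ≤ 2 := by nlinarith
  obtain ⟨C, hC, hA⟩ := lq_estimate hn hσ hnσ
  obtain ⟨D, hD, hS⟩ := source_estimate (n := n) hp hc0 (c1 := c1) hq0.le hq2 hσp
  have hb : 0 < 4 / (p - 1) := div_pos (by norm_num) (by linarith)
  obtain ⟨ρ, hρ, hρ4, hρC⟩ : ∃ ρ : ℝ, 0 < ρ ∧ ρ ≤ 1 / 4 ∧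
      ENNReal.ofReal (ρ ^ (4 / (p - 1))) ^ q * C ≤ 1 / 2 := by
    have h1 : Tendsto (fun ρ : ℝ => ENNReal.ofReal (ρ ^ (4 / (p - 1))) ^ q * C) (𝓝[>] 0) (𝓝 0) := by
      have h0 : Tendsto (fun ρ : ℝ => ρ ^ (4 / (p - 1))) (𝓝[>] 0) (𝓝 0) := by
        have := (Real.continuousAt_rpow_const 0 (4 / (p - 1)) (Or.inr hb.le)).tendsto
        rw [Real.zero_rpow hb.ne'] at this
        exact this.mono_left nhdsWithin_le_nhds
      have h2 := (ENNReal.tendsto_ofReal h0).ennrpow_const q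
      rw [ENNReal.ofReal_zero, ENNReal.zero_rpow_of_pos hq0] at h2
      simpa using ENNReal.Tendsto.mul_const h2 (Or.inr hC)
    have h3 := h1.eventually_le_const (show (0 : ℝ≥0∞) < 1 / 2 by simp)
    have h4 : ∀ᶠ ρ : ℝ in 𝓝[>] 0, ρ ∈ Ioc 0 (1 / 4 : ℝ) := Ioc_mem_nhdsGT (by norm_num)
    obtain ⟨ρ, h5, h6⟩ := (h3.and h4).exists
    exact ⟨ρ, h6.1, h6.2, h5⟩
  set K := ENNReal.ofReal (ρ ^ (4 / (p - 1))) ^ q * (ENNReal.ofReal ((ρ ^ n)⁻¹) * (C * D ^ q)) with hK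
  have hKt : K ≠ ⊤ := by
    have h1 : ENNReal.ofReal (ρ ^ (4 / (p - 1))) ^ q ≠ ⊤ :=
      ENNReal.rpow_ne_top_of_nonneg hq0.le ENNReal.ofReal_ne_top
    have h2 : D ^ q ≠ ⊤ := ENNReal.rpow_ne_top_of_nonneg hq0.le hD
    exact ENNReal.mul_ne_top h1 (ENNReal.mul_ne_top ENNReal.ofReal_ne_top (ENNReal.mul_ne_top hC h2))
  refine ⟨ρ, ((2 * K + 1)⁻¹) ^ (1 / σ), hρ, hρ4, ?_, fun v hv ε hε hvε => ?_⟩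
  · refine ENNReal.rpow_pos (ENNReal.inv_pos.2 (by finiteness)) ?_
    exact ENNReal.inv_ne_top.2 (by simp)
  · have hKε : K * ε ^ σ ≤ 1 / 2 := by
      calc _ ≤ K * (((2 * K + 1)⁻¹) ^ (1 / σ)) ^ σ := by gcongr
        _ = K * (2 * K + 1)⁻¹ := by
            rw [← ENNReal.rpow_mul, one_div, inv_mul_cancel₀ hσ.ne', ENNReal.rpow_one]
        _ ≤ 1 / 2 := by
            rw [← div_eq_mul_inv]
            refine ENNReal.div_le_of_le_mul ?_
            rw [mul_add, ← mul_assoc, ENNReal.div_mul_cancel (by simp) (by simp), one_mul]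
            exact le_self_add
    have h1 := hA v ρ hρ hρ4
    have h2 := hS v hv
    have hI : ∫⁻ x in ball (0 : Eu n) (1 / 2), ‖v x‖ₑ ^ q ≤ Sq q v :=
      lintegral_mono_set (ball_subset_ball (by norm_num))
    have hρρ : ENNReal.ofReal ((ρ ^ n)⁻¹) * ENNReal.ofReal (ρ ^ n) = 1 := by
      rw [← ENNReal.ofReal_mul (by positivity), inv_mul_cancel₀ (by positivity), ENNReal.ofReal_one]
    calc _ ≤ ENNReal.ofReal (ρ ^ (4 / (p - 1))) ^ q *
          (ENNReal.ofReal ((ρ ^ n)⁻¹) * ∫⁻ x in ball (0 : Eu n) ρ, ‖v x‖ₑ ^ q) :=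
          Sq_sc_le hq0.le v hρ measurableSet_ball fun z hz =>
            (smul_mem_unit_ball hρ (by linarith) hz).1
      _ ≤ ENNReal.ofReal (ρ ^ (4 / (p - 1))) ^ q * (ENNReal.ofReal ((ρ ^ n)⁻¹) *
            (C * (ENNReal.ofReal (ρ ^ n) * ε + (D * ε) ^ q))) := by
          refine mul_le_mul_right (mul_le_mul_right (h1.trans ?_) _) _
          gcongr
          · exact hI.trans hvε
          · exact h2.trans (by gcongr)
      _ = ENNReal.ofReal (ρ ^ (4 / (p - 1))) ^ q * C *
            (ENNReal.ofReal ((ρ ^ n)⁻¹) * ENNReal.ofReal (ρ ^ n)) * ε + K * ε ^ σ * ε := by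
          have : ε ^ q = ε ^ σ * ε := by
            rw [hq, add_comm, ENNReal.rpow_add_of_nonneg _ _ hσ.le zero_le_one, ENNReal.rpow_one]
          rw [ENNReal.mul_rpow_of_nonneg _ _ hq0.le, this, hK]; ring
      _ ≤ 1 / 2 * ε + 1 / 2 * ε := by
          rw [hρρ, mul_one]; gcongr
      _ = ε := by
          rw [← add_mul, ENNReal.add_halves, one_mul]

theorem decay_all (hn : 5 ≤ n) {p : ℝ} (hp : 1 < p) {c0 : ℝ} (hc0 : 0 < c0) (c1 : ℝ) {σ : ℝ} (hσ : 0 < σ)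
    (hnσ : n * σ ≤ 1) (hσp : 1 + σ ≤ p) :
    ∃ Λ ε0 : ℝ≥0∞, Λ ≠ ⊤ ∧ 0 < ε0 ∧ ∀ v : Sm n, Loc p c0 c1 v → ∀ ε ≤ ε0, Sq (1 + σ) v ≤ ε →
      ∀ r : ℝ, 0 < r → r ≤ 1 → Sq (1 + σ) (sc p 0 r v) ≤ Λ * ε := by
  obtain ⟨ρ, ε0, hρ, hρ4, hε0, H⟩ := decay_step hn hp hc0 c1 hσ hnσ hσp
  refine ⟨ENNReal.ofReal ((ρ ^ n)⁻¹), ε0, ENNReal.ofReal_ne_top, hε0, fun v hv ε hε hvε => ?_⟩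
  have hq0 : 0 ≤ 1 + σ := by linarith
  have hb : 0 < 4 / (p - 1) := div_pos (by norm_num) (by linarith)
  have hit : ∀ k : ℕ, Loc p c0 c1 (sc p 0 (ρ ^ k) v) ∧ Sq (1 + σ) (sc p 0 (ρ ^ k) v) ≤ ε := by
    intro k
    induction k with
    | zero =>
      have : sc p 0 (ρ ^ 0) v = v := by ext z; simp [sc_apply]
      rw [this]; exact ⟨hv, hvε⟩
    | succ k ih =>
      rw [pow_succ, ← sc_sc p 0 (by positivity) hρ.le]
      exact ⟨ih.1.scale hp hρ fun z hz => (smul_mem_unit_ball hρ (by linarith) hz).2,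
        H _ ih.1 ε hε ih.2⟩
  intro r hr hr1
  obtain ⟨k, hk1, hk2⟩ := exists_nat_pow_near_of_lt_one hr hr1 hρ (by linarith : ρ < 1)
  have hk0 : 0 < ρ ^ k := by positivity
  set t := r / ρ ^ k with ht
  have ht0 : 0 < t := by positivity
  have ht1 : t ≤ 1 := by rw [ht, div_le_one hk0]; exact hk2
  have htρ : ρ ≤ t := by rw [ht, le_div_iff₀ hk0, mul_comm, ← pow_succ]; exact hk1.le
  have hr' : r = ρ ^ k * t := by rw [ht]; field_simp
  rw [hr', ← sc_sc p 0 hk0.le ht0.le]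
  refine (Sq_sc_le hq0 _ ht0 measurableSet_ball fun z hz => (smul_mem_unit_ball ht0 ht1 hz).2).trans ?_
  have h1 : ENNReal.ofReal (t ^ (4 / (p - 1))) ^ (1 + σ) ≤ 1 := by
    refine ENNReal.rpow_le_one ?_ hq0
    rw [ENNReal.ofReal_le_one]
    exact Real.rpow_le_one ht0.le ht1 hb.le
  calc _ ≤ 1 * (ENNReal.ofReal ((ρ ^ n)⁻¹) * ε) := by
        gcongr
        exact (hit k).2
    _ = _ := one_mul _

end

noncomputable section
open scoped ENNReal
variable {n : ℕ}

lemma tsum_ofReal_le {κ : ℝ} (hκ : 0 ≤ κ) {A : ℝ≥0∞} {a : ℕ → ℝ≥0∞} (ha : ∀ k, a k ≤ A) :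
    ∑' k : ℕ, ENNReal.ofReal ((κ * Real.exp (-1) ^ k) ^ 4) * a k ≤ ENNReal.ofReal (2 * κ ^ 4) * A := by
  have hs0 : ∀ k : ℕ, 0 ≤ Real.exp (-1) ^ k := fun k => by positivity
  have hs1 : ∀ k : ℕ, Real.exp (-1) ^ k ≤ 1 := fun k =>
    pow_le_one₀ (by positivity) (by rw [Real.exp_le_one_iff]; norm_num)
  calc _ ≤ ∑' k : ℕ, ENNReal.ofReal (κ ^ 4 * Real.exp (-1) ^ k) * A := by
        refine ENNReal.tsum_le_tsum fun k => ?_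
        gcongr ENNReal.ofReal ?_ * ?_
        · rw [mul_pow]
          gcongr
          have := hs0 k
          have := hs1 k
          exact pow_le_of_le_one (hs0 k) (hs1 k) (by norm_num)
        · exact ha k
    _ = (∑' k : ℕ, ENNReal.ofReal (κ ^ 4 * Real.exp (-1) ^ k)) * A := ENNReal.tsum_mul_right
    _ ≤ _ := by
        gcongr
        refine ENNReal.tsum_le_of_sum_range_le fun N => ?_
        rw [← ENNReal.ofReal_sum_of_nonneg (fun k _ => by have := hs0 k; positivity), ← Finset.mul_sum]
        refine ENNReal.ofReal_le_ofReal ?_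
        have : ∑ k ∈ Finset.range N, Real.exp (-1) ^ k ≤ 2 := sum_exp_le N
        nlinarith [pow_nonneg hκ 4]

/-- A small bounded solution is small at the origin. -/
theorem origin_small (hn : 5 ≤ n) {p : ℝ} (hp : 1 < p) (c0 c1 : ℝ) {q : ℝ} (hq : 1 < q) {δ : ℝ} (hδ : 0 < δ) :
    ∃ ε : ℝ≥0∞, 0 < ε ∧ ∀ v : Sm n, Loc p c0 c1 v → Sq q v ≤ ε →
      (∀ z ∈ ball (0 : Eu n) 1, |v z| ≤ 1) → |v 0| < δ := by
  obtain ⟨C, hC, hrep⟩ := rep_enorm hn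
  have hq0 : 0 < q := by linarith
  set V := volume (closedBall (0 : Eu n) R0) with hV
  have hVt : V ≠ ⊤ := measure_closedBall_lt_top.ne
  set A := ENNReal.ofReal c1 * V with hA
  have hAt : A ≠ ⊤ := ENNReal.mul_ne_top ENNReal.ofReal_ne_top hVt
  obtain ⟨κ, hκ, hκR, hκδ⟩ : ∃ κ : ℝ, 0 < κ ∧ κ * R0 < 1 ∧
      ENNReal.ofReal C * (ENNReal.ofReal (2 * κ ^ 4) * A) ≤ ENNReal.ofReal (δ / 4) := by
    have h0 : Tendsto (fun κ : ℝ => 2 * κ ^ 4) (𝓝[>] 0) (𝓝 0) := by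
      have : Continuous fun κ : ℝ => 2 * κ ^ 4 := by fun_prop
      simpa using (this.tendsto 0).mono_left nhdsWithin_le_nhds
    have h1 := ENNReal.Tendsto.const_mul (a := ENNReal.ofReal C)
      (ENNReal.Tendsto.mul_const (ENNReal.tendsto_ofReal h0) (Or.inr hAt)) (Or.inr ENNReal.ofReal_ne_top)
    simp only [ENNReal.ofReal_zero, zero_mul, mul_zero] at h1
    have h3 := h1.eventually_le_const (show (0 : ℝ≥0∞) < ENNReal.ofReal (δ / 4) by
      rw [ENNReal.ofReal_pos]; positivity)
    have h4 : ∀ᶠ κ : ℝ in 𝓝[>] 0, κ ∈ Ioo 0 (1 / R0) := Ioo_mem_nhdsGT (by have := R0_pos; positivity)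
    obtain ⟨κ, h5, h6⟩ := (h3.and h4).exists
    exact ⟨κ, h6.1, by have := h6.2; rwa [lt_div_iff₀ R0_pos] at this, h5⟩
  have hin : ∀ {s : ℝ}, 0 < s → s ≤ κ → ∀ z ∈ closedBall (0 : Eu n) R0, (0 : Eu n) + s • z ∈ ball (0 : Eu n) 1 := by
    intro s hs hsκ z hz
    have : ‖z‖ ≤ R0 := by simpa using hz
    rw [zero_add, mem_ball_zero_iff, norm_smul, Real.norm_of_nonneg hs.le]
    have : s * ‖z‖ ≤ κ * R0 := by have := norm_nonneg z; gcongr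
    linarith
  set B := V ^ (q - 1) * ENNReal.ofReal ((κ ^ n)⁻¹) with hB
  have hBt : B ≠ ⊤ := ENNReal.mul_ne_top (ENNReal.rpow_ne_top_of_nonneg (by linarith) hVt)
    ENNReal.ofReal_ne_top
  obtain ⟨ε, hε, hεδ⟩ : ∃ ε : ℝ≥0∞, 0 < ε ∧
      ENNReal.ofReal C * (B * ε) ^ (1 / q) ≤ ENNReal.ofReal (δ / 4) := by
    have h1 : Tendsto (fun ε : ℝ≥0∞ => ENNReal.ofReal C * (B * ε) ^ (1 / q)) (𝓝[>] 0) (𝓝 0) := by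
      have h2 : Tendsto (fun ε : ℝ≥0∞ => B * ε) (𝓝[>] 0) (𝓝 0) := by
        have := ENNReal.Tendsto.const_mul (a := B)
          (tendsto_id.mono_left nhdsWithin_le_nhds : Tendsto id (𝓝[>] (0 : ℝ≥0∞)) (𝓝 0)) (Or.inr hBt)
        simpa using this
      have h3 := h2.ennrpow_const (1 / q)
      rw [ENNReal.zero_rpow_of_pos (by positivity)] at h3
      simpa using ENNReal.Tendsto.const_mul (a := ENNReal.ofReal C) h3 (Or.inr ENNReal.ofReal_ne_top)
    have h3 := h1.eventually_le_const (show (0 : ℝ≥0∞) < ENNReal.ofReal (δ / 4) by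
      rw [ENNReal.ofReal_pos]; positivity)
    obtain ⟨ε, h5, h6⟩ := (h3.and self_mem_nhdsWithin).exists
    exact ⟨ε, h6, h5⟩
  refine ⟨ε, hε, fun v ⟨c, h, hl, hu⟩ hS hv => ?_⟩
  have h1 := hrep v 0 κ hκ
  have hF : ∀ k : ℕ, avg (LP (LP v)) 0 (κ * Real.exp (-1) ^ k) ≤ A := by
    intro k
    rw [avg]
    calc _ ≤ ∫⁻ _ in closedBall (0 : Eu n) R0, ENNReal.ofReal c1 := by
          refine setLIntegral_mono_ae' measurableSet_closedBall (ae_of_all _ fun z hz => ?_)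
          have hs0 : 0 < Real.exp (-1) ^ k := by positivity
          have hs1 : Real.exp (-1) ^ k ≤ 1 :=
            pow_le_one₀ (by positivity) (by rw [Real.exp_le_one_iff]; norm_num)
          have hx := hin (s := κ * Real.exp (-1) ^ k) (by positivity) (by nlinarith) z hz
          set x := (0 : Eu n) + (κ * Real.exp (-1) ^ k) • z
          rw [← ofReal_norm, h.sol x hx, norm_mul, norm_mul, Real.norm_of_nonneg (h.nonneg x hx),
            Real.norm_of_nonneg (Real.rpow_nonneg (abs_nonneg (v x)) _), Real.norm_eq_abs]
          refine ENNReal.ofReal_le_ofReal ?_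
          have hvx := hv x hx
          have : |v x| ^ (p - 1) ≤ 1 := Real.rpow_le_one (abs_nonneg _) hvx (by linarith)
          have h0 := h.nonneg x hx
          have h1 := hu x hx
          have h10 := h0.trans h1
          have h2 : 0 ≤ |v x| ^ (p - 1) := Real.rpow_nonneg (abs_nonneg _) _
          calc _ ≤ c1 * 1 * 1 := by gcongr
            _ = c1 := by ring
      _ = A := by rw [setLIntegral_const]
  have hV1 : avg v 0 κ ≤ (B * ε) ^ (1 / q) := by
    rw [one_div, ENNReal.le_rpow_inv_iff hq0, avg]
    refine (lintegral_rpow_le (Sm.cont (aff 0 κ v)).measurable.enorm hq).trans ?_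
    rw [hB, mul_assoc]
    refine mul_le_mul_right ((setLIntegral_comp_aff_le 0 hκ ((Sm.cont v).measurable.enorm.pow_const q)
      measurableSet_closedBall measurableSet_ball fun z hz => hin hκ le_rfl z hz).trans ?_) _
    gcongr
    exact hS
  have h2 : ‖v 0‖ₑ ≤ ENNReal.ofReal (δ / 2) := by
    calc _ ≤ ENNReal.ofReal C * ((B * ε) ^ (1 / q) + ENNReal.ofReal (2 * κ ^ 4) * A) := by
          refine h1.trans (mul_le_mul_right (add_le_add hV1 (tsum_ofReal_le hκ.le hF)) _)
      _ ≤ ENNReal.ofReal (δ / 4) + ENNReal.ofReal (δ / 4) := by rw [mul_add]; gcongr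
      _ = _ := by rw [← ENNReal.ofReal_add (by positivity) (by positivity)]; congr 1; ring
  rw [← ofReal_norm, ENNReal.ofReal_le_ofReal_iff (by positivity), Real.norm_eq_abs] at h2
  linarith

theorem eps_regularity (hn : 5 ≤ n) {p : ℝ} (hp : 1 < p) {c0 : ℝ} (hc0 : 0 < c0) (c1 : ℝ) {σ : ℝ} (hσ : 0 < σ)
    (hnσ : n * σ ≤ 1) (hσp : 1 + σ ≤ p) :
    ∃ ε : ℝ≥0∞, 0 < ε ∧ ∀ v : Sm n, Loc p c0 c1 v → Sq (1 + σ) v ≤ ε →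
      ∀ y ∈ ball (0 : Eu n) (1 / 4), |v y| ≤ 4 ^ (4 / (p - 1)) := by
  set b := 4 / (p - 1) with hb
  have hb0 : 0 < b := div_pos (by norm_num) (by linarith)
  have hq0 : 0 ≤ 1 + σ := by linarith
  obtain ⟨Λ, ε0, hΛ, hε0, hdec⟩ := decay_all hn hp hc0 c1 hσ hnσ hσp
  obtain ⟨ε1, hε1, hor⟩ := origin_small hn hp c0 c1 (q := 1 + σ) (by linarith) (δ := 2⁻¹ ^ b) (by positivity)
  set G := ENNReal.ofReal ((2⁻¹ : ℝ) ^ b) ^ (1 + σ) * ENNReal.ofReal (((1 / 2 : ℝ) ^ n)⁻¹) with hG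
  have hGt : G ≠ ⊤ := ENNReal.mul_ne_top (ENNReal.rpow_ne_top_of_nonneg hq0 ENNReal.ofReal_ne_top)
    ENNReal.ofReal_ne_top
  obtain ⟨ε, hε, hεa, hεb⟩ : ∃ ε : ℝ≥0∞, 0 < ε ∧ G * ε ≤ ε0 ∧ Λ * (G * ε) ≤ ε1 := by
    have h1 : Tendsto (fun ε : ℝ≥0∞ => G * ε) (𝓝[>] 0) (𝓝 0) := by
      have := ENNReal.Tendsto.const_mul (a := G)
        (tendsto_id.mono_left nhdsWithin_le_nhds : Tendsto id (𝓝[>] (0 : ℝ≥0∞)) (𝓝 0)) (Or.inr hGt)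
      simpa using this
    have h2 : Tendsto (fun ε : ℝ≥0∞ => Λ * (G * ε)) (𝓝[>] 0) (𝓝 0) := by
      simpa using ENNReal.Tendsto.const_mul (a := Λ) h1 (Or.inr hΛ)
    obtain ⟨ε, h5, h6, h7⟩ := ((h1.eventually_le_const hε0).and
      ((h2.eventually_le_const hε1).and self_mem_nhdsWithin)).exists
    exact ⟨ε, h7, h5, h6⟩
  refine ⟨ε, hε, fun v hv hS => ?_⟩
  have hrec : ∀ y : Eu n, ‖y‖ ≤ 1 / 2 → ∀ s : ℝ, 0 < s → s ≤ 1 / 2 →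
      Loc p c0 c1 (sc p y s v) ∧ Sq (1 + σ) (sc p y s v) ≤ ε1 := by
    intro y hy s hs hs2
    have hin : ∀ z ∈ ball (0 : Eu n) 1, y + (1 / 2 : ℝ) • z ∈ ball (0 : Eu n) 1 := by
      intro z hz
      have hz' : ‖z‖ < 1 := by simpa using hz
      rw [mem_ball_zero_iff]
      calc _ ≤ ‖y‖ + ‖(1 / 2 : ℝ) • z‖ := norm_add_le _ _
        _ < 1 := by rw [norm_smul]; norm_num; linarith
    have h1 := hv.scale hp (by norm_num : (0 : ℝ) < 1 / 2) hin
    have h2 : Sq (1 + σ) (sc p y (1 / 2) v) ≤ G * ε := by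
      refine (Sq_sc_le hq0 v (by norm_num) measurableSet_ball hin).trans ?_
      rw [hG, mul_assoc, ← hb, show (1 / 2 : ℝ) ^ b = 2⁻¹ ^ b by norm_num]
      gcongr
      exact hS
    have h3 := hdec _ h1 _ hεa h2 (2 * s) (by positivity) (by linarith)
    have e : sc p 0 (2 * s) (sc p y (1 / 2) v) = sc p y s v := by
      rw [sc_sc p y (by norm_num) (by positivity)]; congr 1; ring
    rw [e] at h3
    refine ⟨?_, h3.trans hεb⟩
    rw [← e]
    exact h1.scale hp (by positivity) fun z hz => (smul_mem_unit_ball (by positivity) (by linarith) hz).2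
  obtain ⟨y0, hy0, hmax⟩ := (isCompact_closedBall (0 : Eu n) (1 / 2)).exists_isMaxOn ⟨0, by simp⟩
    (f := fun y => (1 / 2 - ‖y‖) ^ b * |v y|) (by
      refine Continuous.continuousOn ?_
      exact ((continuous_const.sub continuous_norm).rpow_const fun _ => Or.inr hb0.le).mul (Sm.cont v).abs)
  have hy0' : ‖y0‖ ≤ 1 / 2 := by simpa using hy0
  have hm1 : (1 / 2 - ‖y0‖) ^ b * |v y0| ≤ 1 := by
    by_contra! hm
    set d := 1 / 2 - ‖y0‖ with hd
    have hd0 : 0 ≤ d := by linarith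
    set M := |v y0| with hM
    have hM0 : 0 < M := by
      rcases (abs_nonneg (v y0)).eq_or_lt with h | h
      · rw [hM, ← h, mul_zero] at hm; linarith
      · exact h
    set l := M ^ (-(1 / b)) with hl
    have hl0 : 0 < l := Real.rpow_pos_of_pos hM0 _
    have hlb : l ^ b = M⁻¹ := by
      rw [hl, ← Real.rpow_mul hM0.le, neg_mul, one_div, inv_mul_cancel₀ hb0.ne', Real.rpow_neg_one]
    have hld : l < d := by
      rw [← Real.rpow_lt_rpow_iff hl0.le hd0 hb0, hlb, inv_lt_iff_one_lt_mul₀' hM0, mul_comm]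
      exact hm
    have hd2 : d ≤ 1 / 2 := by have := norm_nonneg y0; linarith
    obtain ⟨hL, hSV⟩ := hrec y0 hy0' (l / 2) (by positivity) (by linarith)
    have e1 : (l / 2) ^ b = M⁻¹ * 2⁻¹ ^ b := by
      rw [div_eq_mul_inv, Real.mul_rpow hl0.le (by norm_num), hlb]
    have h22 : (2⁻¹ : ℝ) ^ b * 2 ^ b = 1 := by
      rw [← Real.mul_rpow (by norm_num) (by norm_num)]; norm_num
    have h3 := hor _ hL hSV (fun z hz => by
      rw [sc_apply, abs_mul, abs_of_nonneg (by positivity), ← hb, e1]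
      have hz' : ‖z‖ < 1 := by simpa using hz
      set x := y0 + (l / 2) • z with hx
      have hxn : ‖x‖ ≤ ‖y0‖ + d / 2 := by
        refine (norm_add_le _ _).trans ?_
        rw [norm_smul, Real.norm_of_nonneg (by positivity)]
        nlinarith [norm_nonneg z]
      have hxm := hmax (a := x) (by rw [mem_closedBall_zero_iff]; linarith)
      simp only [mem_ofPred_eq] at hxm
      have hdx : d / 2 ≤ 1 / 2 - ‖x‖ := by linarith
      have hdpos : 0 < d := hl0.trans hld
      have h4 : (d / 2) ^ b * |v x| ≤ d ^ b * M := le_trans (by gcongr) hxm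
      have h5 : (d / 2) ^ b = d ^ b * 2⁻¹ ^ b := by
        rw [div_eq_mul_inv, Real.mul_rpow hd0 (by norm_num)]
      have hdb : 0 < d ^ b := Real.rpow_pos_of_pos hdpos _
      rw [h5, mul_assoc] at h4
      have h6 := le_of_mul_le_mul_left h4 hdb
      calc _ = M⁻¹ * (2⁻¹ ^ b * |v x|) := by ring
        _ ≤ M⁻¹ * M := by gcongr
        _ = 1 := inv_mul_cancel₀ hM0.ne')
    rw [sc_apply, smul_zero, add_zero, abs_mul, abs_of_nonneg (by positivity), ← hb, e1, ← hM] at h3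
    have : M⁻¹ * 2⁻¹ ^ b * M = 2⁻¹ ^ b := by field_simp
    rw [this] at h3
    exact lt_irrefl _ h3
  intro y hy
  have hy' : ‖y‖ < 1 / 4 := by simpa using hy
  have h1 := hmax (a := y) (by rw [mem_closedBall_zero_iff]; linarith)
  simp only [mem_ofPred_eq] at h1
  have h2 : (1 / 4 : ℝ) ^ b * |v y| ≤ 1 := by
    refine le_trans ?_ (h1.trans hm1)
    gcongr
    linarith
  have h4 : (4 : ℝ) ^ b * (1 / 4) ^ b = 1 := by
    rw [← Real.mul_rpow (by norm_num) (by norm_num)]; norm_num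
  calc |v y| = 4 ^ b * ((1 / 4) ^ b * |v y|) := by rw [← mul_assoc, h4, one_mul]
    _ ≤ 4 ^ b * 1 := by gcongr
    _ = _ := mul_one _

end

noncomputable section
open scoped ENNReal
variable {n : ℕ}

/-- Small `L²` norm of a stable solution gives interior bounds up to order three. -/
theorem eps_regularity_sq (hn : 5 ≤ n) {p : ℝ} (hp : 1 < p) {c0 : ℝ} (hc0 : 0 < c0) (c1 : ℝ) :
    ∃ ε C : ℝ, 0 < ε ∧ 0 ≤ C ∧ ∀ v : Sm n, Loc p c0 c1 v → (∫ x in ball (0 : Eu n) 1, v x ^ 2) ≤ ε →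
      ∀ k ≤ 3, ‖iteratedFDeriv ℝ k v.1 0‖ ≤ C := by
  have hn' : (5 : ℝ) ≤ n := by exact_mod_cast hn
  set σ : ℝ := min (1 / n) (p - 1) with hσd
  have hσ : 0 < σ := lt_min (by positivity) (by linarith)
  have hnσ : n * σ ≤ 1 := by
    calc n * σ ≤ n * (1 / n) := by gcongr; exact min_le_left _ _
      _ = 1 := by field_simp
  have hσp : 1 + σ ≤ p := by linarith [min_le_right (1 / (n : ℝ)) (p - 1)]
  have hσ1 : σ < 1 := by nlinarith
  obtain ⟨ε, hε, H⟩ := eps_regularity hn hp hc0 c1 hσ hnσ hσp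
  set M : ℝ := 4 ^ (4 / (p - 1)) with hM
  have hM0 : 0 ≤ M := by positivity
  have hder : ∀ k : ℕ, ∃ D : ℝ, k ≤ 3 → ∀ (v : Sm n) (x : Eu n) (r A B : ℝ), 0 < r → 0 ≤ A → 0 ≤ B →
      (∀ z ∈ closedBall x (r * R0), |v z| ≤ B) → (∀ z ∈ closedBall x (r * R0), |LP (LP v) z| ≤ A) →
      ‖iteratedFDeriv ℝ k v.1 x‖ ≤ D * (r ^ k)⁻¹ * (B + r ^ 4 * A) := fun k => by
    by_cases hk : k ≤ 3
    · obtain ⟨D, _, h⟩ := deriv_bound (n := n) hn hk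
      exact ⟨D, fun _ => h⟩
    · exact ⟨0, fun h => absurd h hk⟩
  choose D hDb using hder
  set q := 1 + σ with hq
  set r := 2 / q with hr
  have hr1 : 1 < r := by rw [hr, one_lt_div (by linarith)]; linarith
  set V := volume (ball (0 : Eu n) 1) with hV
  have hVt : V ≠ ⊤ := measure_ball_lt_top.ne
  have hB : V ^ (r - 1) ≠ ⊤ := ENNReal.rpow_ne_top_of_nonneg (by linarith) hVt
  obtain ⟨ε1, hε1, hεa⟩ : ∃ ε1 : ℝ, 0 < ε1 ∧ V ^ (r - 1) * ENNReal.ofReal ε1 ≤ ε ^ r := by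
    have h1 : Tendsto (fun x : ℝ => V ^ (r - 1) * ENNReal.ofReal x) (𝓝[>] 0) (𝓝 0) := by
      have h2 : Tendsto (fun x : ℝ => ENNReal.ofReal x) (𝓝[>] 0) (𝓝 0) := by
        have := (ENNReal.continuous_ofReal.tendsto 0).mono_left (nhdsWithin_le_nhds (s := Ioi 0))
        simpa using this
      simpa using ENNReal.Tendsto.const_mul h2 (Or.inr hB)
    have h3 : (0 : ℝ≥0∞) < ε ^ r := by
      rcases eq_or_ne ε ⊤ with rfl | ht
      · rw [ENNReal.top_rpow_of_pos (by linarith)]; simp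
      · exact ENNReal.rpow_pos hε ht
    obtain ⟨x, hx, hx'⟩ := ((h1.eventually_le_const h3).and self_mem_nhdsWithin).exists
    exact ⟨x, hx', hx⟩
  set ρ := 1 / (8 * R0) with hρ
  have hR := R0_pos
  have hρ0 : 0 < ρ := by positivity
  refine ⟨ε1, ∑ k ∈ Finset.range 4, |D k * (ρ ^ k)⁻¹ * (M + ρ ^ 4 * (c1 * M ^ p))|, hε1,
    Finset.sum_nonneg fun _ _ => abs_nonneg _, fun v hv hS k hk => ?_⟩
  have hSq : Sq q v ≤ ε := by
    rw [← ENNReal.rpow_le_rpow_iff (z := r) (by linarith), Sq]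
    refine (lintegral_rpow_le ((Sm.cont v).measurable.enorm.pow_const q) hr1).trans ?_
    refine le_trans (mul_le_mul_right ?_ _) hεa
    calc _ = ∫⁻ x in ball (0 : Eu n) 1, ENNReal.ofReal (v x ^ 2) := by
          refine lintegral_congr fun x => ?_
          rw [← ENNReal.rpow_mul, hr, mul_div_cancel₀ _ (by linarith : q ≠ 0), ← enorm_rpow_eq _ (by norm_num),
            Real.rpow_two, sq_abs]
      _ = ENNReal.ofReal (∫ x in ball (0 : Eu n) 1, v x ^ 2) := by
          rw [ofReal_integral_eq_lintegral_ofReal _ (ae_of_all _ fun x => sq_nonneg _)]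
          exact (((Sm.cont v).pow 2).continuousOn.integrableOn_compact
            (isCompact_closedBall (0 : Eu n) 1)).mono_set ball_subset_closedBall
      _ ≤ _ := ENNReal.ofReal_le_ofReal hS
  have hb := H v hv hSq
  obtain ⟨c, h, hl, hu⟩ := hv
  have hsub : ∀ z ∈ closedBall (0 : Eu n) (ρ * R0), z ∈ ball (0 : Eu n) (1 / 4) := fun z hz => by
    have h1 : ‖z‖ ≤ ρ * R0 := by simpa using hz
    have h2 : ρ * R0 = 1 / 8 := by rw [hρ]; field_simp
    rw [mem_ball_zero_iff]; linarith
  have h00 : (0 : Eu n) ∈ ball (0 : Eu n) 1 := by simp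
  have hc1 : 0 ≤ c1 := (h.nonneg 0 h00).trans (hu 0 h00)
  have hMp : 0 ≤ M ^ p := Real.rpow_nonneg hM0 _
  have key := hDb k hk v 0 ρ (c1 * M ^ p) M hρ0 (by positivity) hM0 (fun z hz => hb z (hsub z hz)) (fun z hz => by
    have hz4 := hsub z hz
    have hz1 : z ∈ ball (0 : Eu n) 1 := ball_subset_ball (by norm_num) hz4
    rw [h.sol z hz1, abs_mul, abs_mul, abs_of_nonneg (h.nonneg z hz1),
      abs_of_nonneg (Real.rpow_nonneg (abs_nonneg (v z)) _), mul_assoc]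
    have h3 : |v z| ^ (p - 1) * |v z| ≤ M ^ p := by
      calc _ ≤ M ^ (p - 1) * M := by
            have := hb z hz4
            gcongr
        _ = M ^ p := by
            have : M ≠ 0 := by positivity
            rw [Real.rpow_sub_one this]; field_simp
    have := hu z hz1
    gcongr)
  refine key.trans ((le_abs_self _).trans ?_)
  exact Finset.single_le_sum (f := fun k => |D k * (ρ ^ k)⁻¹ * (M + ρ ^ 4 * (c1 * M ^ p))|)
    (fun i _ => abs_nonneg _) (Finset.mem_range.2 (by omega))

end

noncomputable section
variable {n : ℕ}

/-- A real function of the logarithmic radius bounded near infinity. -/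
def Bd (φ : ℝ → ℝ) : Prop := ∃ C T₁, ∀ T ≥ T₁, |φ T| ≤ C

lemma Bd.const (c : ℝ) : Bd fun _ => c := ⟨|c|, 0, fun _ _ => le_rfl⟩

lemma Bd.add {φ ψ : ℝ → ℝ} (h : Bd φ) (h' : Bd ψ) : Bd fun T => φ T + ψ T := by
  obtain ⟨C, T₁, h⟩ := h
  obtain ⟨C', T₂, h'⟩ := h'
  exact ⟨C + C', max T₁ T₂, fun T hT => (abs_add_le _ _).trans
    (add_le_add (h T ((le_max_left _ _).trans hT)) (h' T ((le_max_right _ _).trans hT)))⟩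

lemma Bd.const_mul {φ : ℝ → ℝ} (h : Bd φ) (c : ℝ) : Bd fun T => c * φ T := by
  obtain ⟨C, T₁, h⟩ := h
  exact ⟨|c| * C, T₁, fun T hT => by
    rw [abs_mul]; exact mul_le_mul_of_nonneg_left (h T hT) (abs_nonneg c)⟩

lemma Bd.congr {φ ψ : ℝ → ℝ} (h : Bd φ) (T₀ : ℝ) (e : ∀ T ≥ T₀, ψ T = φ T) : Bd ψ := by
  obtain ⟨C, T₁, h⟩ := h
  exact ⟨C, max T₀ T₁, fun T hT => by
    rw [e T ((le_max_left _ _).trans hT)]; exact h T ((le_max_right _ _).trans hT)⟩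

lemma Bd.squeeze {φ ψ : ℝ → ℝ} (h : Bd φ) (T₀ : ℝ) (e : ∀ T ≥ T₀, |ψ T| ≤ φ T) : Bd ψ := by
  obtain ⟨C, T₁, h⟩ := h
  exact ⟨C, max T₀ T₁, fun T hT => (e T ((le_max_left _ _).trans hT)).trans
    ((le_abs_self _).trans (h T ((le_max_right _ _).trans hT)))⟩

/-- The shift of a profile by `T`. -/
def sh (T : ℝ) (X : ℝ → ℝ) (t : ℝ) : ℝ := X (t - T)

lemma sh_smooth {X : ℝ → ℝ} (h : ContDiff ℝ (⊤ : ℕ∞) X) (T : ℝ) : ContDiff ℝ (⊤ : ℕ∞) (sh T X) :=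
  h.comp (contDiff_id.sub contDiff_const)

lemma deriv_sh (X : ℝ → ℝ) (T : ℝ) : deriv (sh T X) = sh T (deriv X) :=
  funext fun t => deriv_comp_sub_const X T t

/-- Smooth profiles vanishing outside `[-b, b]`. -/
structure Cc (b : ℝ) (X : ℝ → ℝ) : Prop where
  smooth : ContDiff ℝ (⊤ : ℕ∞) X
  zero : ∀ t, b < |t| → X t = 0

variable {X Y : ℝ → ℝ} {b : ℝ}

lemma Cc.mul (h : Cc b X) (hY : ContDiff ℝ (⊤ : ℕ∞) Y) : Cc b fun t => X t * Y t :=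
  ⟨h.smooth.mul hY, fun t ht => by rw [h.zero t ht, zero_mul]⟩

lemma Cc.deriv (h : Cc b X) : Cc b (deriv X) where
  smooth := smooth_deriv h.smooth
  zero t ht := by
    have : X =ᶠ[𝓝 t] fun _ => 0 := by
      filter_upwards [(isOpen_lt continuous_const continuous_abs).mem_nhds ht] with s hs
        using h.zero s hs
    rw [this.deriv_eq]; simp

lemma Cc.wn (h : Cc b X) {T : ℝ} (hT : b + 1 < T) : Wn (sh T X) where
  smooth := sh_smooth h.smooth T
  zero t ht := h.zero _ (lt_of_lt_of_le (by linarith) (neg_le_abs _))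
  zero' := ⟨b + T + 1, fun t ht => h.zero _ (lt_of_lt_of_le (by linarith) (le_abs_self _))⟩

lemma Cc.far (h : Cc b X) {T t τ : ℝ} (hT : b + τ + 1 ≤ T) (ht : sh T X t ≠ 0) : τ < t := by
  by_contra hlt
  exact ht (h.zero _ (lt_of_lt_of_le (by linarith) (neg_le_abs _)))

/-- A smooth bump equal to one on `[-b, b]`. -/
def bmp (b t : ℝ) : ℝ := stp (t + b + 3) * (1 - stp (t - b))

lemma bmp_smooth (b : ℝ) : ContDiff ℝ (⊤ : ℕ∞) (bmp b) := by
  have := stp_smooth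
  unfold bmp
  fun_prop

lemma bmp_nonneg (b t : ℝ) : 0 ≤ bmp b t :=
  mul_nonneg (stp_nonneg _) (by linarith [stp_le_one (t - b)])

lemma bmp_le_one (b t : ℝ) : bmp b t ≤ 1 :=
  mul_le_one₀ (stp_le_one _) (by linarith [stp_le_one (t - b)]) (by linarith [stp_nonneg (t - b)])

lemma bmp_one {t : ℝ} (h : |t| ≤ b) : bmp b t = 1 := by
  have := abs_le.1 h
  rw [bmp, stp_one (by linarith), stp_zero (by linarith)]; norm_num

lemma bmp_cc (b : ℝ) : Cc (b + 3) (bmp b) where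
  smooth := bmp_smooth b
  zero t ht := by
    rcases lt_abs.1 ht with h | h
    · rw [bmp, stp_one (t := t - b) (by linarith)]; simp
    · rw [bmp, stp_zero (t := t + b + 3) (by linarith)]; simp

lemma Cc.exists_dom (h : Cc b X) : ∃ b' Y, Cc b' Y ∧ (∀ t, |X t| ≤ Y t) := by
  obtain ⟨M, hM⟩ := (isCompact_Icc (a := -b) (b := b)).exists_bound_of_continuousOn
    h.smooth.continuous.continuousOn
  refine ⟨_, _, (bmp_cc b).mul (contDiff_const (c := |M|)), fun t => ?_⟩
  by_cases ht : |t| ≤ b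
  · rw [bmp_one ht, one_mul]
    exact (hM t (abs_le.1 ht)).trans (le_abs_self M)
  · rw [h.zero t (not_le.1 ht), abs_zero]
    exact mul_nonneg (bmp_nonneg _ _) (abs_nonneg M)

/-- Integrals over logarithmic windows of fixed length stay bounded near infinity. -/
def UB (f : Sm n) : Prop := ∀ b X, Cc b X → Bd fun T => K (sh T X) f

variable {f g : Sm n}

lemma UB.add (h : UB f) (h' : UB g) : UB (f + g) := fun b X hX =>
  ((h b X hX).add (h' b X hX)).congr 0 fun T _ => by rw [map_add]

lemma UB.smul (h : UB f) (c : ℝ) : UB (c • f) := fun b X hX =>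
  ((h b X hX).const_mul c).congr 0 fun T _ => by rw [map_smul, smul_eq_mul]

lemma UB.sub (h : UB f) (h' : UB g) : UB (f - g) := by
  have := h.add (h'.smul (-1)); rwa [neg_one_smul, ← sub_eq_add_neg] at this

lemma UB.DE (h : UB f) : UB (DE f) := fun b X hX =>
  ((h b _ hX.deriv).const_mul (-1)).congr (b + 2) fun T hT => by
    rw [K_DE (hX.wn (by linarith [show T ≥ b + 2 from hT])), deriv_sh]; ring

lemma UB_mul_LA (f g : Sm n) : UB (f * LA g + GA f g) := fun b X hX =>
  (Bd.const 0).congr (b + 2) fun T hT => by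
    rw [map_add, K_mul_LA (hX.wn (by linarith [show T ≥ b + 2 from hT]))]; ring

lemma UB.of_le {τ : ℝ} (h : UB g) (h0 : ∀ x, τ < Real.log ‖x‖ → 0 ≤ f x)
    (hle : ∀ x, τ < Real.log ‖x‖ → f x ≤ g x) : UB f := fun b X hX => by
  obtain ⟨b', Y, hY, hXY⟩ := hX.exists_dom
  have hY0 : ∀ t, 0 ≤ Y t := fun t => (abs_nonneg _).trans (hXY t)
  refine (h b' Y hY).squeeze (max (b' + 2) (max (b + 2) (b' + τ + 1))) fun T hT => ?_
  simp only [ge_iff_le, max_le_iff] at hT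
  obtain ⟨h1, h2, h3⟩ := hT
  have wY := hY.wn (show b' + 1 < T by linarith)
  have wX := hX.wn (show b + 1 < T by linarith)
  have e : K (sh T Y) f ≤ K (sh T Y) g :=
    K_mono wY (fun t => hY0 _) fun x hx => hle x (hY.far h3 hx)
  refine le_trans (abs_le.2 ⟨?_, ?_⟩) e
  · have := K_nonneg (f := f) (wY.add wX) (fun t => by
      have := neg_le_of_abs_le (hXY (t - T)); simp only [sh]; linarith) (fun x hx => ?_)
    · rw [K_add wY wX] at this; linarith
    · by_cases hx' : sh T Y (Real.log ‖x‖) = 0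
      · exfalso
        have := hXY (Real.log ‖x‖ - T)
        rw [show Y (Real.log ‖x‖ - T) = 0 from hx'] at this
        have h4 : sh T X (Real.log ‖x‖) = 0 := abs_nonpos_iff.1 this
        exact hx (by rw [hx', h4, add_zero])
      · exact h0 x (hY.far h3 hx')
  · have := K_nonneg (f := f) (wY.add (wX.const_mul (-1))) (fun t => by
      have := le_of_abs_le (hXY (t - T)); simp only [sh]; linarith) (fun x hx => ?_)
    · rw [K_add wY (wX.const_mul _), K_const_mul wX] at this; linarith
    · by_cases hx' : sh T Y (Real.log ‖x‖) = 0
      · exfalso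
        have := hXY (Real.log ‖x‖ - T)
        rw [show Y (Real.log ‖x‖ - T) = 0 from hx'] at this
        have h4 : sh T X (Real.log ‖x‖) = 0 := abs_nonpos_iff.1 this
        exact hx (by rw [hx', h4]; ring)
      · exact h0 x (hY.far h3 hx')

lemma UB.congr {τ : ℝ} (h : UB g) (he : ∀ x, τ < Real.log ‖x‖ → f x = g x) : UB f :=
  fun b X hX => (h b X hX).congr (max (b + 2) (b + τ + 1)) fun T hT => by
    simp only [ge_iff_le, max_le_iff] at hT
    exact K_congr (hX.wn (by linarith)) fun x hx => he x (hX.far hT.2 hx)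

lemma UB.mul (hf : UB (f * f)) (hg : UB (g * g)) : UB (f * g) := by
  have h1 : UB ((f + g) * (f + g)) := UB.of_le (τ := 0) ((hf.add hg).smul 2)
    (fun x _ => mul_self_nonneg _) (fun x _ => by
      simp only [Sm.mul_apply, Sm.add_apply, Sm.smul_apply]
      nlinarith [mul_self_nonneg (f x - g x)])
  have h2 := ((h1.sub hf).sub hg).smul (1 / 2)
  refine h2.congr (τ := 0) fun x _ => ?_
  simp only [Sm.mul_apply, Sm.add_apply, Sm.smul_apply, Sm.sub_apply]; ring

lemma UB.left (h : UB (f + g)) (hf : ∀ x, 0 ≤ f x) (hg : ∀ x, 0 ≤ g x) : UB f :=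
  h.of_le (τ := 0) (fun x _ => hf x) fun x _ => by rw [Sm.add_apply]; linarith [hg x]

lemma UB.sq_add (hf : UB (f * f)) (hg : UB (g * g)) : UB ((f + g) * (f + g)) := by
  refine ((hf.add hg).add ((hf.mul hg).smul 2)).congr (τ := 0) fun x _ => ?_
  simp only [Sm.mul_apply, Sm.add_apply, Sm.smul_apply]; ring

lemma UB.sq_smul (hf : UB (f * f)) (c : ℝ) : UB ((c • f) * (c • f)) := by
  refine (hf.smul (c * c)).congr (τ := 0) fun x _ => ?_
  simp only [Sm.mul_apply, Sm.smul_apply]; ring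

/-- Cylindrical regularity: integral bounds for `w` and its second order cylindrical operator on
windows control all the second derivatives. -/
lemma UB.elliptic {w : Sm n} (c d : ℝ) (h0 : UB (w * w))
    (hB : UB ((_root_.DE (_root_.DE w) + c • _root_.DE w + LA w + d • w) *
      (_root_.DE (_root_.DE w) + c • _root_.DE w + LA w + d • w))) :
    UB (_root_.DE w * _root_.DE w) ∧ UB (GA w w) ∧
      UB (_root_.DE (_root_.DE w) * _root_.DE (_root_.DE w)) ∧ UB (LA w * LA w) ∧
      UB (GA (_root_.DE w) (_root_.DE w)) := by
  set B := _root_.DE (_root_.DE w) + c • _root_.DE w + LA w + d • w with hBdef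
  have h1 : UB (w * _root_.DE w) := by
    refine (h0.DE.smul (1 / 2)).congr (τ := 0) fun x _ => ?_
    rw [DE_mul]
    simp only [Sm.mul_apply, Sm.smul_apply, Sm.add_apply]; ring
  have h2 : UB (_root_.DE w * _root_.DE w + GA w w) := by
    refine ((((h1.DE.add (h1.smul c)).add (UB_mul_LA w w)).add (h0.smul d)).sub (h0.mul hB)).congr
      (τ := 0) fun x _ => ?_
    simp only [DE_mul, hBdef, Sm.mul_apply, Sm.smul_apply, Sm.add_apply, Sm.sub_apply]; ring
  have n1 : ∀ x, 0 ≤ (_root_.DE w * _root_.DE w) x := fun x => mul_self_nonneg _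
  have h3 := h2.left n1 (GA_self_nonneg w)
  have h4 : UB (GA w w) := UB.left (by rwa [add_comm] at h2) (GA_self_nonneg w) n1
  set h := _root_.DE (_root_.DE w) + LA w with hh
  have h5 : UB (h * h) := by
    have e : h = B + (-c) • _root_.DE w + (-d) • w := by
      ext x; simp only [hBdef, hh, Sm.smul_apply, Sm.add_apply]; ring
    rw [e]
    exact (hB.sq_add (h3.sq_smul _)).sq_add (h0.sq_smul _)
  have h6 : UB (_root_.DE (_root_.DE w) * _root_.DE (_root_.DE w) + LA w * LA w +
      (2 : ℝ) • GA (_root_.DE w) (_root_.DE w)) := by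
    refine (h5.sub ((UB_mul_LA (_root_.DE (_root_.DE w)) w).smul 2)).add (h4.DE.DE)
      |>.congr (τ := 0) fun x _ => ?_
    simp only [DE_GA, DE_add, GA_comm w, hh, Sm.mul_apply, Sm.smul_apply, Sm.add_apply, Sm.sub_apply]
    ring
  have n2 : ∀ x, 0 ≤ (_root_.DE (_root_.DE w) * _root_.DE (_root_.DE w)) x :=
    fun x => mul_self_nonneg _
  have n3 : ∀ x, 0 ≤ (LA w * LA w) x := fun x => mul_self_nonneg _
  have n4 : ∀ x, 0 ≤ ((2 : ℝ) • GA (_root_.DE w) (_root_.DE w)) x := fun x => by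
    rw [Sm.smul_apply]; linarith [GA_self_nonneg (_root_.DE w) x]
  refine ⟨h3, h4, ?_, ?_, ?_⟩
  · refine h6.of_le (τ := 0) (fun x _ => n2 x) fun x _ => ?_
    simp only [Sm.add_apply]; linarith [n3 x, n4 x]
  · refine h6.of_le (τ := 0) (fun x _ => n3 x) fun x _ => ?_
    simp only [Sm.add_apply]; linarith [n2 x, n4 x]
  · refine h6.of_le (τ := 0) (fun x _ => GA_self_nonneg _ x) fun x _ => ?_
    have := GA_self_nonneg (_root_.DE w) x
    simp only [Sm.add_apply, Sm.smul_apply]; linarith [n2 x, n3 x]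
end

noncomputable section
variable {n : ℕ}

/-- Smooth profiles vanishing outside `[τ + 2, τ + 3]`. -/
structure Lz (τ : ℝ) (A : ℝ → ℝ) : Prop where
  smooth : ContDiff ℝ (⊤ : ℕ∞) A
  left : ∀ t, t < τ + 2 → A t = 0
  right : ∀ t, τ + 3 < t → A t = 0

variable {τ : ℝ} {A B A' B' : ℝ → ℝ}

lemma Lz.mul (h : Lz τ A) (hB : ContDiff ℝ (⊤ : ℕ∞) B) : Lz τ fun t => A t * B t :=
  ⟨h.smooth.mul hB, fun t ht => by rw [h.left t ht, zero_mul],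
    fun t ht => by rw [h.right t ht, zero_mul]⟩

lemma Lz.deriv (h : Lz τ A) : Lz τ (deriv A) where
  smooth := smooth_deriv h.smooth
  left t ht := by
    have : A =ᶠ[𝓝 t] fun _ => 0 := by
      filter_upwards [Iio_mem_nhds ht] with s hs using h.left s hs
    rw [this.deriv_eq]; simp
  right t ht := by
    have : A =ᶠ[𝓝 t] fun _ => 0 := by
      filter_upwards [Ioi_mem_nhds ht] with s hs using h.right s hs
    rw [this.deriv_eq]; simp

lemma Lz.wn (h : Lz τ A) (hτ : 0 ≤ τ) : Wn A :=
  ⟨⟨h.smooth, fun t ht => h.left t (by linarith)⟩, τ + 4, fun t ht => h.right t (by linarith)⟩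

lemma Lz.cc (h : Lz 0 A) : Cc 3 A where
  smooth := h.smooth
  zero t ht := by
    rcases lt_abs.1 ht with h' | h'
    · exact h.right t (by linarith)
    · exact h.left t (by linarith)

lemma Lz_stp (τ : ℝ) : Lz τ (deriv (sh τ stp)) where
  smooth := smooth_deriv (sh_smooth stp_smooth τ)
  left t ht := by rw [deriv_sh]; exact deriv_stp_zero (by linarith)
  right t ht := by rw [deriv_sh]; exact deriv_stp_zero' (by linarith)

/-- `Y T` is glued from the fixed left profile `A` and the moving right profile `B`. -/
def GF (τ : ℝ) (A B : ℝ → ℝ) (Y : ℝ → ℝ → ℝ) : Prop :=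
  ∃ T₁, ∀ T ≥ T₁, (∀ t < τ + 4, Y T t = A t) ∧ ∀ t > τ + 3, Y T t = B (t - T)

variable {Y Z : ℝ → ℝ → ℝ}

lemma GF.mul (h : GF τ A B Y) (h' : GF τ A' B' Z) :
    GF τ (fun t => A t * A' t) (fun t => B t * B' t) fun T t => Y T t * Z T t := by
  obtain ⟨T₁, h⟩ := h
  obtain ⟨T₂, h'⟩ := h'
  refine ⟨max T₁ T₂, fun T hT => ?_⟩
  simp only [ge_iff_le, max_le_iff] at hT
  exact ⟨fun t ht => by simp only [(h T hT.1).1 t ht, (h' T hT.2).1 t ht],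
    fun t ht => by simp only [(h T hT.1).2 t ht, (h' T hT.2).2 t ht]⟩

lemma GF.deriv (h : GF τ A B Y) : GF τ (deriv A) (deriv B) fun T => deriv (Y T) := by
  obtain ⟨T₁, h⟩ := h
  refine ⟨T₁, fun T hT => ⟨fun t ht => ?_, fun t ht => ?_⟩⟩
  · have : Y T =ᶠ[𝓝 t] A := by
      filter_upwards [Iio_mem_nhds ht] with s hs using (h T hT).1 s hs
    exact this.deriv_eq
  · have : Y T =ᶠ[𝓝 t] sh T B := by
      filter_upwards [Ioi_mem_nhds ht] with s hs using (h T hT).2 s hs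
    simp only [this.deriv_eq, deriv_sh]; rfl

lemma GF.bd {f : Sm n} (h : GF τ A B Y) (hτ : 0 ≤ τ) (hA : Lz τ A) (hB : Lz 0 B) (hf : UB f) :
    Bd fun T => K (Y T) f := by
  obtain ⟨T₁, h⟩ := h
  refine ((Bd.const (K A f)).add (hf _ _ hB.cc)).congr (max T₁ (τ + 5)) fun T hT => ?_
  simp only [ge_iff_le, max_le_iff] at hT
  rw [← K_add (hA.wn hτ) (hB.cc.wn (by linarith))]
  refine K_congr_left (fun t => ?_) f
  rcases lt_or_ge t (τ + 4) with ht | ht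
  · rw [(h T hT.1).1 t ht, sh, hB.left _ (by linarith), add_zero]
  · rw [(h T hT.1).2 t (by linarith), sh, hA.right _ (by linarith), zero_add]

/-- The plateau cutoff, rising near `τ` and falling near `T`. -/
def plt (τ T t : ℝ) : ℝ := sh τ stp t * (1 - sh T stp t)

lemma plt_smooth (τ T : ℝ) : ContDiff ℝ (⊤ : ℕ∞) (plt τ T) :=
  (sh_smooth stp_smooth τ).mul (contDiff_const.sub (sh_smooth stp_smooth T))

lemma plt_wn (hτ : 0 ≤ τ) (T : ℝ) : Wn (plt τ T) where
  smooth := plt_smooth τ T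
  zero t ht := by rw [plt, sh, stp_zero (by linarith), zero_mul]
  zero' := ⟨T + 4, fun t ht => by rw [plt, sh, sh, stp_one (t := t - T) (by linarith)]; simp⟩

lemma plt_far {T t : ℝ} (h : plt τ T t ≠ 0) : τ + 2 < t := by
  by_contra hlt
  exact h (by rw [plt, sh, stp_zero (by linarith), zero_mul])

lemma plt_nonneg (τ T t : ℝ) : 0 ≤ plt τ T t :=
  mul_nonneg (stp_nonneg _) (sub_nonneg.2 (stp_le_one _))

lemma plt_GF (τ : ℝ) : GF τ (sh τ stp) (fun s => 1 - stp s) (plt τ) := by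
  refine ⟨τ + 4, fun T hT => ⟨fun t ht => ?_, fun t ht => ?_⟩⟩
  · rw [plt, sh, sh, stp_zero (t := t - T) (by linarith)]; simp
  · rw [plt, sh, sh, stp_one (t := t - τ) (by linarith)]; simp

lemma Lz_stp_right : Lz 0 (deriv fun s => 1 - stp s) := by
  have e : (deriv fun s => 1 - stp s) = fun s => deriv stp s * (-1) := by
    funext s; rw [deriv_const_sub]; ring
  rw [e]
  exact Lz.mul ⟨smooth_deriv stp_smooth, fun t ht => deriv_stp_zero (by linarith),
    fun t ht => deriv_stp_zero' (by linarith)⟩ contDiff_const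

lemma deriv_plt_mul_bd {f : Sm n} (hτ : 0 ≤ τ) (hf : UB f) :
    Bd fun T => K (fun t => deriv (plt τ T) t * plt τ T t) f :=
  ((plt_GF τ).deriv.mul (plt_GF τ)).bd hτ ((Lz_stp τ).mul (sh_smooth stp_smooth τ))
    (Lz_stp_right.mul (contDiff_const.sub stp_smooth)) hf

lemma deriv_plt_mul_deriv_bd {f : Sm n} (hτ : 0 ≤ τ) (hf : UB f) :
    Bd fun T => K (fun t => deriv (plt τ T) t * deriv (plt τ T) t) f :=
  ((plt_GF τ).deriv.mul (plt_GF τ).deriv).bd hτ ((Lz_stp τ).mul (Lz_stp τ).smooth)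
    (Lz_stp_right.mul Lz_stp_right.smooth) hf

lemma deriv2_plt_mul_bd {f : Sm n} (hτ : 0 ≤ τ) (hf : UB f) :
    Bd fun T => K (fun t => deriv (deriv (plt τ T)) t * plt τ T t) f :=
  ((plt_GF τ).deriv.deriv.mul (plt_GF τ)).bd hτ ((Lz_stp τ).deriv.mul (sh_smooth stp_smooth τ))
    (Lz_stp_right.deriv.mul (contDiff_const.sub stp_smooth)) hf

lemma deriv2_plt_mul_deriv_bd {f : Sm n} (hτ : 0 ≤ τ) (hf : UB f) :
    Bd fun T => K (fun t => deriv (deriv (plt τ T)) t * deriv (plt τ T) t) f :=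
  ((plt_GF τ).deriv.deriv.mul (plt_GF τ).deriv).bd hτ ((Lz_stp τ).deriv.mul (Lz_stp τ).smooth)
    (Lz_stp_right.deriv.mul Lz_stp_right.smooth) hf

lemma deriv2_plt_mul_deriv2_bd {f : Sm n} (hτ : 0 ≤ τ) (hf : UB f) :
    Bd fun T => K (fun t => deriv (deriv (plt τ T)) t * deriv (deriv (plt τ T)) t) f :=
  ((plt_GF τ).deriv.deriv.mul (plt_GF τ).deriv.deriv).bd hτ
    ((Lz_stp τ).deriv.mul (Lz_stp τ).deriv.smooth)
    (Lz_stp_right.deriv.mul Lz_stp_right.deriv.smooth) hf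

/-- The integral of `f` over `{τ < log |x| < T}` stays bounded as `T → ∞`. -/
def IB (τ : ℝ) (f : Sm n) : Prop := Bd fun T => K (fun t => plt τ T t * plt τ T t) f

variable {f g : Sm n}

lemma plt_sq_wn (hτ : 0 ≤ τ) (T : ℝ) : Wn fun t => plt τ T t * plt τ T t :=
  (plt_wn hτ T).mul (plt_smooth τ T)

lemma IB.add (h : IB τ f) (h' : IB τ g) : IB τ (f + g) :=
  (Bd.add h h').congr 0 fun T _ => by rw [map_add]

lemma IB.smul (h : IB τ f) (c : ℝ) : IB τ (c • f) :=
  (Bd.const_mul h c).congr 0 fun T _ => by rw [map_smul, smul_eq_mul]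

lemma IB.sub (h : IB τ f) (h' : IB τ g) : IB τ (f - g) := by
  have := h.add (h'.smul (-1)); rwa [neg_one_smul, ← sub_eq_add_neg] at this

lemma UB.IB_DE (h : UB f) (hτ : 0 ≤ τ) : IB τ (_root_.DE f) :=
  ((deriv_plt_mul_bd hτ h).const_mul (-2)).congr 0 fun T _ => by
    rw [K_DE (plt_sq_wn hτ T), ← neg_one_mul, show (-2 : ℝ) = -1 * 2 by norm_num, mul_assoc,
      ← K_const_mul ((plt_wn hτ T).deriv.mul (plt_smooth τ T))]
    congr 1
    refine K_congr_left (fun t => ?_) f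
    have hd : HasDerivAt (plt τ T) (deriv (plt τ T) t) t :=
      ((plt_smooth τ T).differentiable (by simp) t).hasDerivAt
    have := (hd.mul hd).deriv
    change deriv (fun t => plt τ T t * plt τ T t) t = _ at this
    rw [this]; ring

lemma IB_mul_LA (hτ : 0 ≤ τ) (f g : Sm n) : IB τ (f * LA g + GA f g) :=
  (Bd.const 0).congr 0 fun T _ => by
    rw [map_add, K_mul_LA (plt_sq_wn hτ T)]; ring

lemma plt_sq_far {T : ℝ} {x : Eu n}
    (h : plt τ T (Real.log ‖x‖) * plt τ T (Real.log ‖x‖) ≠ 0) : τ + 2 < Real.log ‖x‖ :=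
  plt_far (left_ne_zero_of_mul h)

lemma IB.congr (hτ : 0 ≤ τ) (h : IB τ g) (he : ∀ x, τ + 2 < Real.log ‖x‖ → f x = g x) : IB τ f :=
  Bd.congr h 0 fun T _ => K_congr (plt_sq_wn hτ T) fun x hx => he x (plt_sq_far hx)

lemma IB.of_le (hτ : 0 ≤ τ) (h : IB τ g) (h0 : ∀ x, τ + 2 < Real.log ‖x‖ → 0 ≤ f x)
    (hle : ∀ x, τ + 2 < Real.log ‖x‖ → f x ≤ g x) : IB τ f :=
  Bd.squeeze h 0 fun T _ => by
    rw [abs_of_nonneg (K_nonneg (plt_sq_wn hτ T) (fun t => mul_self_nonneg _) fun x hx =>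
      h0 x (plt_sq_far hx))]
    exact K_mono (plt_sq_wn hτ T) (fun t => mul_self_nonneg _) fun x hx => hle x (plt_sq_far hx)

/-- Convergent integrals have vanishing tails. -/
lemma IB.tail (hτ : 0 ≤ τ) (h : IB τ f) (h0 : ∀ x, 0 ≤ f x) {ε : ℝ} (hε : 0 < ε) :
    ∃ T₁, ∀ T ≥ T₁, ∀ Y, Wn Y → (∀ t, Y t ≤ 1) → (∀ t, Y t ≠ 0 → T + 3 ≤ t ∧ t ≤ T + 7) →
      K Y f ≤ ε := by
  set F : ℝ → ℝ := fun T => K (fun t => plt τ T t * plt τ T t) f with hF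
  have mono : ∀ S T, S ≤ T → F S ≤ F T := fun S T hST =>
    K_mono_left (plt_sq_wn hτ S) (plt_sq_wn hτ T) (fun t => by
      have : plt τ S t ≤ plt τ T t :=
        mul_le_mul_of_nonneg_left (by
          have := stp_mono (show t - T ≤ t - S by linarith)
          simp only [sh]; linarith) (stp_nonneg _)
      exact mul_le_mul this this (plt_nonneg _ _ _) (plt_nonneg _ _ _)) h0
  obtain ⟨C, T₁, hC⟩ := h
  have hb : BddAbove (F '' Ici T₁) :=
    ⟨C, by rintro _ ⟨T, hT, rfl⟩; exact (le_abs_self _).trans (hC T hT)⟩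
  obtain ⟨_, ⟨S, hS, rfl⟩, hlt⟩ := exists_lt_of_lt_csSup (Nonempty.image F ⟨T₁, le_refl T₁⟩)
    (show sSup (F '' Ici T₁) - ε < sSup (F '' Ici T₁) by linarith)
  have hS' : T₁ ≤ S := hS
  refine ⟨max S (τ + 3), fun T hT Y hY h1 hY2 => ?_⟩
  simp only [ge_iff_le, max_le_iff] at hT
  have e : K Y f + F T ≤ F (T + 5) := by
    rw [hF]
    simp only
    rw [← K_add hY (plt_sq_wn hτ T)]
    refine K_mono_left (hY.add (plt_sq_wn hτ T)) (plt_sq_wn hτ _) (fun t => ?_) h0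
    by_cases ht : Y t = 0
    · rw [ht, zero_add]
      have : plt τ T t ≤ plt τ (T + 5) t :=
        mul_le_mul_of_nonneg_left (by
          have := stp_mono (show t - (T + 5) ≤ t - T by linarith)
          simp only [sh]; linarith) (stp_nonneg _)
      exact mul_le_mul this this (plt_nonneg _ _ _) (plt_nonneg _ _ _)
    · obtain ⟨h3, h4⟩ := hY2 t ht
      simp only [plt, sh]
      rw [stp_one (t := t - T) (by linarith), stp_one (t := t - τ) (by linarith),
        stp_zero (t := t - (T + 5)) (by linarith)]
      norm_num; exact h1 t
  have e1 := mono S T hT.1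
  have e2 : F (T + 5) ≤ sSup (F '' Ici T₁) :=
    le_csSup hb ⟨T + 5, by simp only [mem_Ici]; linarith, rfl⟩
  linarith
end

noncomputable section
variable {n : ℕ}

/-- The cylindrical second order operator `∂ₜ² + c ∂ₜ + Δ_S + d`. -/
def cyl (c d : ℝ) (f : Sm n) : Sm n := DE (DE f) + c • DE f + LA f + d • f

/-- Two factor form of the cylindrical bilaplacian. -/
def cyl4 (m μ : ℝ) (w : Sm n) : Sm n := cyl (m - 2) (-(μ + 2 * m)) (cyl (m + 2) (-μ) w)

lemma cyl4_eq (m μ : ℝ) (w : Sm n) (x : Eu n) : cyl4 m μ w x =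
    DE (DE (DE (DE w))) x + 2 * m * DE (DE (DE w)) x + (m ^ 2 - 4 - (2 * μ + 2 * m)) * DE (DE w) x +
      2 * LA (DE (DE w)) x + 2 * m * LA (DE w) x - m * (2 * μ + 2 * m + 4) * DE w x +
      LA (LA w) x - (2 * μ + 2 * m) * LA w x + μ * (μ + 2 * m) * w x := by
  simp only [cyl4, cyl, DE_add, DE_smul, LA_add, LA_smul, DE_LA, Sm.add_apply, Sm.smul_apply]
  ring

/-- The window bounds provided by elliptic regularity. -/
structure WB (w : Sm n) : Prop where
  h00 : UB (w * w)
  h11 : UB (DE w * DE w)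
  h22 : UB (DE (DE w) * DE (DE w))
  hLL : UB (LA w * LA w)
  hG : UB (GA w w)
  hG1 : UB (GA (DE w) (DE w))

lemma WB.of_cyl {w : Sm n} (c d : ℝ) (h0 : UB (w * w)) (hB : UB (cyl c d w * cyl c d w)) : WB w := by
  obtain ⟨h1, h2, h3, h4, h5⟩ := UB.elliptic c d h0 hB
  exact ⟨h0, h1, h3, h4, h2, h5⟩

variable {w : Sm n} {τ : ℝ}

lemma WB.GA_mixed (h : WB w) : UB (GA w (DE w)) :=
  (h.hG.DE.smul (1 / 2)).congr (τ := 0) fun x _ => by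
    rw [DE_GA, GA_comm (DE w) w]; simp only [Sm.add_apply, Sm.smul_apply]; ring

/-- Testing the equation with `w`, up to terms with bounded integrals. -/
lemma WB.energy (h : WB w) (hτ : 0 ≤ τ) (m μ : ℝ) :
    IB τ (w * cyl4 m μ w - (DE (DE w) * DE (DE w) + (4 + (2 * μ + 2 * m) - m ^ 2) • (DE w * DE w) +
      (2 : ℝ) • GA (DE w) (DE w) + LA w * LA w + (2 * μ + 2 * m) • GA w w +
      (μ * (μ + 2 * m)) • (w * w))) := by
  have u02 := h.h00.mul h.h22
  have u12 := h.h11.mul h.h22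
  have u01 := h.h00.mul h.h11
  have u03 : UB (w * DE (DE (DE w))) := (u02.DE.sub u12).congr (τ := 0) fun x _ => by
    simp only [DE_mul, Sm.add_apply, Sm.mul_apply, Sm.sub_apply]; ring
  refine IB.congr hτ (((((((((u03.sub u12).IB_DE hτ).add
    (((u02.sub (h.h11.smul (1 / 2))).IB_DE hτ).smul (2 * m))).add
    ((u01.IB_DE hτ).smul (m ^ 2 - 4 - (2 * μ + 2 * m)))).add
    (((IB_mul_LA hτ w (DE (DE w))).sub (h.GA_mixed.IB_DE hτ)).smul 2)).add
    (((IB_mul_LA hτ w (DE w)).sub ((h.hG.IB_DE hτ).smul (1 / 2))).smul (2 * m))).add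
    ((h.h00.IB_DE hτ).smul (-(m * (2 * μ + 2 * m + 4) / 2)))).add
    ((IB_mul_LA hτ w (LA w)).sub (IB_mul_LA hτ (LA w) w))).add
    ((IB_mul_LA hτ w w).smul (-(2 * μ + 2 * m)))) fun x _ => ?_
  simp only [DE_mul, DE_sub, DE_smul, DE_GA, GA_comm (LA w) w, GA_comm (DE w) w,
    Sm.mul_apply, Sm.add_apply, Sm.sub_apply, Sm.smul_apply, cyl4_eq]
  ring

/-- Testing the equation with `∂ₜ w`, up to terms with bounded integrals. -/
lemma WB.dilation (h : WB w) (hτ : 0 ≤ τ) (m μ : ℝ) :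
    IB τ (DE w * cyl4 m μ w + ((2 * m) • (DE (DE w) * DE (DE w)) +
      (2 * m) • GA (DE w) (DE w) + (m * (2 * μ + 2 * m + 4)) • (DE w * DE w))) := by
  have u12 := h.h11.mul h.h22
  have u13 : UB (DE w * DE (DE (DE w))) := (u12.DE.sub h.h22).congr (τ := 0) fun x _ => by
    simp only [DE_mul, Sm.add_apply, Sm.mul_apply, Sm.sub_apply]; ring
  refine IB.congr hτ (((((((((u13.sub (h.h22.smul (1 / 2))).IB_DE hτ).add
    ((u12.IB_DE hτ).smul (2 * m))).add
    ((h.h11.IB_DE hτ).smul ((m ^ 2 - 4 - (2 * μ + 2 * m)) / 2))).add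
    (((IB_mul_LA hτ (DE w) (DE (DE w))).sub ((h.hG1.IB_DE hτ).smul (1 / 2))).smul 2)).add
    ((IB_mul_LA hτ (DE w) (DE w)).smul (2 * m))).add
    (((IB_mul_LA hτ (DE w) (LA w)).sub (IB_mul_LA hτ (LA w) (DE w))).add
      ((h.hLL.IB_DE hτ).smul (1 / 2)))).add
    (((IB_mul_LA hτ (DE w) w).sub ((h.hG.IB_DE hτ).smul (1 / 2))).smul (-(2 * μ + 2 * m)))).add
    ((h.h00.IB_DE hτ).smul (μ * (μ + 2 * m) / 2))) fun x _ => ?_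
  simp only [DE_mul, DE_sub, DE_smul, DE_GA, DE_LA, GA_comm (LA w) (DE w), GA_comm (DE (DE w)) (DE w),
    GA_comm w (DE w), Sm.mul_apply, Sm.add_apply, Sm.sub_apply, Sm.smul_apply, cyl4_eq]
  ring

/-- The square of the operator in the stability test, up to terms with bounded integrals. -/
lemma WB.stab_square (h : WB w) (hτ : 0 ≤ τ) (κ : ℝ) :
    IB τ (cyl 2 (-κ) w * cyl 2 (-κ) w - (DE (DE w) * DE (DE w) + (4 + 2 * κ) • (DE w * DE w) +
      (2 : ℝ) • GA (DE w) (DE w) + LA w * LA w + (2 * κ) • GA w w + (κ ^ 2) • (w * w))) := by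
  have u01 := h.h00.mul h.h11
  refine IB.congr hτ (((((((IB_mul_LA hτ (DE (DE w)) w).sub (h.GA_mixed.IB_DE hτ)).smul 2).add
    (((IB_mul_LA hτ (DE w) w).sub ((h.hG.IB_DE hτ).smul (1 / 2))).smul 4)).add
    ((IB_mul_LA hτ w w).smul (-(2 * κ)))).add ((h.h11.IB_DE hτ).smul 2)).add
    (((u01.IB_DE hτ).smul (-(2 * κ))).add ((h.h00.IB_DE hτ).smul (-(2 * κ))))) fun x _ => ?_
  simp only [cyl, DE_mul, DE_GA, GA_comm (DE (DE w)) w, GA_comm (DE w) w,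
    Sm.mul_apply, Sm.add_apply, Sm.sub_apply, Sm.smul_apply]
  ring

/-- Stability in the supercritical and critical ranges makes `w` square integrable at infinity. -/
theorem WB.square_integrable (h : WB w) (hτ : 0 ≤ τ) {m μ κ p : ℝ} (hp : 1 < p) (hm : 0 ≤ m)
    (hμ : 0 < 2 * μ + 2 * m) (hκ : 2 * κ < p * (2 * μ + 2 * m)) (hκ2 : κ ^ 2 < p * (μ * (μ + 2 * m)))
    (hcrit : m = 0 → μ = κ) (hdil : IB τ (DE w * cyl4 m μ w)) {R : ℝ → ℝ} (hR : Bd R)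
    (hstab : ∀ T, p * K (fun t => plt τ T t * plt τ T t) (w * cyl4 m μ w) ≤
      K (fun t => plt τ T t * plt τ T t) (cyl 2 (-κ) w * cyl 2 (-κ) w) + R T) :
    IB τ (w * w) := by
  have nn : ∀ (f : Sm n) x, 0 ≤ (f * f) x := fun f x => mul_self_nonneg _
  set δ : ℝ := p * (μ * (μ + 2 * m)) - κ ^ 2 with hδ
  have hδ0 : 0 < δ := by linarith
  set S : Sm n := (p - 1) • (DE (DE w) * DE (DE w)) +
    (p * (4 + (2 * μ + 2 * m) - m ^ 2) - (4 + 2 * κ)) • (DE w * DE w) +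
    (2 * (p - 1)) • GA (DE w) (DE w) with hS
  have hmain : IB τ (p • (w * cyl4 m μ w) - cyl 2 (-κ) w * cyl 2 (-κ) w -
      (S + ((p - 1) • (LA w * LA w) + (p * (2 * μ + 2 * m) - 2 * κ) • GA w w + δ • (w * w)))) := by
    refine IB.congr hτ (((h.energy hτ m μ).smul p).sub (h.stab_square hτ κ)) fun x _ => ?_
    simp only [hS, hδ, Sm.mul_apply, Sm.add_apply, Sm.sub_apply, Sm.smul_apply]
    ring
  have hS' : ∃ S' : Sm n, IB τ S' ∧ ∀ x, S' x ≤ S x := by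
    rcases hm.eq_or_lt with h0 | h0
    · subst h0
      have hk := hcrit rfl
      subst hk
      refine ⟨0, (Bd.const 0).congr 0 fun T _ => by rw [map_zero], fun x => ?_⟩
      have h1 := nn (DE (DE w)) x
      have h2 := nn (DE w) x
      have h3 := GA_self_nonneg (DE w) x
      simp only [hS, Sm.add_apply, Sm.smul_apply, Sm.zero_apply]
      have e : p * (4 + (2 * μ + 2 * 0) - 0 ^ 2) - (4 + 2 * μ) = (p - 1) * (4 + 2 * μ) := by ring
      rw [e]
      have h4 : 0 < p - 1 := by linarith
      have h5 : 0 < 4 + 2 * μ := by linarith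
      positivity
    · refine ⟨S, ?_, fun x => le_rfl⟩
      have hd : IB τ ((2 * m) • (DE (DE w) * DE (DE w)) +
          (2 * m) • GA (DE w) (DE w) + (m * (2 * μ + 2 * m + 4)) • (DE w * DE w)) :=
        IB.congr hτ ((h.dilation hτ m μ).sub hdil) fun x _ => by
          simp only [Sm.add_apply, Sm.sub_apply]; ring
      have c3 : 0 < m * (2 * μ + 2 * m + 4) := by positivity
      have i1 : IB τ (DE (DE w) * DE (DE w)) := by
        refine IB.of_le hτ (hd.smul (2 * m)⁻¹) (fun x _ => nn _ x) fun x _ => ?_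
        simp only [Sm.add_apply, Sm.smul_apply]
        rw [le_inv_mul_iff₀ (by positivity)]
        have := mul_nonneg c3.le (nn (DE w) x)
        have := mul_nonneg (show 0 ≤ 2 * m by positivity) (GA_self_nonneg (DE w) x)
        linarith
      have i2 : IB τ (GA (DE w) (DE w)) := by
        refine IB.of_le hτ (hd.smul (2 * m)⁻¹) (fun x _ => GA_self_nonneg _ x) fun x _ => ?_
        simp only [Sm.add_apply, Sm.smul_apply]
        rw [le_inv_mul_iff₀ (by positivity)]
        have := mul_nonneg c3.le (nn (DE w) x)
        have := mul_nonneg (show 0 ≤ 2 * m by positivity) (nn (DE (DE w)) x)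
        linarith
      have i3 : IB τ (DE w * DE w) := by
        refine IB.of_le hτ (hd.smul (m * (2 * μ + 2 * m + 4))⁻¹) (fun x _ => nn _ x) fun x _ => ?_
        simp only [Sm.add_apply, Sm.smul_apply]
        rw [le_inv_mul_iff₀ (by positivity)]
        have := mul_nonneg (show 0 ≤ 2 * m by positivity) (GA_self_nonneg (DE w) x)
        have := mul_nonneg (show 0 ≤ 2 * m by positivity) (nn (DE (DE w)) x)
        linarith
      exact ((i1.smul _).add (i3.smul _)).add (i2.smul _)
  obtain ⟨S', hS1, hS2⟩ := hS'
  have key : IB τ (δ • (w * w)) := by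
    refine Bd.squeeze ((hR.add (hmain.const_mul (-1))).add (hS1.const_mul (-1))) 0 fun T _ => ?_
    have wn := plt_sq_wn (τ := τ) hτ T
    have p0 : ∀ t, 0 ≤ plt τ T t * plt τ T t := fun t => mul_self_nonneg _
    rw [abs_of_nonneg (K_nonneg wn p0 fun x _ => by
      rw [Sm.smul_apply]; exact mul_nonneg hδ0.le (nn w x))]
    have e1 : K (fun t => plt τ T t * plt τ T t) (S' + δ • (w * w)) ≤
        K (fun t => plt τ T t * plt τ T t) (S + ((p - 1) • (LA w * LA w) +
          (p * (2 * μ + 2 * m) - 2 * κ) • GA w w + δ • (w * w))) := by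
      refine K_mono wn p0 fun x _ => ?_
      have h1 := mul_nonneg (show 0 ≤ p - 1 by linarith) (nn (LA w) x)
      have h2 := mul_nonneg (show 0 ≤ p * (2 * μ + 2 * m) - 2 * κ by linarith) (GA_self_nonneg w x)
      simp only [Sm.add_apply, Sm.smul_apply]
      linarith [hS2 x]
    have e2 := hstab T
    rw [map_add] at e1
    rw [map_sub, map_sub, map_smul (K _) p, smul_eq_mul]
    linarith
  exact IB.congr hτ (key.smul δ⁻¹) fun x _ => by
    simp only [Sm.smul_apply]; field_simp
end

noncomputable section
variable {n : ℕ}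

/-- Equality far from the origin. -/
def FE (σ : ℝ) (f g : Sm n) : Prop := ∀ x, σ < Real.log ‖x‖ → f x = g x

variable {f g h : Sm n} {σ τ : ℝ}

lemma FE.trans (hf : FE σ f g) (hg : FE σ g h) : FE σ f h := fun x hx => (hf x hx).trans (hg x hx)

lemma norm_pos_of_log (hσ : 0 ≤ σ) {x : Eu n} (hx : σ < Real.log ‖x‖) : 0 < ‖x‖ := by
  rcases (norm_nonneg x).eq_or_lt with h | h
  · rw [← h, Real.log_zero] at hx; linarith
  · exact h

lemma log_norm_lt_iff (hσ : 0 ≤ σ) {x : Eu n} : σ < Real.log ‖x‖ ↔ Real.exp σ < ‖x‖ := by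
  constructor
  · intro h
    exact (Real.lt_log_iff_exp_lt (norm_pos_of_log hσ h)).1 h
  · intro h
    exact (Real.lt_log_iff_exp_lt ((Real.exp_pos σ).trans h)).2 h

lemma isOpen_far (hσ : 0 ≤ σ) : IsOpen {x : Eu n | σ < Real.log ‖x‖} := by
  simp only [log_norm_lt_iff hσ]
  exact isOpen_lt continuous_const continuous_norm

lemma FE.eventually (h : FE σ f g) (hσ : 0 ≤ σ) {x : Eu n} (hx : σ < Real.log ‖x‖) :
    f.1 =ᶠ[𝓝 x] g.1 := by
  filter_upwards [(isOpen_far hσ).mem_nhds hx] with y hy using h y hy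

lemma FE.DE (h : FE σ f g) (hσ : 0 ≤ σ) : FE σ (DE f) (DE g) := fun _ hx =>
  Der_congr_at (h.eventually hσ hx)

lemma FE.pd (h : FE σ f g) (hσ : 0 ≤ σ) (i : Fin n) : FE σ (pd i f) (pd i g) := fun _ hx =>
  Der_congr_at (h.eventually hσ hx)

lemma FE.LP (h : FE σ f g) (hσ : 0 ≤ σ) : FE σ (LP f) (LP g) := fun x hx => by
  simp only [_root_.LP, Sm.sum_apply]
  exact Finset.sum_congr rfl fun i _ => ((h.pd hσ i).pd hσ i) x hx

lemma FE.LA (h : FE σ f g) (hσ : 0 ≤ σ) : FE σ (LA f) (LA g) := fun x hx => by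
  simp only [_root_.LA, Sm.sub_apply, Sm.mul_apply, Sm.smul_apply, h.LP hσ x hx, h.DE hσ x hx,
    (h.DE hσ).DE hσ x hx]

lemma FE.cyl (h : FE σ f g) (hσ : 0 ≤ σ) (c d : ℝ) : FE σ (cyl c d f) (cyl c d g) := fun x hx => by
  simp only [_root_.cyl, Sm.add_apply, Sm.smul_apply, h x hx, h.LA hσ x hx, h.DE hσ x hx,
    (h.DE hσ).DE hσ x hx]

/-- The profile `e^{ct}`, cut off to vanish for `t ≤ τ + 1`. -/
def pw (τ c t : ℝ) : ℝ := Real.exp (c * t) * sh (τ - 1) stp t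

lemma pw_rd (hτ : 0 ≤ τ) (c : ℝ) : Rd (pw τ c) where
  smooth := (exp_smooth c).mul (sh_smooth stp_smooth _)
  zero t ht := by simp [pw, sh, stp_zero (show t - (τ - 1) ≤ 2 by linarith)]

lemma pw_far (c : ℝ) {t : ℝ} (ht : τ + 2 < t) : pw τ c t = Real.exp (c * t) := by
  simp [pw, sh, stp_one (show 3 ≤ t - (τ - 1) by linarith)]

lemma deriv_pw_far (c : ℝ) {t : ℝ} (ht : τ + 2 < t) : deriv (pw τ c) t = c * Real.exp (c * t) := by
  have : pw τ c =ᶠ[𝓝 t] fun t => Real.exp (c * t) := by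
    filter_upwards [lt_mem_nhds ht] with s hs using pw_far c hs
  rw [this.deriv_eq]
  have := ((hasDerivAt_id t).const_mul c).exp
  simp only [id, mul_one] at this
  rw [this.deriv]; ring

/-- Multiplication by `|x|^c` far from the origin. -/
def Wt (τ c : ℝ) (f : Sm n) : Sm n := rad (pw τ c) * f

lemma Wt_far (hτ : 0 ≤ τ) (c : ℝ) (f : Sm n) {x : Eu n} (hx : τ + 2 < Real.log ‖x‖) :
    Wt τ c f x = Real.exp (c * Real.log ‖x‖) * f x := by
  rw [Wt, Sm.mul_apply, rad_apply (pw_rd hτ c), pw_far c hx]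

lemma DE_Wt (hτ : 0 ≤ τ) (c : ℝ) (f : Sm n) :
    FE (τ + 2) (DE (Wt τ c f)) (c • Wt τ c f + Wt τ c (DE f)) := fun x hx => by
  simp only [Wt, DE_mul, DE_rad (pw_rd hτ c), Sm.add_apply, Sm.smul_apply, Sm.mul_apply,
    rad_apply (pw_rd hτ c), rad_apply (pw_rd hτ c).deriv, pw_far c hx, deriv_pw_far c hx]
  ring

lemma cyl_Wt (hτ : 0 ≤ τ) (c : ℝ) (f : Sm n) :
    FE (τ + 2) (cyl (n - 2 - 2 * c) (-(c * (n - 2 - c))) (Wt τ c f)) (Wt τ (c + 2) (LP f)) :=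
  fun x hx => by
  have hσ : 0 ≤ τ + 2 := by linarith
  have h1 := DE_Wt hτ c f
  have h2 := (h1.DE hσ) x hx
  rw [DE_add, DE_smul, Sm.add_apply, Sm.smul_apply, h1 x hx, DE_Wt hτ c (DE f) x hx] at h2
  have hLA : LA (Wt τ c f) = Wt τ c (LA f) := LA_rad_mul (pw_rd hτ c) f
  have hx0 := norm_pos_of_log hσ hx
  have e : Real.exp ((c + 2) * Real.log ‖x‖) = Real.exp (c * Real.log ‖x‖) * ‖x‖ ^ 2 := by
    rw [add_mul, Real.exp_add]
    congr 1
    rw [two_mul, Real.exp_add, Real.exp_log hx0]; ring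
  rw [cyl, hLA]
  simp only [Sm.add_apply, Sm.smul_apply, h2, h1 x hx, Wt_far hτ _ _ hx, LA,
    Sm.sub_apply, Sm.mul_apply, qn_apply, e]
  ring

end

noncomputable section
open scoped ENNReal
variable {n : ℕ}

/-- A solution near infinity which is stable there. -/
structure Far (p a β τ : ℝ) (u : Sm n) : Prop where
  hp : 1 < p
  ha : 0 ≤ a
  hτ : 0 ≤ τ
  hβ : β * (p - 1) = 4 + a
  adm : Adm p u (fun x => ‖x‖ ^ a) {x | Real.exp (τ + 1) < ‖x‖}

variable {p a β τ : ℝ} {u f : Sm n} {X : ℝ → ℝ} {b : ℝ}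

lemma Far.β_pos (h : Far p a β τ u) : 0 < β := by
  have h1 := h.hβ
  have h2 := h.hp
  have h3 := h.ha
  by_contra hb
  nlinarith

lemma Far.scale (h : Far p a β τ u) (y : Eu n) {R : ℝ} (hR : 0 < R) {Ω : Set (Eu n)}
    (hΩ : ∀ z ∈ Ω, Real.exp (τ + 1) < ‖y + R • z‖) :
    Adm p (R ^ β • aff y R u) (fun z => (‖y + R • z‖ / R) ^ a) Ω := by
  have := h.adm.scale (Ω' := Ω) y hR (Real.rpow_pos_of_pos hR β) hΩ
  convert this using 2 with z
  rw [Real.div_rpow (norm_nonneg _) hR.le, ← Real.rpow_mul hR.le, ← Real.rpow_natCast R 4,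
    ← Real.rpow_add hR, div_eq_mul_inv, ← Real.rpow_neg hR.le, mul_comm]
  congr 2
  push_cast
  linear_combination h.hβ

lemma K_scale (h : Cc b X) {S T : ℝ} (hS : b + 1 < S) (hT : b + 1 < T) (f : Sm n) :
    K (sh T X) f = K (sh S X) (aff 0 (Real.exp (T - S)) f) := by
  set R := Real.exp (T - S) with hR
  have hR0 : 0 < R := Real.exp_pos _
  have hw := h.wn hT
  have hw' := h.wn hS
  rw [K_def, K_def, J_apply (hw.exp _).cs, J_apply (hw'.exp _).cs]
  have e := integral_comp_aff (0 : Eu n) hR0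
    fun x => (rad fun t => Real.exp (-n * t) * sh T X t : Sm n) x * f x
  have e2 : ∫ x, (rad fun t => Real.exp (-n * t) * sh T X t : Sm n) x * f x = R ^ n *
      ∫ z : Eu n, (rad fun t => Real.exp (-n * t) * sh T X t : Sm n) (0 + R • z) * f (0 + R • z) := by
    rw [e, ← mul_assoc, mul_inv_cancel₀ (pow_pos hR0 n).ne', one_mul]
  rw [e2, ← integral_const_mul]
  congr 1; ext z
  rw [rad_apply (hw.exp _).toRd, rad_apply (hw'.exp _).toRd, aff_apply, ← mul_assoc]
  congr 1
  rcases eq_or_ne z 0 with rfl | hz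
  · simp [hw.zero 0 (by norm_num), hw'.zero 0 (by norm_num)]
  · have hz' : ‖z‖ ≠ 0 := norm_ne_zero_iff.2 hz
    have e3 : Real.log ‖0 + R • z‖ = Real.log ‖z‖ + (T - S) := by
      rw [zero_add, norm_smul, Real.norm_of_nonneg hR0.le, Real.log_mul hR0.ne' hz', hR,
        Real.log_exp]; ring
    have e4 : R ^ n = Real.exp (n * (T - S)) := by rw [hR, ← Real.exp_nat_mul]
    rw [e3, e4, ← mul_assoc, ← Real.exp_add]
    simp only [sh]
    ring_nf

lemma UB_one : UB (1 : Sm n) := fun b X hX =>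
  (Bd.const (K (sh (b + 2) X) (1 : Sm n))).congr (b + 2) fun T hT => by
    rw [K_scale hX (S := b + 2) (by linarith) (by linarith)]; rfl

lemma Cc.le_bmp_pow (h : Cc b X) : ∃ M, 0 ≤ M ∧ ∀ k t, |X t| ≤ M * bmp b t ^ k := by
  have hc : HasCompactSupport X := HasCompactSupport.intro (isCompact_Icc (a := -b) (b := b))
    fun t ht => h.zero t (by
      by_contra hb
      exact ht (abs_le.1 (not_lt.1 hb)))
  obtain ⟨M, hM⟩ := hc.exists_bound_of_continuous h.smooth.continuous
  have hM0 : 0 ≤ M := (norm_nonneg _).trans (hM 0)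
  refine ⟨M, hM0, fun k t => ?_⟩
  by_cases ht : b < |t|
  · rw [h.zero t ht, abs_zero]
    have := bmp_nonneg b t
    positivity
  · rw [bmp_one (not_lt.1 ht), one_pow, mul_one]
    exact hM t

/-- The scale-invariant energy density. -/
def enr (τ β : ℝ) (u : Sm n) : Sm n := Wt τ (2 * β + 4) (u * LP (LP u) + LP u * LP u)

lemma rpow_eq_exp_log {R : ℝ} (hR : 0 < R) (c : ℝ) : R ^ c = Real.exp (c * Real.log R) := by
  rw [Real.rpow_def_of_pos hR, mul_comm]

lemma Far.ub_energy (h : Far p a β τ u) : UB (enr τ β u) := fun b X hX => by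
  have hβ := h.β_pos
  set S := |b| + 5 with hSd
  have hbS := le_abs_self b
  have hbb := abs_nonneg b
  have hS : b + 4 < S := by linarith
  have hwn := (bmp_cc b).wn (T := S) (by linarith)
  set ζ : Sm n := rad (sh S (bmp b)) with hζd
  have hζ : ∀ x, ζ x = sh S (bmp b) (Real.log ‖x‖) := fun x => rad_apply hwn.toRd x
  have hsupp : tsupport ζ.1 ⊆ {x : Eu n | 1 < ‖x‖} := by
    have hcl : IsClosed {x : Eu n | Real.exp 1 ≤ ‖x‖} := isClosed_le continuous_const continuous_norm
    refine (closure_minimal (fun x hx => ?_) hcl).trans fun x (hx : Real.exp 1 ≤ ‖x‖) =>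
      lt_of_lt_of_le ?_ hx
    · have h1 : ζ x ≠ 0 := hx
      rw [hζ] at h1
      have h2 : 1 < Real.log ‖x‖ := by
        by_contra h3
        exact h1 (hwn.zero _ (not_lt.1 h3))
      exact ((log_norm_lt_iff zero_le_one).1 h2).le
    · exact Real.one_lt_exp_iff.2 one_pos
  obtain ⟨N, C, hC, hN⟩ := interior_bound h.hp (Ω := {x : Eu n | 1 < ‖x‖}) (ζ := ζ) hwn.cs hsupp
    (fun x => by rw [hζ]; exact bmp_nonneg _ _) (fun x => by rw [hζ]; exact bmp_le_one _ _)
    one_pos le_rfl zero_le_two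
  obtain ⟨M, hM0, hM⟩ := hX.le_bmp_pow
  set M' := M * Real.exp ((2 * β + 4) * (S + |b| + 3))
  set V := ∫ x in tsupport ζ.1, (1 : ℝ)
  refine ⟨M' * (C * V), S + τ + 2, fun T hT => ?_⟩
  have hτ := h.hτ
  set R := Real.exp (T - S) with hR
  have hR0 : 0 < R := Real.exp_pos _
  have hRτ : Real.exp (τ + 1) < R := Real.exp_lt_exp.2 (by linarith)
  have hin : ∀ z ∈ {x : Eu n | 1 < ‖x‖}, Real.exp (τ + 1) < ‖(0 : Eu n) + R • z‖ := by
    intro z (hz : 1 < ‖z‖)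
    rw [zero_add, norm_smul, Real.norm_of_nonneg hR0.le]
    nlinarith
  have hAdm := h.scale (0 : Eu n) hR0 hin
  set v : Sm n := R ^ β • aff 0 R u with hv
  have hb := hN v _ hAdm fun z (hz : 1 < ‖z‖) => by
    rw [zero_add, norm_smul, Real.norm_of_nonneg hR0.le, mul_div_cancel_left₀ _ hR0.ne']
    exact Real.one_le_rpow hz.le h.ha
  simp only [Real.rpow_zero] at hb
  have hc : Cs (ζ ^ (2 * N + 4)) := by rw [pow_succ]; exact Cs.mul' hwn.cs _
  rw [← map_add] at hb
  beta_reduce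
  rw [K_scale hX (S := S) (by linarith) (by linarith)]
  have hXw := hX.wn (T := S) (by linarith)
  have key : ∀ s : ℝ, |s| = 1 → s * K (sh S X) (aff 0 R (enr τ β u)) ≤
      M' * J (ζ ^ (2 * N + 4)) (v * LP (LP v) + LP v * LP v) := by
    intro s hs
    rw [K_def, ← J_smul (hXw.exp _).cs, ← J_smul hc]
    refine J_mono ((hXw.exp _).cs.smul _) (hc.smul _) fun z => ?_
    simp only [Sm.smul_apply, Sm.pow_apply, hζ, rad_apply (hXw.exp _).toRd, aff_apply]
    have hX1 := hM (2 * N + 4) (Real.log ‖z‖ - S)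
    rcases le_or_gt (Real.log ‖z‖) 1 with hz | hz
    · rw [hXw.zero _ hz, hwn.zero _ hz]; simp
    by_cases hz2 : S + |b| + 3 < Real.log ‖z‖
    · have h0 : bmp b (Real.log ‖z‖ - S) = 0 := (bmp_cc b).zero _ (by
        rw [abs_of_nonneg (by linarith)]; linarith)
      have h0' : X (Real.log ‖z‖ - S) = 0 := hX.zero _ (by
        rw [abs_of_nonneg (by linarith)]; linarith)
      simp only [sh, h0, h0']; simp
    have hz0 := norm_pos_of_log zero_le_one hz
    have hz1 : (1 : ℝ) < ‖z‖ := (Real.one_lt_exp_iff.2 one_pos).trans ((log_norm_lt_iff zero_le_one).1 hz)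
    have hlog : Real.log ‖(0 : Eu n) + R • z‖ = (T - S) + Real.log ‖z‖ := by
      rw [zero_add, norm_smul, Real.norm_of_nonneg hR0.le, Real.log_mul hR0.ne' hz0.ne', hR,
        Real.log_exp]
    have hsrc := hAdm.source_nonneg (x := z) hz1
    have hD : 0 ≤ (v * LP (LP v) + LP v * LP v) z :=
      add_nonneg hsrc (mul_self_nonneg _)
    have hE : enr τ β u (0 + R • z) = Real.exp ((2 * β + 4) * Real.log ‖z‖) *
        (v * LP (LP v) + LP v * LP v) z := by
      rw [enr, Wt_far h.hτ _ _ (by rw [hlog]; linarith), hlog]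
      simp only [hv, LP_smul, LP_aff, Sm.add_apply, Sm.mul_apply, Sm.smul_apply, aff_apply]
      have e1 : Real.exp ((2 * β + 4) * (T - S + Real.log ‖z‖)) =
          Real.exp ((2 * β + 4) * Real.log ‖z‖) * (R ^ β * R ^ β * R ^ 4) := by
        rw [rpow_eq_exp_log hR0, ← Real.exp_add, hR, ← Real.exp_nat_mul, ← Real.exp_add,
          ← Real.exp_add, Real.log_exp]
        push_cast
        ring_nf
      rw [e1]; ring
    rw [hE]
    set D := (v * LP (LP v) + LP v * LP v) z
    have i1 : s * X (Real.log ‖z‖ - S) ≤ M * bmp b (Real.log ‖z‖ - S) ^ (2 * N + 4) := by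
      refine (le_abs_self _).trans ?_
      rw [abs_mul, hs, one_mul]; exact hX1
    have i2 : Real.exp (-n * Real.log ‖z‖) ≤ 1 := Real.exp_le_one_iff.2 (by
      have : (0 : ℝ) ≤ n := Nat.cast_nonneg n
      nlinarith)
    have i3 : Real.exp ((2 * β + 4) * Real.log ‖z‖) ≤ Real.exp ((2 * β + 4) * (S + |b| + 3)) :=
      Real.exp_le_exp.2 (mul_le_mul_of_nonneg_left (not_lt.1 hz2) (by linarith))
    have i4 := pow_nonneg (bmp_nonneg b (Real.log ‖z‖ - S)) (2 * N + 4)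
    simp only [sh]
    calc _ = (s * X (Real.log ‖z‖ - S)) *
          (Real.exp (-n * Real.log ‖z‖) * (Real.exp ((2 * β + 4) * Real.log ‖z‖) * D)) := by ring
      _ ≤ (M * bmp b (Real.log ‖z‖ - S) ^ (2 * N + 4)) *
          (1 * (Real.exp ((2 * β + 4) * (S + |b| + 3)) * D)) := by
        gcongr
      _ = _ := by ring
  have hM' : 0 ≤ M' := by positivity
  refine (abs_le.2 ⟨?_, ?_⟩).trans (mul_le_mul_of_nonneg_left hb hM')
  · have := key (-1) (by norm_num); linarith
  · have := key 1 (by norm_num); linarith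

end

noncomputable section
open scoped ENNReal
variable {n : ℕ} {p a β τ : ℝ} {u f : Sm n}

/-- The drift coefficient of the cylindrical operator. -/
def dr (n : ℕ) (β : ℝ) : ℝ := n - 4 - 2 * β
/-- The zeroth order coefficient of the cylindrical operator. -/
def zc (n : ℕ) (β : ℝ) : ℝ := β * (n - 2 - β)

lemma ell1_eq : 2 * zc n β + 2 * dr n β = (β + 2) * (n - 4 - β) + β * (n - 2 - β) := by
  simp only [zc, dr]; ring

lemma ell2_eq : zc n β * (zc n β + 2 * dr n β) = β * (β + 2) * (n - 4 - β) * (n - 2 - β) := by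
  simp only [zc, dr]; ring

lemma cyl_far (hτ : 0 ≤ τ) (β : ℝ) (u : Sm n) :
    FE (τ + 2) (cyl (dr n β + 2) (-zc n β) (Wt τ β u)) (Wt τ (β + 2) (LP u)) := by
  convert cyl_Wt hτ β u using 2
  · simp only [dr]; ring
  · simp only [zc]

lemma cyl4_far (hτ : 0 ≤ τ) (β : ℝ) (u : Sm n) :
    FE (τ + 2) (cyl4 (dr n β) (zc n β) (Wt τ β u)) (Wt τ (β + 4) (LP (LP u))) := by
  have h1 := (cyl_far hτ β u).cyl (by linarith) (dr n β - 2) (-(zc n β + 2 * dr n β))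
  refine h1.trans ?_
  convert cyl_Wt hτ (β + 2) (LP u) using 2
  · simp only [dr]; ring
  · simp only [zc, dr]; ring
  · ring_nf

lemma cyl_sq_far (hτ : 0 ≤ τ) (β : ℝ) (u : Sm n) {x : Eu n} (hx : τ + 2 < Real.log ‖x‖) :
    (cyl (dr n β + 2) (-zc n β) (Wt τ β u) * cyl (dr n β + 2) (-zc n β) (Wt τ β u)) x =
      Real.exp ((2 * β + 4) * Real.log ‖x‖) * LP u x ^ 2 := by
  rw [Sm.mul_apply, cyl_far hτ β u x hx, Wt_far hτ _ _ hx,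
    show (2 * β + 4) * Real.log ‖x‖ = (β + 2) * Real.log ‖x‖ + (β + 2) * Real.log ‖x‖ by ring,
    Real.exp_add]
  ring

lemma mul_cyl4_far (hτ : 0 ≤ τ) (β : ℝ) (u : Sm n) {x : Eu n} (hx : τ + 2 < Real.log ‖x‖) :
    (Wt τ β u * cyl4 (dr n β) (zc n β) (Wt τ β u)) x =
      Real.exp ((2 * β + 4) * Real.log ‖x‖) * (u x * LP (LP u) x) := by
  rw [Sm.mul_apply, cyl4_far hτ β u x hx, Wt_far hτ _ _ hx, Wt_far hτ _ _ hx,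
    show (2 * β + 4) * Real.log ‖x‖ = β * Real.log ‖x‖ + (β + 4) * Real.log ‖x‖ by ring,
    Real.exp_add]
  ring

lemma far_mem (hτ : 0 ≤ τ) {x : Eu n} (hx : τ + 2 < Real.log ‖x‖) :
    x ∈ {x : Eu n | Real.exp (τ + 1) < ‖x‖} :=
  (log_norm_lt_iff (by linarith)).1 (by linarith)

lemma Far.cyl4_eq (h : Far p a β τ u) {x : Eu n} (hx : τ + 2 < Real.log ‖x‖) :
    cyl4 (dr n β) (zc n β) (Wt τ β u) x = |Wt τ β u x| ^ (p - 1) * Wt τ β u x := by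
  have hx0 := norm_pos_of_log (by linarith [h.hτ]) hx
  rw [cyl4_far h.hτ β u x hx, Wt_far h.hτ _ _ hx, Wt_far h.hτ _ _ hx, h.adm.sol x (far_mem h.hτ hx),
    abs_mul, Real.mul_rpow (abs_nonneg _) (abs_nonneg _), Real.abs_exp, ← Real.exp_mul,
    rpow_eq_exp_log hx0, show (β + 4) * Real.log ‖x‖ = β * Real.log ‖x‖ * (p - 1) +
      (β * Real.log ‖x‖ - a * Real.log ‖x‖) by linear_combination (-Real.log ‖x‖) * h.hβ,
    Real.exp_add, Real.exp_sub]
  field_simp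

lemma Far.mul_cyl4_eq (h : Far p a β τ u) {x : Eu n} (hx : τ + 2 < Real.log ‖x‖) :
    (Wt τ β u * cyl4 (dr n β) (zc n β) (Wt τ β u)) x = |Wt τ β u x| ^ (p + 1) := by
  rw [Sm.mul_apply, h.cyl4_eq hx]
  rw [show p + 1 = (p - 1) + 2 by ring, Real.rpow_add_of_nonneg (abs_nonneg _) (by linarith [h.hp])
    (by norm_num), Real.rpow_two, sq_abs]
  ring

lemma Far.ub_source (h : Far p a β τ u) :
    UB (Wt τ β u * cyl4 (dr n β) (zc n β) (Wt τ β u)) := by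
  refine h.ub_energy.of_le (τ := τ + 2) (fun x hx => ?_) fun x hx => ?_
  · rw [h.mul_cyl4_eq hx]; positivity
  · rw [mul_cyl4_far h.hτ β u hx, enr, Wt_far h.hτ _ _ hx]
    simp only [Sm.add_apply, Sm.mul_apply]
    gcongr
    exact le_add_of_nonneg_right (mul_self_nonneg _)

lemma Far.ub_cyl_sq (h : Far p a β τ u) :
    UB (cyl (dr n β + 2) (-zc n β) (Wt τ β u) * cyl (dr n β + 2) (-zc n β) (Wt τ β u)) := by
  refine h.ub_energy.of_le (τ := τ + 2) (fun x hx => mul_self_nonneg _) fun x hx => ?_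
  rw [cyl_sq_far h.hτ β u hx, enr, Wt_far h.hτ _ _ hx]
  simp only [Sm.add_apply, Sm.mul_apply, sq]
  gcongr
  exact le_add_of_nonneg_left (h.adm.source_nonneg (far_mem h.hτ hx))

lemma Far.wb (h : Far p a β τ u) : WB (Wt τ β u) := by
  refine WB.of_cyl (dr n β + 2) (-zc n β) ?_ h.ub_cyl_sq
  refine (UB_one.add h.ub_source).of_le (τ := τ + 2) (fun x hx => mul_self_nonneg _) fun x hx => ?_
  rw [Sm.add_apply, Sm.one_apply, h.mul_cyl4_eq hx, Sm.mul_apply, ← abs_mul_abs_self, ← sq,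
    ← Real.rpow_two]
  set s := |Wt τ β u x|
  have hs : 0 ≤ s := abs_nonneg _
  have h2 : (2 : ℝ) ≤ p + 1 := by linarith [h.hp]
  rcases le_total s 1 with h1 | h1
  · exact (Real.rpow_le_one hs h1 (by norm_num)).trans (le_add_of_nonneg_right (by positivity))
  · exact (Real.rpow_le_rpow_of_exponent_le h1 h2).trans (le_add_of_nonneg_left zero_le_one)

lemma fderiv_abs_rpow {f : Sm n} {p : ℝ} (hp : 1 < p) (x v : Eu n) :
    fderiv ℝ (fun y => |f y| ^ (p + 1)) x v = (p + 1) * (|f x| ^ (p - 1) * f x) * fderiv ℝ f.1 x v := by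
  have h1 := hasDerivAt_abs_rpow (f x) (show 1 < p + 1 by linarith)
  have h2 := h1.comp_hasFDerivAt x (Sm.diff f x).hasFDerivAt
  have e : (fun t : ℝ => |t| ^ (p + 1)) ∘ f.1 = fun y => |f y| ^ (p + 1) := rfl
  rw [e] at h2
  rw [h2.fderiv]
  simp only [_root_.smul_apply, smul_eq_mul]
  rw [show p + 1 - 2 = p - 1 by ring]
  ring

lemma Far.DE_source (h : Far p a β τ u) : FE (τ + 2)
    (DE (Wt τ β u * cyl4 (dr n β) (zc n β) (Wt τ β u)))
    ((p + 1) • (DE (Wt τ β u) * cyl4 (dr n β) (zc n β) (Wt τ β u))) := fun x hx => by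
  set w := Wt τ β u
  have he : (w * cyl4 (dr n β) (zc n β) w).1 =ᶠ[𝓝 x] fun y => |w y| ^ (p + 1) := by
    filter_upwards [(isOpen_far (by linarith [h.hτ])).mem_nhds hx] with y hy
      using h.mul_cyl4_eq hy
  rw [DE_apply, he.fderiv_eq, fderiv_abs_rpow h.hp, Sm.smul_apply, Sm.mul_apply, h.cyl4_eq hx,
    DE_apply]
  ring

lemma Far.hdil (h : Far p a β τ u) :
    IB τ (DE (Wt τ β u) * cyl4 (dr n β) (zc n β) (Wt τ β u)) := by
  have hp := h.hp
  refine ((h.ub_source.IB_DE h.hτ).smul (1 / (p + 1))).congr h.hτ fun x hx => ?_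
  rw [Sm.smul_apply, h.DE_source x hx, Sm.smul_apply]
  field_simp

end

noncomputable section
open scoped ENNReal
variable {n : ℕ} {p a β τ : ℝ} {u f : Sm n} {X : ℝ → ℝ}

lemma deriv_exp_mul (h : ContDiff ℝ (⊤ : ℕ∞) X) (c : ℝ) :
    deriv (fun t => Real.exp (c * t) * X t) = fun t => Real.exp (c * t) * (deriv X t + c * X t) := by
  funext t
  have h1 := ((hasDerivAt_id t).const_mul c).exp
  simp only [id, mul_one] at h1
  refine (h1.mul (h.differentiable (by simp) t).hasDerivAt).deriv.trans ?_
  ring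

lemma qn_mul_LP (f : Sm n) : qn * LP f = LA f + DE (DE f) + ((n : ℝ) - 2) • DE f := by
  rw [LA]; abel

/-- The Laplacian of a function multiplied by a radial cutoff, in logarithmic polar coordinates. -/
lemma LP_rad_mul_apply (h : Rd X) (f : Sm n) (x : Eu n) :
    ‖x‖ ^ 2 * LP (rad X * f) x = X (Real.log ‖x‖) * (LA f x + DE (DE f) x + (n - 2) * DE f x) +
      (deriv (deriv X) (Real.log ‖x‖) + (n - 2) * deriv X (Real.log ‖x‖)) * f x +
        2 * deriv X (Real.log ‖x‖) * DE f x := by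
  have e := congrArg (fun g : Sm n => g x) (qn_mul_LP f)
  simp only [Sm.mul_apply, qn_apply, Sm.add_apply, Sm.smul_apply] at e
  have h2 : Rd fun t => deriv (deriv X) t + ((n : ℝ) - 2) * deriv X t :=
    h.deriv.deriv.add (h.deriv.mul' contDiff_const)
  have e2 := congrArg (fun g : Sm n => g x) (qn_rad (n := n) h2)
  have e3 := congrArg (fun g : Sm n => g x) (qn_rad (n := n) h.deriv)
  simp only [Sm.mul_apply, qn_apply, rad_apply h2, rad_apply h.deriv] at e2 e3
  rw [LP_mul, LP_rad h, Gm_rad h]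
  simp only [Sm.add_apply, Sm.mul_apply, Sm.smul_apply, rad_apply h]
  rw [← e, ← e2, ← e3]
  ring

/-- The boundary terms of the stability inequality tested with `plt τ T`. -/
def bdry (τ : ℝ) (P Q w : Sm n) (T : ℝ) : ℝ :=
  K (fun t => deriv (plt τ T) t * plt τ T t) ((2 : ℝ) • (P * Q)) +
    K (fun t => deriv (deriv (plt τ T)) t * plt τ T t) ((2 : ℝ) • (P * w)) +
    K (fun t => deriv (plt τ T) t * deriv (plt τ T) t) (Q * Q) +
    K (fun t => deriv (deriv (plt τ T)) t * deriv (plt τ T) t) ((2 : ℝ) • (Q * w)) +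
    K (fun t => deriv (deriv (plt τ T)) t * deriv (deriv (plt τ T)) t) (w * w)

lemma bdry_bd (hτ : 0 ≤ τ) {P Q w : Sm n} (hP : UB (P * P)) (hQ : UB (Q * Q)) (hw : UB (w * w)) :
    Bd (bdry τ P Q w) :=
  ((((deriv_plt_mul_bd hτ ((hP.mul hQ).smul 2)).add
    (deriv2_plt_mul_bd hτ ((hP.mul hw).smul 2))).add (deriv_plt_mul_deriv_bd hτ hQ)).add
    (deriv2_plt_mul_deriv_bd hτ ((hQ.mul hw).smul 2))).add (deriv2_plt_mul_deriv2_bd hτ hw)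

lemma square_expand (hτ : 0 ≤ τ) (P Q w L : Sm n) (hL : Cs L) (T : ℝ)
    (h : ∀ x, 1 < Real.log ‖x‖ → L x = Real.exp (-(n / 2) * Real.log ‖x‖) *
      (plt τ T (Real.log ‖x‖) * P x + deriv (plt τ T) (Real.log ‖x‖) * Q x +
        deriv (deriv (plt τ T)) (Real.log ‖x‖) * w x))
    (h0 : ∀ x, Real.log ‖x‖ ≤ 1 → L x = 0) :
    J L L = K (fun t => plt τ T t * plt τ T t) (P * P) + bdry τ P Q w T := by
  have w0 := plt_wn hτ T
  have s0 := w0.smooth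
  have s1 := w0.deriv.smooth
  have s2 := w0.deriv.deriv.smooth
  have w1 := w0.mul s0
  have w2 := w0.deriv.mul s0
  have w3 := w0.deriv.deriv.mul s0
  have w4 := w0.deriv.mul s1
  have w5 := w0.deriv.deriv.mul s1
  have w6 := w0.deriv.deriv.mul s2
  have hK : ∀ {X : ℝ → ℝ} (_ : Wn X) (f : Sm n),
      K X f = J (rad (fun t => Real.exp (-n * t) * X t) * f) 1 := fun hX f => by
    rw [K_def, J_eq_one (hX.exp _).cs]
  have c1 := (w1.exp (-n)).cs (n := n)
  have c2 := (w2.exp (-n)).cs (n := n)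
  have c3 := (w3.exp (-n)).cs (n := n)
  have c4 := (w4.exp (-n)).cs (n := n)
  have c5 := (w5.exp (-n)).cs (n := n)
  have c6 := (w6.exp (-n)).cs (n := n)
  rw [bdry, hK w1, hK w2, hK w3, hK w4, hK w5, hK w6, ← J_add (c2.mul _) (c3.mul _),
    ← J_add ((c2.mul _).add (c3.mul _)) (c4.mul _),
    ← J_add (((c2.mul _).add (c3.mul _)).add (c4.mul _)) (c5.mul _),
    ← J_add ((((c2.mul _).add (c3.mul _)).add (c4.mul _)).add (c5.mul _)) (c6.mul _),
    ← J_add (c1.mul _) (((((c2.mul _).add (c3.mul _)).add (c4.mul _)).add (c5.mul _)).add (c6.mul _)),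
    J_eq_one hL]
  congr 1
  congr 1
  ext x
  simp only [Sm.mul_apply, Sm.add_apply, Sm.smul_apply, rad_apply (w1.exp (-n)).toRd,
    rad_apply (w2.exp (-n)).toRd, rad_apply (w3.exp (-n)).toRd, rad_apply (w4.exp (-n)).toRd,
    rad_apply (w5.exp (-n)).toRd, rad_apply (w6.exp (-n)).toRd]
  rcases le_or_gt (Real.log ‖x‖) 1 with hx | hx
  · rw [h0 x hx, w0.zero _ hx, w0.deriv.zero _ hx, w0.deriv.deriv.zero _ hx]; ring
  · rw [h x hx, show -(n : ℝ) * Real.log ‖x‖ = -(n / 2) * Real.log ‖x‖ + -(n / 2) * Real.log ‖x‖ by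
      ring, Real.exp_add]
    ring

lemma Far.hstab (h : Far p a β τ u) (T : ℝ) :
    p * K (fun t => plt τ T t * plt τ T t) (Wt τ β u * cyl4 (dr n β) (zc n β) (Wt τ β u)) ≤
      K (fun t => plt τ T t * plt τ T t) (cyl 2 (-(n * (n - 4) / 4)) (Wt τ β u) *
        cyl 2 (-(n * (n - 4) / 4)) (Wt τ β u)) +
      bdry τ (cyl 2 (-(n * (n - 4) / 4)) (Wt τ β u)) ((2 : ℝ) • DE (Wt τ β u) + (2 : ℝ) • Wt τ β u)
        (Wt τ β u) T := by
  have hτ := h.hτ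
  set w := Wt τ β u with hw
  have w0 := plt_wn hτ T
  set η : Sm n := rad (fun t => Real.exp ((β - (n - 4) / 2) * t) * plt τ T t) with hη
  have hηw := w0.exp (β - ((n : ℝ) - 4) / 2)
  have hηx : ∀ x, η x = Real.exp ((β - (n - 4) / 2) * Real.log ‖x‖) * plt τ T (Real.log ‖x‖) :=
    fun x => rad_apply hηw.toRd x
  have hsupp : tsupport η.1 ⊆ {x : Eu n | Real.exp (τ + 1) < ‖x‖} := by
    have hcl : IsClosed {x : Eu n | Real.exp (τ + 2) ≤ ‖x‖} :=
      isClosed_le continuous_const continuous_norm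
    refine (closure_minimal (fun x hx => ?_) hcl).trans fun x (hx : Real.exp (τ + 2) ≤ ‖x‖) =>
      lt_of_lt_of_le (Real.exp_lt_exp.2 (by linarith)) hx
    have h1 : η x ≠ 0 := hx
    rw [hηx] at h1
    exact ((log_norm_lt_iff (by linarith)).1 (plt_far (right_ne_zero_of_mul h1))).le
  have hs := h.adm.stab_mul hηw.cs hsupp
  have wz := w0.exp (-(((n : ℝ) - 4) / 2))
  have e1 : u * η = rad (fun t => Real.exp (-((n - 4) / 2) * t) * plt τ T t) * w := by
    ext x
    rw [Sm.mul_apply, Sm.mul_apply, hηx, rad_apply wz.toRd]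
    by_cases h0 : plt τ T (Real.log ‖x‖) = 0
    · rw [h0]; ring
    · rw [hw, Wt_far hτ _ _ (plt_far h0), show (β - ((n : ℝ) - 4) / 2) * Real.log ‖x‖ =
        β * Real.log ‖x‖ + -((n - 4) / 2) * Real.log ‖x‖ by ring, Real.exp_add]
      ring
  have e2 : K (fun t => plt τ T t * plt τ T t) (w * cyl4 (dr n β) (zc n β) w) =
      J (η * η) (u * LP (LP u)) := by
    rw [K_def]
    refine J_congr ((plt_sq_wn hτ T).exp _).cs (hηw.cs.mul _) fun x => ?_
    rw [rad_apply ((plt_sq_wn hτ T).exp _).toRd, Sm.mul_apply η η, hηx]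
    by_cases h0 : plt τ T (Real.log ‖x‖) = 0
    · rw [h0]; ring
    · rw [mul_cyl4_far hτ β u (plt_far h0), Sm.mul_apply,
        show (2 * β + 4) * Real.log ‖x‖ = (β - ((n : ℝ) - 4) / 2) * Real.log ‖x‖ +
          (β - ((n : ℝ) - 4) / 2) * Real.log ‖x‖ + n * Real.log ‖x‖ by ring, Real.exp_add,
        Real.exp_add, neg_mul, Real.exp_neg]
      have := Real.exp_ne_zero (n * Real.log ‖x‖)
      field_simp
  have hL : Cs (LP (u * η)) := (hηw.cs.mul' u).LP
  have hD : deriv (fun t => Real.exp (-(((n : ℝ) - 4) / 2) * t) * plt τ T t) = fun t =>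
      Real.exp (-(((n : ℝ) - 4) / 2) * t) * (deriv (plt τ T) t + -(((n : ℝ) - 4) / 2) * plt τ T t) :=
    deriv_exp_mul w0.smooth _
  have hsm : ContDiff ℝ (⊤ : ℕ∞) fun t => deriv (plt τ T) t + -(((n : ℝ) - 4) / 2) * plt τ T t :=
    w0.deriv.smooth.add (contDiff_const.mul w0.smooth)
  have hD2 : ∀ t, deriv (fun t => deriv (plt τ T) t + -(((n : ℝ) - 4) / 2) * plt τ T t) t =
      deriv (deriv (plt τ T)) t + -(((n : ℝ) - 4) / 2) * deriv (plt τ T) t := fun t =>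
    (((w0.deriv.diff t).hasDerivAt).add (((w0.diff t).hasDerivAt).const_mul _)).deriv
  have e3 := square_expand hτ (cyl 2 (-(n * (n - 4) / 4)) w) ((2 : ℝ) • DE w + (2 : ℝ) • w) w
    (LP (u * η)) hL T (fun x hx => ?_) (fun x hx => ?_)
  · rw [e2, ← e3]
    exact hs
  · have hx0 := norm_pos_of_log zero_le_one hx
    have := LP_rad_mul_apply wz.toRd w x
    rw [hD, deriv_exp_mul hsm] at this
    simp only [hD2] at this
    rw [e1]
    have hx2 : ‖x‖ ^ 2 ≠ 0 := (pow_pos hx0 2).ne'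
    have e5 : Real.exp (-((n : ℝ) / 2) * Real.log ‖x‖) * ‖x‖ ^ 2 =
        Real.exp (-((n - 4) / 2) * Real.log ‖x‖) := by
      rw [show -(((n : ℝ) - 4) / 2) * Real.log ‖x‖ = -(n / 2) * Real.log ‖x‖ +
        (Real.log ‖x‖ + Real.log ‖x‖) by ring, Real.exp_add, Real.exp_add, Real.exp_log hx0]
      ring
    apply mul_left_cancel₀ hx2
    rw [this, ← e5]
    simp only [cyl, Sm.add_apply, Sm.smul_apply]
    ring
  · have hc : (u * η).1 =ᶠ[𝓝 x] (0 : Sm n).1 := by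
      have hx' : ‖x‖ < Real.exp (τ + 2) := by
        by_contra h1
        have h2 : Real.log ‖x‖ < τ + 2 := by linarith
        have h3 := Real.log_le_log (Real.exp_pos _) (not_lt.1 h1)
        rw [Real.log_exp] at h3
        linarith
      filter_upwards [(isOpen_lt continuous_norm continuous_const).mem_nhds hx'] with y hy
      have : plt τ T (Real.log ‖y‖) = 0 := by
        by_contra h0
        have := (log_norm_lt_iff (by linarith)).1 (plt_far h0)
        linarith [show ‖y‖ < Real.exp (τ + 2) from hy]
      change u y * η y = 0
      rw [hηx, this]; ring
    rw [← lap_eq]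
    have h4 : lap n (u * η).1 x = lap n (0 : Sm n).1 x := by
      rw [lap_eq, lap_eq]
      simp only [LP, Sm.sum_apply]
      refine Finset.sum_congr rfl fun i _ => Der_congr_at ?_
      filter_upwards [hc.eventually_nhds] with y hy using Der_congr_at hy
    rw [h4, lap_eq]
    simp [LP]

end

noncomputable section
open scoped ENNReal
variable {n : ℕ} {p a β τ : ℝ} {u f g : Sm n} {X : ℝ → ℝ} {b : ℝ}

lemma WB.cyl_sq {w : Sm n} (h : WB w) (c d : ℝ) : UB (cyl c d w * cyl c d w) :=
  ((h.h22.sq_add (h.h11.sq_smul c)).sq_add h.hLL).sq_add (h.h00.sq_smul d)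

theorem Far.square_integrable (h : Far p a β τ u) (hn : 5 ≤ n) (hm : 0 ≤ dr n β)
    (hκ : (n : ℝ) * (n - 4) / 2 < p * (2 * zc n β + 2 * dr n β))
    (hκ2 : (n : ℝ) ^ 2 * (n - 4) ^ 2 / 16 < p * (zc n β * (zc n β + 2 * dr n β))) :
    IB τ (Wt τ β u * Wt τ β u) := by
  have hn' : (5 : ℝ) ≤ n := by exact_mod_cast hn
  have hβ := h.β_pos
  have hw := h.wb
  refine hw.square_integrable (m := dr n β) (μ := zc n β) (κ := n * (n - 4) / 4)
    h.hτ h.hp hm ?_ (by linarith) (by linarith) (fun h0 => ?_) h.hdil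
    (bdry_bd h.hτ (hw.cyl_sq _ _) ((hw.h11.sq_smul _).sq_add (hw.h00.sq_smul _)) hw.h00) h.hstab
  · have h1 : β ≤ ((n : ℝ) - 4) / 2 := by simp only [dr] at hm; linarith
    rw [ell1_eq]
    have : 0 < (β + 2) * (n - 4 - β) := mul_pos (by linarith) (by linarith)
    have : 0 < β * (n - 2 - β) := mul_pos (by linarith) (by linarith)
    linarith
  · have h1 : β = ((n : ℝ) - 4) / 2 := by simp only [dr] at h0; linarith
    simp only [zc, h1]; ring

lemma pohozaev {η : Sm n} (hη : Cs η) (hp : p + 1 ≠ 0)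
    (hG : (p + 1) • (LP (LP u) * DE u) = DE (u * LP (LP u)) - a • (u * LP (LP u))) :
    (((n : ℝ) - 4) / 2 - (n + a) / (p + 1)) * J η (u * LP (LP u)) =
      1 / (p + 1) * J (DE η) (u * LP (LP u)) - 1 / 2 * J (DE η) (LP u * LP u) +
        (J (LP η) (DE u * LP u) + 2 * J (Gm η (DE u)) (LP u)) +
        ((n : ℝ) - 4) / 2 * (J (LP η) (u * LP u) + 2 * J (Gm η u) (LP u)) := by
  set V := LP u with hV
  have hA : J η (DE u * LP V) = (2 - (n : ℝ) / 2) * J η (V * V) - 1 / 2 * J (DE η) (V * V) +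
      (J (LP η) (DE u * V) + 2 * J (Gm η (DE u)) V) := by
    have e1 : J η (DE (V * V)) = -(J (DE η) (V * V) + n * J η (V * V)) := by
      rw [J_DE hη, J_add hη.DE (hη.smul _), J_smul hη]
    have e2 : J η (DE (V * V)) = 2 * J η (V * DE V) := by
      rw [DE_mul, mul_comm (DE V), ← two_smul ℝ, map_smul, smul_eq_mul]
    have e3 : J (LP (η * DE u)) V = J η (V * DE V) + 2 * J η (V * V) + J (LP η) (DE u * V) +
        2 * J (Gm η (DE u)) V := by
      rw [LP_mul, LP_DE, J_add ((hη.mul _).add (hη.LP.mul' _)) ((hη.Gm _).smul _),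
        J_add (hη.mul _) (hη.LP.mul' _), J_smul (hη.Gm _), ← J_mul hη, mul_comm (DE u) (LP η),
        ← J_mul hη.LP, add_mul, map_add, mul_comm (DE V), smul_mul_assoc, map_smul, smul_eq_mul]
    rw [J_mul hη, J_LP (hη.mul _), e3]
    linarith
  have hB : J η (u * LP V) = J η (V * V) + J (LP η) (u * V) + 2 * J (Gm η u) V := by
    rw [J_mul hη, J_LP (hη.mul _), LP_mul, J_add ((hη.mul _).add (hη.LP.mul' _)) ((hη.Gm _).smul _),
        J_add (hη.mul _) (hη.LP.mul' _), J_smul (hη.Gm _), ← J_mul hη, mul_comm u (LP η),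
        ← J_mul hη.LP]
  have hC := congrArg (J η) hG
  rw [map_smul, map_sub, map_smul, J_DE hη, J_add hη.DE (hη.smul _), J_smul hη, smul_eq_mul,
    smul_eq_mul, mul_comm (LP V)] at hC
  have hC' : J η (DE u * LP V) = (-(J (DE η) (u * LP V) + n * J η (u * LP V)) -
      a * J η (u * LP V)) / (p + 1) := by
    rw [eq_div_iff hp]; linarith
  rw [hC'] at hA
  have : (((n : ℝ) - 4) / 2 - (n + a) / (p + 1)) * J η (u * LP V) =
    ((n : ℝ) - 4) / 2 * J η (u * LP V) + (-(J (DE η) (u * LP V) + n * J η (u * LP V)) -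
      a * J η (u * LP V)) / (p + 1) + 1 / (p + 1) * J (DE η) (u * LP V) := by ring
  rw [this, hA, hB]
  ring

lemma UB.weighted_decay (hX : Cc b X) (hg : UB g) {c m σ : ℝ}
    (hf : ∀ x, σ < Real.log ‖x‖ → f x = Real.exp ((m - n + c) * Real.log ‖x‖) * g x) :
    Bd fun T => Real.exp (-m * T) * J (rad fun t => Real.exp (-c * t) * sh T X t) f := by
  have hY : Cc b fun s => X s * Real.exp (m * s) := hX.mul (exp_smooth m)
  refine (hg b _ hY).congr (max (b + 2) (b + σ + 1)) fun T hT => ?_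
  have hT1 := (le_max_left _ _).trans hT
  have hT2 := (le_max_right _ _).trans hT
  have w1 := (hX.wn (T := T) (by linarith)).exp (-c)
  have w2 := (hY.wn (T := T) (by linarith)).exp (-n)
  rw [K_def, ← J_smul w1.cs]
  refine J_congr (w1.cs.smul _) w2.cs fun x => ?_
  rw [Sm.smul_apply, rad_apply w1.toRd, rad_apply w2.toRd]
  by_cases h0 : sh T X (Real.log ‖x‖) = 0
  · simp only [sh] at h0 ⊢
    rw [h0]; ring
  · rw [hf x (hX.far hT2 h0)]
    simp only [sh]
    have : Real.exp (-n * Real.log ‖x‖) * Real.exp (m * (Real.log ‖x‖ - T)) =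
        Real.exp (-m * T) * (Real.exp (-c * Real.log ‖x‖) *
          Real.exp ((m - n + c) * Real.log ‖x‖)) := by
      rw [← Real.exp_add, ← Real.exp_add, ← Real.exp_add]; ring_nf
    linear_combination (-X (Real.log ‖x‖ - T) * g x) * this

/-- The cutoff equal to one up to logarithmic radius `T + 2`. -/
def cut (T : ℝ) : Sm n := 1 - rad (sh T stp)

lemma sh_stp_rd {T : ℝ} (hT : 0 ≤ T) : Rd (sh T stp) :=
  ⟨sh_smooth stp_smooth T, fun t ht => stp_zero (by linarith)⟩

lemma cut_apply {T : ℝ} (hT : 0 ≤ T) (x : Eu n) : (cut T : Sm n) x = 1 - stp (Real.log ‖x‖ - T) := by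
  rw [cut, Sm.sub_apply, Sm.one_apply, rad_apply (sh_stp_rd hT)]; rfl

lemma cut_cs {T : ℝ} (hT : 0 ≤ T) : Cs (cut T : Sm n) := by
  refine HasCompactSupport.intro (isCompact_closedBall (0 : Eu n) (Real.exp (T + 3))) fun x hx => ?_
  rw [mem_closedBall_zero_iff, not_le] at hx
  rw [cut_apply hT, stp_one (by linarith [(log_norm_lt_iff (by linarith)).2 hx]), sub_self]

lemma pd_cut (T : ℝ) (i : Fin n) : pd i (cut T) = -pd i (rad (sh T stp) : Sm n) := by
  rw [cut, map_sub, Derivation.map_one_eq_zero, zero_sub]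

lemma LP_cut (T : ℝ) : LP (cut T) = -LP (rad (sh T stp) : Sm n) := by
  simp [LP, pd_cut]

lemma Gm_cut (T : ℝ) (f : Sm n) : Gm (cut T) f = -Gm (rad (sh T stp)) f := by
  simp only [Gm, pd_cut]
  ext x
  simp only [Sm.neg_apply, Sm.sum_apply, Sm.mul_apply, neg_mul, Finset.sum_neg_distrib]

lemma DE_cut (T : ℝ) : DE (cut T) = -DE (rad (sh T stp) : Sm n) := by
  rw [cut, DE_sub, DE, Derivation.map_one_eq_zero, zero_sub]

lemma stp_deriv_cc : Cc 3 (deriv stp) where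
  smooth := smooth_deriv stp_smooth
  zero t ht := by
    rcases lt_abs.1 ht with h | h
    · exact deriv_stp_zero' h.le
    · exact deriv_stp_zero (by linarith)

lemma Bd.neg {φ : ℝ → ℝ} (h : Bd φ) : Bd fun T => -φ T := by
  simpa using h.const_mul (-1)

theorem Far.source_zero (h : Far p a β τ u) (hm : dr n β < 0)
    (hsol : ∀ x, LP (LP u) x = ‖x‖ ^ a * |u x| ^ (p - 1) * u x) (x : Eu n) :
    (u * LP (LP u)) x = 0 := by
  have hp := h.hp
  have ha := h.ha
  have hτ := h.hτ
  have hβ := h.β_pos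
  set w := Wt τ β u with hwd
  have hw : WB w := h.wb
  set G := u * LP (LP u) with hG
  have hGx : ∀ x, G x = ‖x‖ ^ a * |u x| ^ (p + 1) := fun x => by
    rw [hG, Sm.mul_apply, hsol, show p + 1 = (p - 1) + 2 by ring,
      Real.rpow_add_of_nonneg (abs_nonneg _) (by linarith) (by norm_num), Real.rpow_two, sq_abs]
    ring
  have hG0 : ∀ x, 0 ≤ G x := fun x => by rw [hGx]; positivity
  -- homogeneity of the weight
  have hDG : (p + 1) • (LP (LP u) * DE u) = DE G - a • G := by
    ext x
    simp only [Sm.smul_apply, Sm.sub_apply, Sm.mul_apply]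
    rcases eq_or_ne x 0 with rfl | hx
    · rw [DE_apply, DE_apply, map_zero, map_zero, hGx]
      rcases ha.eq_or_lt with rfl | ha'
      · simp
      · rw [norm_zero, Real.zero_rpow ha'.ne']; simp
    have hx0 : ‖x‖ ≠ 0 := norm_ne_zero_iff.2 hx
    have e : G.1 = fun y => ‖y‖ ^ a * |u y| ^ (p + 1) := funext hGx
    have h1 : HasFDerivAt (fun y : Eu n => ‖y‖) (fderiv ℝ (fun y : Eu n => ‖y‖) x) x :=
      ((contDiffAt_norm ℝ hx).differentiableAt one_ne_zero).hasFDerivAt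
    have h1' : fderiv ℝ (fun y : Eu n => ‖y‖) x x = ‖x‖ := by
      exact h1.differentiableAt.fderiv_norm_self
    have h2 := h1.rpow_const (p := a) (Or.inl hx0)
    have hu1 := hasDerivAt_abs_rpow (u x) (show 1 < p + 1 by linarith)
    have h3 : HasFDerivAt (fun y => |u y| ^ (p + 1)) _ x :=
      hu1.comp_hasFDerivAt x (Sm.diff u x).hasFDerivAt
    have h4 := h2.mul h3
    rw [DE_apply G, e]
    erw [h4.fderiv]
    simp only [_root_.add_apply, _root_.smul_apply, smul_eq_mul, h1']
    rw [hsol, DE_apply, show p + 1 - 2 = p - 1 by ring]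
    have : ‖x‖ ^ (a - 1) * ‖x‖ = ‖x‖ ^ a := by
      rw [← Real.rpow_add_one hx0, sub_add_cancel]
    linear_combination (-a * |u x| ^ (p + 1)) * this
  -- the factors in logarithmic coordinates
  set m := dr n β with hmd
  set P := cyl (m + 2) (-zc n β) w with hP
  set A1 := DE w + (-β) • w with hA1
  set A2 := DE (DE w) + ((-(2 * β)) • DE w + (β ^ 2) • w) with hA2
  have hσ : 0 ≤ τ + 2 := by linarith
  have eV : ∀ x, τ + 2 < Real.log ‖x‖ → Real.exp ((β + 2) * Real.log ‖x‖) * LP u x = P x :=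
    fun x hx => by rw [hP, hmd, hwd, cyl_far hτ β u x hx, Wt_far hτ _ _ hx]
  have e0 : ∀ x, τ + 2 < Real.log ‖x‖ → Real.exp (β * Real.log ‖x‖) * u x = w x :=
    fun x hx => by rw [hwd, Wt_far hτ _ _ hx]
  have e1 : ∀ x, τ + 2 < Real.log ‖x‖ → Real.exp (β * Real.log ‖x‖) * DE u x = A1 x :=
    fun x hx => by
      rw [hA1, Sm.add_apply, Sm.smul_apply, hwd, DE_Wt hτ β u x hx, Sm.add_apply, Sm.smul_apply,
        Wt_far hτ β (DE u) hx]; ring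
  have e2 : ∀ x, τ + 2 < Real.log ‖x‖ → Real.exp (β * Real.log ‖x‖) * DE (DE u) x = A2 x :=
    fun x hx => by
      have h1 := DE_Wt hτ β u
      have h2 := (h1.DE hσ) x hx
      rw [DE_add, DE_smul, Sm.add_apply, Sm.smul_apply, h1 x hx, DE_Wt hτ β (DE u) x hx] at h2
      simp only [hA2, Sm.add_apply, Sm.smul_apply, hwd, h2, h1 x hx, Wt_far hτ β (DE (DE u)) hx]
      ring
  have split : ∀ {f A : Sm n}, (∀ x, τ + 2 < Real.log ‖x‖ → Real.exp (β * Real.log ‖x‖) * f x = A x) →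
      ∀ x, τ + 2 < Real.log ‖x‖ → (f * LP u) x =
        Real.exp ((m - n + 2) * Real.log ‖x‖) * (A * P) x := fun {f A} he x hx => by
    rw [Sm.mul_apply, Sm.mul_apply, ← he x hx, ← eV x hx, hmd, dr,
      show ((n : ℝ) - 4 - 2 * β - n + 2) * Real.log ‖x‖ = -(β * Real.log ‖x‖) +
        -((β + 2) * Real.log ‖x‖) by ring, Real.exp_add, Real.exp_neg, Real.exp_neg]
    have := Real.exp_ne_zero (β * Real.log ‖x‖)
    have := Real.exp_ne_zero ((β + 2) * Real.log ‖x‖)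
    field_simp
  have hPP : UB (P * P) := hw.cyl_sq _ _
  have u0 : UB (w * P) := hw.h00.mul hPP
  have u1 : UB (A1 * P) := (hw.h11.sq_add (hw.h00.sq_smul _)).mul hPP
  have u2 : UB (A2 * P) :=
    (hw.h22.sq_add ((hw.h11.sq_smul _).sq_add (hw.h00.sq_smul _))).mul hPP
  have hc1 := stp_deriv_cc
  have hc2 : Cc 3 fun t => deriv (deriv stp) t + ((n : ℝ) - 2) * deriv stp t :=
    ⟨hc1.deriv.smooth.add (contDiff_const.mul hc1.smooth), fun t ht => by
      rw [hc1.zero t ht, hc1.deriv.zero t ht]; simp⟩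
  -- boundary terms
  have hw1 : ∀ {T : ℝ}, 4 < T → Wn (sh T (deriv stp)) := fun hT => hc1.wn (by linarith)
  have dDE : ∀ T > 4, ∀ f : Sm n, J (DE (cut T)) f =
      -J (rad fun t => Real.exp (-0 * t) * sh T (deriv stp) t) f := fun T hT f => by
    rw [DE_cut, DE_rad (sh_stp_rd (by linarith)), deriv_sh, J_neg (hw1 hT).cs,
      neg_zero]
    simp only [zero_mul, Real.exp_zero, one_mul]
  have dGm : ∀ T > 4, ∀ f g : Sm n, J (Gm (cut T) f) g =
      -J (rad fun t => Real.exp (-2 * t) * sh T (deriv stp) t) (DE f * g) := fun T hT f g => by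
    rw [Gm_cut, Gm_rad (sh_stp_rd (by linarith)), deriv_sh, J_neg (((hw1 hT).exp _).cs.mul _),
      J_mul ((hw1 hT).exp _).cs]
  have dLP : ∀ T > 4, ∀ f : Sm n, J (LP (cut T)) f =
      -J (rad fun t => Real.exp (-2 * t) *
        sh T (fun t => deriv (deriv stp) t + ((n : ℝ) - 2) * deriv stp t) t) f := fun T hT f => by
    rw [LP_cut, LP_rad (sh_stp_rd (by linarith)), deriv_sh, deriv_sh]
    change J (-rad fun t => Real.exp (-2 * t) *
        sh T (fun t => deriv (deriv stp) t + ((n : ℝ) - 2) * deriv stp t) t) f = _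
    rw [J_neg ((hc2.wn (T := T) (by linarith)).exp (-2)).cs]
  have hexp : dr n β - n + 0 + (2 * β + 4) = 0 := by rw [dr]; ring
  have b1 : Bd fun T => Real.exp (-m * T) * J (DE (cut T)) G :=
    (UB.weighted_decay (f := G) (σ := τ + 2) (c := 0) (m := m) hc1 h.ub_source fun x hx => by
      rw [mul_cyl4_far hτ β u hx, ← mul_assoc, ← Real.exp_add, ← add_mul, hexp, zero_mul,
        Real.exp_zero, one_mul, hG, Sm.mul_apply]).neg.congr 5 fun T hT => by rw [dDE T (by linarith)]; ring
  have b2 : Bd fun T => Real.exp (-m * T) * J (DE (cut T)) (LP u * LP u) :=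
    (UB.weighted_decay (f := LP u * LP u) (σ := τ + 2) (c := 0) (m := m) hc1 hPP fun x hx => by
      rw [hP, hmd, hwd, cyl_sq_far hτ β u hx, ← mul_assoc, ← Real.exp_add, ← add_mul, hexp,
        zero_mul, Real.exp_zero, one_mul, Sm.mul_apply, sq]).neg.congr 5 fun T hT => by rw [dDE T (by linarith)]; ring
  have b3 : Bd fun T => Real.exp (-m * T) * J (LP (cut T)) (DE u * LP u) :=
    (UB.weighted_decay (σ := τ + 2) hc2 u1 (split e1)).neg.congr 5 fun T hT => by
      rw [dLP T (by linarith)]; ring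
  have b4 : Bd fun T => Real.exp (-m * T) * J (Gm (cut T) (DE u)) (LP u) :=
    (UB.weighted_decay (σ := τ + 2) hc1 u2 (split e2)).neg.congr 5 fun T hT => by
      rw [dGm T (by linarith)]; ring
  have b5 : Bd fun T => Real.exp (-m * T) * J (LP (cut T)) (u * LP u) :=
    (UB.weighted_decay (σ := τ + 2) hc2 u0 (split e0)).neg.congr 5 fun T hT => by
      rw [dLP T (by linarith)]; ring
  have b6 : Bd fun T => Real.exp (-m * T) * J (Gm (cut T) u) (LP u) :=
    (UB.weighted_decay (σ := τ + 2) hc1 u1 (split e1)).neg.congr 5 fun T hT => by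
      rw [dGm T (by linarith)]; ring
  set κ := ((n : ℝ) - 4) / 2 - (n + a) / (p + 1) with hκ
  have hκ0 : κ ≠ 0 := by
    have h1 : ((n : ℝ) - 4) * (p - 1) < 2 * (4 + a) := by
      rw [hmd, dr] at hm
      nlinarith [h.hβ]
    have : κ < 0 := by
      rw [hκ, sub_neg, div_lt_div_iff₀ (by norm_num) (by linarith)]
      linarith
    exact this.ne
  have hB : Bd fun T => Real.exp (-m * T) * J (cut T) G := by
    refine ((((b1.const_mul (1 / (p + 1))).add (b2.const_mul (-(1 / 2)))).add
      (b3.add (b4.const_mul 2))).add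
      ((b5.add (b6.const_mul 2)).const_mul (((n : ℝ) - 4) / 2))).const_mul κ⁻¹ |>.congr 5
      fun T hT => ?_
    have hpz := pohozaev (cut_cs (n := n) (show 0 ≤ T by linarith)) (by linarith) hDG
    rw [← hκ] at hpz
    rw [eq_inv_mul_iff_mul_eq₀ hκ0]
    linear_combination Real.exp (-m * T) * hpz
  obtain ⟨C, T₁, hC⟩ := hB
  set T₀ := max 0 (Real.log ‖x‖) with hT₀
  have hT₀0 : 0 ≤ T₀ := le_max_left _ _
  have hle : ∀ T ≥ T₀, J (cut T₀) G ≤ J (cut T) G := fun T hT => by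
    refine J_mono (cut_cs hT₀0) (cut_cs (hT₀0.trans hT)) fun y => ?_
    rw [cut_apply hT₀0, cut_apply (hT₀0.trans hT)]
    have := stp_mono (show Real.log ‖y‖ - T ≤ Real.log ‖y‖ - T₀ by linarith)
    exact mul_le_mul_of_nonneg_right (by linarith) (hG0 y)
  have hlim : Tendsto (fun T => C * Real.exp (m * T)) atTop (𝓝 (C * 0)) := by
    refine (Real.tendsto_exp_atBot.comp ?_).const_mul C
    exact tendsto_id.const_mul_atTop_of_neg hm
  have hJ : J (cut T₀) G ≤ 0 := by
    rw [← mul_zero C]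
    refine ge_of_tendsto hlim ?_
    filter_upwards [eventually_ge_atTop T₀, eventually_ge_atTop T₁] with T hT hT'
    have h1 := (le_abs_self _).trans (hC T hT')
    have h2 : Real.exp (m * T) * Real.exp (-m * T) = 1 := by
      rw [← Real.exp_add]; ring_nf; simp
    calc J (cut T₀) G ≤ J (cut T) G := hle T hT
      _ = Real.exp (m * T) * (Real.exp (-m * T) * J (cut T) G) := by
        rw [← mul_assoc, h2, one_mul]
      _ ≤ Real.exp (m * T) * C := by gcongr
      _ = _ := mul_comm _ _
  by_contra hx
  have hcut0 : ∀ y, 0 ≤ (cut T₀ : Sm n) y := fun y => by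
    rw [cut_apply hT₀0]; linarith [stp_le_one (Real.log ‖y‖ - T₀)]
  have hpos : 0 < ∫ y, (cut T₀ * G : Sm n) y := by
    refine Continuous.integral_pos_of_hasCompactSupport_nonneg_nonzero (Sm.cont _)
      ((cut_cs hT₀0).mul G) (fun y => mul_nonneg (hcut0 y) (hG0 y)) (x := x) ?_
    rw [Sm.mul_apply, cut_apply hT₀0, stp_zero (by linarith [le_max_right 0 (Real.log ‖x‖)]),
      sub_zero, one_mul]
    exact hx
  rw [J_apply (cut_cs hT₀0)] at hJ
  exact absurd hJ (not_le.2 hpos)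

end

noncomputable section
open scoped ENNReal
variable {n : ℕ} {p a β τ : ℝ} {u f g : Sm n}

lemma Dm_smul (k : ℕ) (m : Fin k → Eu n) (c : ℝ) (f : Sm n) : Dm k m (c • f) = c • Dm k m f := by
  induction k with
  | zero => rfl
  | succ k ih => simp only [Dm]; rw [ih, Dh_smul]

lemma iteratedFDeriv_smul_aff (c : ℝ) (y : Eu n) (r : ℝ) (f : Sm n) (k : ℕ) :
    iteratedFDeriv ℝ k (c • aff y r f).1 0 = (c * r ^ k) • iteratedFDeriv ℝ k f.1 y := by
  ext m
  rw [← Dm_apply, _root_.smul_apply, ← Dm_apply, Dm_smul, Dm_aff]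
  simp only [Sm.smul_apply, aff_apply, smul_zero, add_zero, smul_eq_mul]
  ring

lemma plt_le_one (τ T t : ℝ) : plt τ T t ≤ 1 :=
  mul_le_one₀ (stp_le_one _) (by linarith [stp_le_one (t - T), show sh T stp t = stp (t - T) from rfl])
    (by linarith [stp_nonneg (t - T), show sh T stp t = stp (t - T) from rfl])

lemma plt_near {τ T t : ℝ} (h : plt τ T t ≠ 0) : t ≤ T + 3 := by
  by_contra hlt
  exact h (by rw [plt, sh, sh, stp_one (t := t - T) (by linarith), sub_self, mul_zero])

lemma plt_one {τ T t : ℝ} (h : τ + 3 ≤ t) (h' : t ≤ T + 2) : plt τ T t = 1 := by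
  rw [plt, sh, sh, stp_one (by linarith), stp_zero (by linarith)]; norm_num

lemma norm_add_smul_mem {x z : Eu n} {R : ℝ} (hR : 0 < R) (hx : ‖x‖ = 2 * R)
    (hz : z ∈ ball (0 : Eu n) 1) : R < ‖x + R • z‖ ∧ ‖x + R • z‖ < 3 * R := by
  rw [mem_ball_zero_iff] at hz
  have h1 : ‖R • z‖ < R := by
    rw [norm_smul, Real.norm_of_nonneg hR.le]
    exact mul_lt_of_lt_one_right hR hz
  have h2 := norm_add_le x (R • z)
  have h3 := norm_sub_le_norm_add x (R • z)
  constructor <;> linarith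

/-- The rescaled `L²` norm on a ball is controlled by a logarithmic window. -/
lemma Far.window (h : Far p a β τ u) {x : Eu n} {T : ℝ} (hT : τ + 3 ≤ T)
    (hx : ‖x‖ = 2 * Real.exp (T + 4)) :
    ∫ z in ball (0 : Eu n) 1, (Real.exp (T + 4) ^ β • aff x (Real.exp (T + 4)) u) z ^ 2 ≤
      3 ^ n * K (plt (T + 1) (T + 4)) (Wt τ β u * Wt τ β u) := by
  have hτ := h.hτ
  set R := Real.exp (T + 4) with hRd
  have hR : 0 < R := Real.exp_pos _
  set w := Wt τ β u with hw
  have hY := plt_wn (τ := T + 1) (by linarith) (T + 4)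
  set ρ : Sm n := rad (fun t => Real.exp (-n * t) * plt (T + 1) (T + 4) t) with hρ
  have hcs : Cs ρ := (hY.exp _).cs
  set g : Sm n := ρ * (w * w) with hg
  have hgv : ∀ y, g y = Real.exp (-n * Real.log ‖y‖) * plt (T + 1) (T + 4) (Real.log ‖y‖) * w y ^ 2 :=
    fun y => by
      rw [hg, Sm.mul_apply, Sm.mul_apply, hρ, rad_apply (hY.exp _).toRd, sq]
  have hg0 : ∀ y, 0 ≤ g y := fun y => by
    rw [hgv]
    have := plt_nonneg (T + 1) (T + 4) (Real.log ‖y‖)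
    positivity
  have hpt : ∀ z ∈ ball (0 : Eu n) 1, (R ^ β • aff x R u) z ^ 2 ≤ (3 * R) ^ n * aff x R g z := by
    intro z hz
    obtain ⟨h1, h2⟩ := norm_add_smul_mem hR hx hz
    set y := x + R • z with hy
    have hy0 : 0 < ‖y‖ := hR.trans h1
    have l1 : T + 4 < Real.log ‖y‖ := (Real.lt_log_iff_exp_lt hy0).2 h1
    have l2 : Real.log ‖y‖ ≤ T + 6 := by
      refine (Real.log_le_log hy0 h2.le).trans ?_
      rw [Real.log_mul (by norm_num) hR.ne', hRd, Real.log_exp]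
      have : Real.log 3 ≤ 3 - 1 := Real.log_le_sub_one_of_pos (by norm_num)
      linarith
    rw [Sm.smul_apply, aff_apply, aff_apply, ← hy, hgv, plt_one (by linarith) (by linarith), hw,
      Wt_far hτ β u (by linarith), mul_comm β, mul_comm (-(n : ℝ)),
      Real.exp_mul, Real.exp_mul, Real.exp_log hy0, Real.rpow_neg hy0.le, Real.rpow_natCast, mul_one, mul_pow, mul_pow]
    have e1 : (R ^ β) ^ 2 ≤ (‖y‖ ^ β) ^ 2 := by
      have := Real.rpow_le_rpow hR.le h1.le h.β_pos.le
      gcongr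
    have e2 : 1 ≤ (3 * R) ^ n * (‖y‖ ^ n)⁻¹ := by
      rw [← div_eq_mul_inv, one_le_div (by positivity)]
      gcongr
    calc (R ^ β) ^ 2 * u y ^ 2 ≤ 1 * ((‖y‖ ^ β) ^ 2 * u y ^ 2) := by
          rw [one_mul]; gcongr
      _ ≤ ((3 * R) ^ n * (‖y‖ ^ n)⁻¹) * ((‖y‖ ^ β) ^ 2 * u y ^ 2) := by gcongr
      _ = _ := by ring
  have hgi : Integrable fun z => aff x R g z := by
    have : Integrable g.1 := (Sm.cont g).integrable_of_hasCompactSupport (hcs.mul _)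
    exact ((this.comp_add_left x).comp_smul hR.ne')
  calc _ ≤ ∫ z in ball (0 : Eu n) 1, (3 * R) ^ n * aff x R g z :=
        setIntegral_mono_on
          ((((Sm.cont _).pow 2).continuousOn.integrableOn_compact (isCompact_closedBall 0 1)).mono_set
            ball_subset_closedBall) (hgi.const_mul _).integrableOn measurableSet_ball hpt
    _ ≤ ∫ z, (3 * R) ^ n * aff x R g z :=
        setIntegral_le_integral (hgi.const_mul _)
          (Eventually.of_forall fun z => mul_nonneg (by positivity) (hg0 _))
    _ = (3 * R) ^ n * ((R ^ n)⁻¹ * ∫ y, g y) := by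
        rw [integral_const_mul]
        congr 1
        exact integral_comp_aff x hR g.1
    _ = _ := by
        rw [K_def, J_apply hcs, mul_pow]
        have : (R ^ n) * (R ^ n)⁻¹ = 1 := mul_inv_cancel₀ (by positivity)
        simp only [hg, Sm.mul_apply ρ]
        linear_combination (3 ^ n * ∫ y, ρ y * (w * w) y) * this

theorem Far.decay (h : Far p a β τ u) (hn : 5 ≤ n) (hI : IB τ (Wt τ β u * Wt τ β u)) :
    ∃ C R₀ : ℝ, 0 ≤ C ∧ 0 < R₀ ∧ ∀ x : Eu n, R₀ ≤ ‖x‖ → ∀ k : ℕ, k ≤ 3 →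
      ‖x‖ ^ (β + (k : ℝ)) * ‖iteratedFDeriv ℝ k u.1 x‖ ≤ C := by
  have hτ := h.hτ
  have hβ := h.β_pos
  obtain ⟨ε, C, hε, hC, hreg⟩ := eps_regularity_sq hn h.hp one_pos (3 ^ a)
  obtain ⟨T₁, hT₁⟩ := hI.tail hτ (fun x => by rw [Sm.mul_apply]; exact mul_self_nonneg _)
    (show 0 < ε / 3 ^ n by positivity)
  set T₂ := max T₁ (τ + 3) with hT₂
  refine ⟨2 ^ (β + 3) * C, 2 * Real.exp (T₂ + 4), by positivity, by positivity, fun x hx k hk => ?_⟩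
  set R := ‖x‖ / 2 with hR
  have hRe : Real.exp (T₂ + 4) ≤ R := by rw [hR]; linarith
  have hR0 : 0 < R := (Real.exp_pos _).trans_le hRe
  set T := Real.log R - 4 with hT
  have hTT : T₂ ≤ T := by
    have := (Real.le_log_iff_exp_le hR0).2 hRe
    linarith
  have hT1 : T₁ ≤ T := (le_max_left _ _).trans hTT
  have hT2 : τ + 3 ≤ T := (le_max_right _ _).trans hTT
  have hRT : Real.exp (T + 4) = R := by rw [hT, sub_add_cancel, Real.exp_log hR0]
  have hx2 : ‖x‖ = 2 * R := by rw [hR]; ring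
  have hwin := h.window hT2 (x := x) (by rw [hRT, hx2])
  rw [hRT] at hwin
  have hK := hT₁ T hT1 _ (plt_wn (τ := T + 1) (by linarith) (T + 4)) (plt_le_one _ _)
    fun t ht => ⟨by linarith [plt_far ht], by linarith [plt_near ht]⟩
  have hloc : Loc p 1 (3 ^ a) (R ^ β • aff x R u) := by
    refine ⟨_, h.scale x hR0 fun z hz => ?_, fun z hz => ?_, fun z hz => ?_⟩
    · refine lt_trans ?_ (norm_add_smul_mem hR0 hx2 hz).1
      rw [← hRT]
      exact Real.exp_lt_exp.2 (by linarith)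
    · exact Real.one_le_rpow ((one_le_div hR0).2 (norm_add_smul_mem hR0 hx2 hz).1.le) h.ha
    · exact Real.rpow_le_rpow (by positivity)
        ((div_le_iff₀ hR0).2 (norm_add_smul_mem hR0 hx2 hz).2.le) h.ha
  have hsmall : 3 ^ n * K (plt (T + 1) (T + 4)) (Wt τ β u * Wt τ β u) ≤ ε := by
    calc _ ≤ (3 : ℝ) ^ n * (ε / 3 ^ n) := by gcongr
      _ = ε := by field_simp
  have hfin := hreg _ hloc (hwin.trans hsmall) k hk
  rw [iteratedFDeriv_smul_aff, norm_smul, Real.norm_of_nonneg (by positivity),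
    ← Real.rpow_natCast R k, ← Real.rpow_add hR0] at hfin
  have hk3 : (k : ℝ) ≤ 3 := by exact_mod_cast hk
  rw [hx2, Real.mul_rpow (by norm_num) hR0.le, mul_assoc]
  have : (2 : ℝ) ^ (β + (k : ℝ)) ≤ 2 ^ (β + 3) :=
    Real.rpow_le_rpow_of_exponent_le (by norm_num) (by linarith)
  gcongr

end

noncomputable section
open scoped ENNReal
variable {n : ℕ} {p a β τ : ℝ} {u f g : Sm n}

lemma Far.square_integrable_of_range (h : Far p a β τ u) (hn : 5 ≤ n)
    (hsol : ∀ x, LP (LP u) x = ‖x‖ ^ a * |u x| ^ (p - 1) * u x)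
    (hrange : p ≤ ((n : ℝ) + 4 + 2 * a) / ((n : ℝ) - 4) ∨
      ((n : ℝ) * ((n : ℝ) - 4) / 2 < p * (2 * zc n β + 2 * dr n β) ∧
        (n : ℝ) ^ 2 * ((n : ℝ) - 4) ^ 2 / 16 < p * (zc n β * (zc n β + 2 * dr n β)))) :
    IB τ (Wt τ β u * Wt τ β u) := by
  have hn' : (5 : ℝ) ≤ n := by exact_mod_cast hn
  have hp := h.hp
  have hβ := h.hβ
  rcases lt_trichotomy (dr n β) 0 with hm | hm | hm
  · have h0 : IB τ (0 : Sm n) := (Bd.const 0).congr 0 fun T _ => map_zero _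
    refine h0.congr h.hτ fun x hx => ?_
    have hx0 : 0 < ‖x‖ := norm_pos_of_log (by linarith [h.hτ]) hx
    have hux : u x = 0 := by
      have := h.source_zero hm hsol x
      rw [Sm.mul_apply, hsol] at this
      by_contra hne
      have : u x * (‖x‖ ^ a * |u x| ^ (p - 1) * u x) ≠ 0 :=
        mul_ne_zero hne (mul_ne_zero (mul_ne_zero (Real.rpow_pos_of_pos hx0 _).ne'
          (Real.rpow_pos_of_pos (abs_pos.2 hne) _).ne') hne)
      contradiction
    rw [Sm.mul_apply, Wt_far h.hτ β u hx, hux, Sm.zero_apply]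
    ring
  · have hβ' : β = ((n : ℝ) - 4) / 2 := by rw [dr] at hm; linarith
    have hz : zc n β = n * (n - 4) / 4 := by rw [zc, hβ']; ring
    have hq : 0 < (n : ℝ) * (n - 4) := mul_pos (by linarith) (by linarith)
    refine h.square_integrable hn hm.ge ?_ ?_
    · rw [hm, hz]; nlinarith
    · rw [hm, hz]; nlinarith [mul_pos hq hq]
  · rcases hrange with hr | hr
    · exfalso
      rw [le_div_iff₀ (by linarith)] at hr
      rw [dr] at hm
      nlinarith
    · exact h.square_integrable hn hm.le hr.1 hr.2

lemma exists_far (hp : 1 < p) (ha : 0 ≤ a) (hβ : β * (p - 1) = 4 + a)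
    (hsol : ∀ x, LP (LP u) x = ‖x‖ ^ a * |u x| ^ (p - 1) * u x)
    (hstab : ∃ K : Set (Eu n), IsCompact K ∧ StableOn n a p u.1 Kᶜ) :
    ∃ τ, Far p a β τ u := by
  obtain ⟨S, hS, hst⟩ := hstab
  obtain ⟨ρ, hρ⟩ := hS.isBounded.exists_norm_le
  refine ⟨max 0 ρ, hp, ha, le_max_left _ _, hβ, fun x _ => hsol x, fun x _ => by positivity,
    fun ψ hψ hsupp => ?_⟩
  rw [← lap_eq]
  refine hst ψ.1 (Sm.smooth ψ) hψ fun x hx hxS => ?_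
  have h1 : Real.exp (max 0 ρ + 1) < ‖x‖ := hsupp hx
  have h2 := Real.add_one_le_exp (max 0 ρ + 1)
  linarith [hρ x hxS, le_max_right 0 ρ]

end

/-- Lemma 5.2: decay estimates `|u(x)| ≤ C|x|^(-β)` for `|x| ≥ R*`
and `Σ_{k≤3} |x|^(β+k) |∇^k u(x)| ≤ C` for `|x| ≥ 3R*`, for solutions stable outside
a compact set. -/
theorem stmt17 (n : ℕ) (hn : 5 ≤ n) (a p : ℝ) (ha : 0 ≤ a) (hp : 1 < p)
    (hrange : p ≤ ((n : ℝ) + 4 + 2 * a) / ((n : ℝ) - 4) ∨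
      (((n : ℝ) + 4 + 2 * a) / ((n : ℝ) - 4) < p ∧
        p * ell1 n a p > (n : ℝ) * ((n : ℝ) - 4) / 2 ∧
        p * ell2 n a p > (n : ℝ) ^ 2 * ((n : ℝ) - 4) ^ 2 / 16))
    (u : EuclideanSpace ℝ (Fin n) → ℝ) (hu : ContDiff ℝ (⊤ : ℕ∞) u)
    (hsol : IsSolutionOn n a p u Set.univ)
    (hstab : ∃ K : Set (EuclideanSpace ℝ (Fin n)), IsCompact K ∧ StableOn n a p u Kᶜ) :
    ∃ C Rstar : ℝ, 0 < Rstar ∧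
      (∀ x : EuclideanSpace ℝ (Fin n), Rstar ≤ ‖x‖ →
        |u x| ≤ C * ‖x‖ ^ (-((4 + a) / (p - 1)))) ∧
      (∀ x : EuclideanSpace ℝ (Fin n), 3 * Rstar ≤ ‖x‖ →
        ∑ k ∈ Finset.range 4,
          ‖x‖ ^ ((4 + a) / (p - 1) + (k : ℝ)) * ‖iteratedFDeriv ℝ k u x‖ ≤ C) := by
  set β := (4 + a) / (p - 1) with hβd
  have hβ : β * (p - 1) = 4 + a := div_mul_cancel₀ _ (by linarith)
  let U : Sm n := ⟨u, hu⟩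
  have hsol' : ∀ x, LP (LP U) x = ‖x‖ ^ a * |U x| ^ (p - 1) * U x := fun x => by
    have h1 := hsol x (mem_univ x)
    rw [show u = U.1 from rfl, lap_eq, lap_eq] at h1
    exact h1
  obtain ⟨τ, hfar⟩ := exists_far hp ha hβ hsol' hstab
  obtain ⟨C, R₀, hC, hR₀, hdec⟩ := hfar.decay hn (hfar.square_integrable_of_range hn hsol'
    (hrange.imp_right fun h => by rw [ell1_eq, ell2_eq]; exact h.2))
  refine ⟨4 * C, R₀, hR₀, fun x hx => ?_, fun x hx => ?_⟩
  · have h0 := hdec x hx 0 (by norm_num)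
    have hx0 : 0 < ‖x‖ := hR₀.trans_le hx
    rw [norm_iteratedFDeriv_zero, Nat.cast_zero, add_zero, Real.norm_eq_abs] at h0
    rw [Real.rpow_neg hx0.le, ← div_eq_mul_inv, le_div_iff₀ (by positivity), mul_comm]
    exact h0.trans (by linarith)
  · calc _ ≤ ∑ _k ∈ Finset.range 4, C := Finset.sum_le_sum fun k hk =>
          hdec x (by linarith) k (by rw [Finset.mem_range] at hk; omega)
      _ = 4 * C := by simp
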